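/- Let 𝒫^{sing} be the space of polynomials f = q_2 + q_3 + ... + q_M in M variables (q_i homogeneous of degree i), and 𝒫^{sing}_reg ⊂ 𝒫^{sing} the subset satisfying conditions (R2.1)–(R2.3). Then codim(closure(𝒫^{sing} \ 𝒫^{sing}_reg) ⊂ 𝒫^{sing}) = (M−7)(M−6)/2. -/

import Mathlib

/-!
Shared elementary framework: the Zariski topology on a complex vector space,
dimension of subsets (topological Krull dimension), rank of quadratic forms,
and the space 𝒫^sing of polynomials `f = q₂ + q₃ + ⋯ + q_M`.
-/

noncomputable section

open MvPolynomial

/-- A polynomial function on a complex vector space: a polynomial expression in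
finitely many linear functionals. -/
def IsPolyFun {E : Type*} [AddCommGroup E] [Module ℂ E] (g : E → ℂ) : Prop :=
  ∃ (n : ℕ) (φ : E →ₗ[ℂ] (Fin n → ℂ)) (p : MvPolynomial (Fin n) ℂ),
    ∀ v, g v = MvPolynomial.eval (φ v) p

/-- Zariski-closed subsets of a complex vector space: common zero loci of families
of polynomial functions. -/
def IsZClosed {E : Type*} [AddCommGroup E] [Module ℂ E] (A : Set E) : Prop :=
  ∃ G : Set (E → ℂ), (∀ g ∈ G, IsPolyFun g) ∧ A = {v | ∀ g ∈ G, g v = 0}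

/-- The Zariski topology on a complex vector space. -/
def zariskiTopology (E : Type*) [AddCommGroup E] [Module ℂ E] : TopologicalSpace E :=
  TopologicalSpace.generateFrom {U | IsZClosed Uᶜ}

/-- A subset is Zariski open. -/
def IsZOpen {E : Type*} [AddCommGroup E] [Module ℂ E] (A : Set E) : Prop :=
  @IsOpen E (zariskiTopology E) A

/-- The dimension of a subset of a complex vector space: the topological Krull
dimension in the induced Zariski topology. -/
def zdim {E : Type*} [AddCommGroup E] [Module ℂ E] (A : Set E) : WithBot ℕ∞ :=
  @topologicalKrullDim A (TopologicalSpace.induced Subtype.val (zariskiTopology E))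

/-- The Zariski closure of a subset of a complex vector space. -/
def zclosure {E : Type*} [AddCommGroup E] [Module ℂ E] (A : Set E) : Set E :=
  @closure E (zariskiTopology E) A

/-- The rank of the quadratic form `q` on a subset `A ⊆ ℂ^n`: the least number of
squares of linear forms expressing `q` on `A` (over `ℂ` this is the rank of the
restriction of `q`). -/
def rankOn {n : ℕ} (q : MvPolynomial (Fin n) ℂ) (A : Set (Fin n → ℂ)) : ℕ :=
  sInf {r : ℕ | ∃ l : Fin r → ((Fin n → ℂ) →ₗ[ℂ] ℂ),
    ∀ z ∈ A, MvPolynomial.eval z q = ∑ i, l i z ^ 2}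

/-- The space 𝒫^sing of polynomials `f = q₂ + q₃ + ⋯ + q_M` in `M` variables:
polynomials of total degree at most `M` whose homogeneous components of degree 0
and 1 vanish. -/
def Psing (M : ℕ) : Submodule ℂ (MvPolynomial (Fin M) ℂ) :=
  (MvPolynomial.restrictTotalDegree (Fin M) ℂ M) ⊓
    (LinearMap.ker (MvPolynomial.homogeneousComponent 0) ⊓
     LinearMap.ker (MvPolynomial.homogeneousComponent 1))

/-- Condition (R2.1): for every linear subspace `Π ⊆ ℂ^M` of codimension
`c ∈ {0,1,2}`, the sequence `q₂|_Π, …, q_{M−c}|_Π` is regular in the local ring at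
the origin, i.e. the system `q₂|_{ℙ(Π)} = ⋯ = q_{M−c}|_{ℙ(Π)} = 0` defines a finite
set of points in `ℙ(Π) ≅ ℙ^{M−c−1}`; equivalently the affine cone of common zeroes
in `Π` has dimension at most 1. -/
def CondR21 {M : ℕ} (f : MvPolynomial (Fin M) ℂ) : Prop :=
  ∀ c ∈ ({0, 1, 2} : Set ℕ), ∀ Pl : Submodule ℂ (Fin M → ℂ),
    Module.finrank ℂ ↥Pl = M - c →
      zdim {z : Fin M → ℂ | z ∈ Pl ∧ ∀ i ∈ Finset.Icc 2 (M - c),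
        MvPolynomial.eval z (MvPolynomial.homogeneousComponent i f) = 0} ≤ 1

/-- Condition (R2.2): the quadratic form `q₂` has rank at least 8. -/
def CondR22 {M : ℕ} (f : MvPolynomial (Fin M) ℂ) : Prop :=
  8 ≤ rankOn (MvPolynomial.homogeneousComponent 2 f) Set.univ

/-- Condition (R2.3): viewing `(z₁ : ⋯ : z_M)` as homogeneous coordinates on
`ℙ^{M−1}`, the divisor `{q₃|_{q₂=0} = 0}` on the quadric `{q₂ = 0}` is not a sum of
three (not necessarily distinct) hyperplane sections of this quadric taken from the
same linear pencil; i.e. there is no identity `q₃ = l₁l₂l₃ + l·q₂` with linear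
forms `l₁, l₂, l₃` lying in a pencil (a two-dimensional space of linear forms). -/
def CondR23 {M : ℕ} (f : MvPolynomial (Fin M) ℂ) : Prop :=
  ¬ ∃ a b l l₁ l₂ l₃ : MvPolynomial (Fin M) ℂ,
      a.IsHomogeneous 1 ∧ b.IsHomogeneous 1 ∧ l.IsHomogeneous 1 ∧
      l₁ ∈ Submodule.span ℂ ({a, b} : Set (MvPolynomial (Fin M) ℂ)) ∧
      l₂ ∈ Submodule.span ℂ ({a, b} : Set (MvPolynomial (Fin M) ℂ)) ∧
      l₃ ∈ Submodule.span ℂ ({a, b} : Set (MvPolynomial (Fin M) ℂ)) ∧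
      MvPolynomial.homogeneousComponent 3 f
        = l₁ * l₂ * l₃ + l * MvPolynomial.homogeneousComponent 2 f

/-- The subset `𝒫^sing_reg ⊆ 𝒫^sing` of polynomials satisfying (R2.1)–(R2.3). -/
def PsingReg (M : ℕ) : Set ↥(Psing M) :=
  {f | CondR21 (f : MvPolynomial (Fin M) ℂ) ∧ CondR22 (f : MvPolynomial (Fin M) ℂ) ∧
       CondR23 (f : MvPolynomial (Fin M) ℂ)}

section Algebra

variable {D : ℕ}

theorem height_eq_of_isMaximal_fin (s : ℕ) (m : Ideal (MvPolynomial (Fin s) ℂ)) [hm : m.IsMaximal] :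
    m.height = s := by
  induction s with
  | zero =>
    have h := ringKrullDim_mvPolynomial_of_isEmpty (R := ℂ) (Fin 0)
    rw [ringKrullDim_eq_zero_of_field] at h
    have h1 := Ideal.height_le_ringKrullDim_of_isPrime (I := m)
    rw [h] at h1
    have : m.height ≤ 0 := by exact_mod_cast h1
    simpa using this
  | succ s ih =>
    let e := (finSuccEquiv ℂ s).toRingEquiv
    have h1 : (m.map e).height = m.height := e.height_map m
    have : (m.map e).IsMaximal := Ideal.map_isMaximal_of_equiv e
    have hp : ((m.map e).under (MvPolynomial (Fin s) ℂ)).IsMaximal := by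
      exact Polynomial.isMaximal_comap_C_of_isJacobsonRing (m.map e)
    have hl : (m.map e).LiesOver ((m.map e).under (MvPolynomial (Fin s) ℂ)) := ⟨rfl⟩
    rw [← h1, Polynomial.height_eq_height_add_one ((m.map e).under (MvPolynomial (Fin s) ℂ)), ih]
    push_cast; rfl

/-- The transcendence degree of the coordinate ring of `P`. -/
def pdim (P : Ideal (MvPolynomial (Fin D) ℂ)) : ℕ :=
  Cardinal.toNat (Algebra.trdeg ℂ (MvPolynomial (Fin D) ℂ ⧸ P))

theorem noether_pdim (P : Ideal (MvPolynomial (Fin D) ℂ)) [hP : P.IsPrime] :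
    ∃ g : MvPolynomial (Fin (pdim P)) ℂ →ₐ[ℂ] (MvPolynomial (Fin D) ℂ ⧸ P),
      Function.Injective g ∧ g.IsIntegral ∧
        Algebra.trdeg ℂ (MvPolynomial (Fin D) ℂ ⧸ P) = pdim P := by
  obtain ⟨s, -, g, hg, hi⟩ := exists_integral_inj_algHom_of_quotient P hP.ne_top
  have ht : Algebra.trdeg ℂ (MvPolynomial (Fin D) ℂ ⧸ P) = s := by
    have hx : AlgebraicIndependent ℂ (fun i : Fin s => g (X i)) := by
      have : (aeval fun i : Fin s => g (X i)) = g := by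
        ext i; simp
      rw [AlgebraicIndependent, this]; exact hg
    have h_integral : Algebra.IsIntegral (Algebra.adjoin ℂ (Set.range fun i : Fin s => g (X i)))
        (MvPolynomial (Fin D) ℂ ⧸ P) := by
      constructor
      intro x
      obtain ⟨p, hp, hx⟩ := hi x
      have hr : ∀ y, g y ∈ Algebra.adjoin ℂ (Set.range fun i : Fin s => g (X i)) := by
        intro y
        rw [Algebra.adjoin_range_eq_range_aeval]
        refine ⟨y, ?_⟩
        have : (aeval fun i : Fin s => g (X i)) = g := by
          ext i; simp
        show (aeval fun i : Fin s => g (X i)) y = g y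
        rw [this]
      let g' : MvPolynomial (Fin s) ℂ →+* Algebra.adjoin ℂ (Set.range fun i : Fin s => g (X i)) :=
        (g.codRestrict _ hr).toRingHom
      refine ⟨p.map g', hp.map g', ?_⟩
      rw [Polynomial.eval₂_map]
      exact hx
    have : Algebra.IsAlgebraic (Algebra.adjoin ℂ (Set.range fun i : Fin s => g (X i)))
        (MvPolynomial (Fin D) ℂ ⧸ P) :=
      Algebra.IsIntegral.isAlgebraic
    have hb : IsTranscendenceBasis ℂ (fun i : Fin s => g (X i)) :=
      hx.isTranscendenceBasis_iff_isAlgebraic.mpr this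
    have := hb.lift_cardinalMk_eq_trdeg
    simpa using this.symm
  have hs : pdim P = s := by simp [pdim, ht]
  subst hs
  exact ⟨g, hg, hi, ht⟩

theorem pdim_le_height (P : Ideal (MvPolynomial (Fin D) ℂ)) [hP : P.IsPrime]
    (m : Ideal (MvPolynomial (Fin D) ℂ ⧸ P)) [hm : m.IsMaximal] :
    (pdim P : ℕ∞) ≤ m.height := by
  obtain ⟨g, hg, hi, -⟩ := noether_pdim P
  algebraize [g.toRingHom]
  have hinj : Function.Injective (algebraMap (MvPolynomial (Fin (pdim P)) ℂ)
    (MvPolynomial (Fin D) ℂ ⧸ P)) := hg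
  have : FaithfulSMul (MvPolynomial (Fin (pdim P)) ℂ) (MvPolynomial (Fin D) ℂ ⧸ P) :=
    (faithfulSMul_iff_algebraMap_injective _ _).mpr hinj
  have h_integral : Algebra.IsIntegral (MvPolynomial (Fin (pdim P)) ℂ) (MvPolynomial (Fin D) ℂ ⧸ P) :=
    ⟨hi⟩
  have : (m.under (MvPolynomial (Fin (pdim P)) ℂ)).IsMaximal :=
    Ideal.isMaximal_comap_of_isIntegral_of_isMaximal m
  rw [Ideal.height_eq_height_add_of_liesOver_of_hasGoingDown
    (m.under (MvPolynomial (Fin (pdim P)) ℂ)) m, height_eq_of_isMaximal_fin]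
  exact le_self_add

theorem ringKrullDim_quotient_eq_pdim (P : Ideal (MvPolynomial (Fin D) ℂ)) [hP : P.IsPrime] :
    ringKrullDim (MvPolynomial (Fin D) ℂ ⧸ P) = pdim P := by
  apply le_antisymm
  · obtain ⟨g, hg, hi, -⟩ := noether_pdim P
    algebraize [g.toRingHom]
    have h_integral : Algebra.IsIntegral (MvPolynomial (Fin (pdim P)) ℂ) (MvPolynomial (Fin D) ℂ ⧸ P) :=
      ⟨hi⟩
    have h0 : ringKrullDim (MvPolynomial (Fin (pdim P)) ℂ) = pdim P := by
      rw [MvPolynomial.ringKrullDim_of_isNoetherianRing, ringKrullDim_eq_zero_of_field]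
      simp
    rw [← h0]
    refine Order.krullDim_le_of_strictMono
      (fun p => PrimeSpectrum.comap (algebraMap (MvPolynomial (Fin (pdim P)) ℂ) _) p) ?_
    intro p q hpq
    exact Ideal.IsIntegral.comap_lt_comap (R := MvPolynomial (Fin (pdim P)) ℂ) (I := p.asIdeal)
      (J := q.asIdeal) hpq
  · obtain ⟨m, hm⟩ := Ideal.exists_maximal (MvPolynomial (Fin D) ℂ ⧸ P)
    refine le_trans ?_ (Ideal.height_le_ringKrullDim_of_isPrime (I := m))
    exact_mod_cast pdim_le_height P m

theorem pdim_lt_of_lt {P Q : Ideal (MvPolynomial (Fin D) ℂ)} [hP : P.IsPrime] [hQ : Q.IsPrime]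
    (h : P < Q) : pdim Q + 1 ≤ pdim P := by
  obtain ⟨x, hxQ, hxP⟩ := Set.exists_of_ssubset h
  have := ringKrullDim_succ_le_of_surjective (Ideal.Quotient.factor h.le)
    (Ideal.Quotient.factor_surjective h.le) (r := Ideal.Quotient.mk P x)
    (by
      rw [mem_nonZeroDivisors_iff_ne_zero]
      simpa [Ideal.Quotient.eq_zero_iff_mem] using hxP)
    (by
      rw [Ideal.Quotient.factor_mk]
      exact Ideal.Quotient.eq_zero_iff_mem.mpr hxQ)
  rw [ringKrullDim_quotient_eq_pdim, ringKrullDim_quotient_eq_pdim] at this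
  exact_mod_cast this

theorem exists_dependent_of_pdim_le (P : Ideal (MvPolynomial (Fin D) ℂ)) [hP : P.IsPrime] {d : ℕ}
    (hd : pdim P ≤ d) (f : Fin (d + 1) → MvPolynomial (Fin D) ℂ) :
    ∃ F : MvPolynomial (Fin (d + 1)) ℂ, F ≠ 0 ∧ aeval f F ∈ P := by
  by_contra! hcon
  have hx : AlgebraicIndependent ℂ (fun i => Ideal.Quotient.mkₐ ℂ P (f i)) := by
    rw [algebraicIndependent_iff]
    intro F hF
    by_contra h0
    apply hcon F h0
    rw [← Ideal.Quotient.eq_zero_iff_mem, ← hF]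
    show Ideal.Quotient.mkₐ ℂ P _ = _
    rw [← AlgHom.comp_apply]
    congr 1
    ext i; simp
  have h1 := hx.lift_cardinalMk_le_trdeg
  obtain ⟨-, -, -, ht⟩ := noether_pdim P
  rw [ht] at h1
  simp only [Cardinal.mk_fin, Cardinal.lift_natCast, Nat.cast_le] at h1
  have : d + 1 ≤ pdim P := by simpa using h1
  omega

theorem le_pdim_of_independent (P : Ideal (MvPolynomial (Fin D) ℂ)) [hP : P.IsPrime] {d : ℕ}
    (f : Fin d → MvPolynomial (Fin D) ℂ)
    (hf : ∀ F : MvPolynomial (Fin d) ℂ, aeval f F ∈ P → F = 0) : d ≤ pdim P := by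
  by_contra! hd
  obtain ⟨k, rfl⟩ : ∃ k, d = k + 1 := ⟨d - 1, by omega⟩
  obtain ⟨F, hF, hFP⟩ := exists_dependent_of_pdim_le P (d := k) (by omega) f
  exact hF (hf F hFP)

theorem exists_independent_pdim (P : Ideal (MvPolynomial (Fin D) ℂ)) [hP : P.IsPrime] :
    ∃ f : Fin (pdim P) → MvPolynomial (Fin D) ℂ,
      ∀ F : MvPolynomial (Fin (pdim P)) ℂ, aeval f F ∈ P → F = 0 := by
  obtain ⟨g, hg, -, -⟩ := noether_pdim P
  choose f hf using fun i => Ideal.Quotient.mk_surjective (I := P) (g (X i))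
  refine ⟨f, fun F hF => ?_⟩
  apply hg
  rw [map_zero, ← Ideal.Quotient.eq_zero_iff_mem.mpr hF]
  show g F = (Ideal.Quotient.mkₐ ℂ P) (aeval f F)
  rw [← AlgHom.comp_apply]
  congr 1
  ext i; simp [hf]

/-- Krull's height theorem combined with equidimensionality of affine domains. -/
theorem pdim_le_card_of_mem_minimalPrimes {P m : Ideal (MvPolynomial (Fin D) ℂ)} [hP : P.IsPrime]
    [hm : m.IsMaximal] {n : ℕ} (g : Fin n → MvPolynomial (Fin D) ℂ)
    (hmin : m ∈ (P ⊔ Ideal.span (Set.range g)).minimalPrimes) : pdim P ≤ n := by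
  have hPm : P ≤ m := le_trans le_sup_left hmin.1.2
  have hker : RingHom.ker (Ideal.Quotient.mk P) ≤ m := by rwa [Ideal.mk_ker]
  have hm' : (m.map (Ideal.Quotient.mk P)).IsMaximal :=
    Ideal.IsMaximal.map_of_surjective_of_ker_le Ideal.Quotient.mk_surjective hker
  have h1 := pdim_le_height P (m.map (Ideal.Quotient.mk P))
  have h2 : m.map (Ideal.Quotient.mk P) ∈
      (Ideal.span (Set.range fun i => Ideal.Quotient.mk P (g i))).minimalPrimes := by
    refine ⟨⟨hm'.isPrime, ?_⟩, ?_⟩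
    · rw [Ideal.span_le]
      rintro _ ⟨i, rfl⟩
      exact Ideal.mem_map_of_mem _ (hmin.1.2 (Ideal.mem_sup_right (Ideal.subset_span ⟨i, rfl⟩)))
    · rintro Q ⟨hQ, hQ1⟩ hQm
      have hc : (Q.comap (Ideal.Quotient.mk P)) ≤ m := by
        have := Ideal.comap_mono (f := Ideal.Quotient.mk P) hQm
        rwa [Ideal.comap_map_of_surjective' _ Ideal.Quotient.mk_surjective,
          sup_eq_left.mpr hker] at this
      have h3 := hmin.2 ⟨hQ.comap (Ideal.Quotient.mk P), ?_⟩ hc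
      · exact Ideal.map_le_iff_le_comap.mpr h3
      · refine sup_le ?_ ?_
        · intro x hx
          rw [Ideal.mem_comap, Ideal.Quotient.eq_zero_iff_mem.mpr hx]; exact Q.zero_mem
        · rw [Ideal.span_le]
          rintro _ ⟨i, rfl⟩
          exact hQ1 (Ideal.subset_span ⟨i, rfl⟩)
  have h3 := Ideal.height_le_card_of_mem_minimalPrimes_span (Set.finite_range _) h2
  have h4 : (Set.range fun i => Ideal.Quotient.mk P (g i)).ncard ≤ n := by
    rw [← Set.image_univ]
    refine (Set.ncard_image_le Set.finite_univ).trans ?_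
    simp [Set.ncard_univ]
  have h5 := h1.trans h3
  have h6 : pdim P ≤ (Set.range fun i => Ideal.Quotient.mk P (g i)).ncard := by exact_mod_cast h5
  exact h6.trans h4

end Algebra

section PolyFun

variable {E : Type*} [AddCommGroup E] [Module ℂ E]
variable {E' : Type*} [AddCommGroup E'] [Module ℂ E']

theorem IsPolyFun.const (c : ℂ) : IsPolyFun (fun _ : E => c) :=
  ⟨0, 0, C c, fun v => by simp⟩

theorem IsPolyFun.linear (φ : E →ₗ[ℂ] ℂ) : IsPolyFun (fun v => φ v) :=
  ⟨1, LinearMap.pi fun _ => φ, X 0, fun v => by simp⟩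

theorem IsPolyFun.comp_linear {g : E → ℂ} (hg : IsPolyFun g) (L : E' →ₗ[ℂ] E) :
    IsPolyFun (fun v => g (L v)) := by
  obtain ⟨n, φ, p, h⟩ := hg
  exact ⟨n, φ ∘ₗ L, p, fun v => h (L v)⟩

/-- Linear coordinates on a finite-dimensional space. -/
def coordE (E : Type*) [AddCommGroup E] [Module ℂ E] [FiniteDimensional ℂ E] :
    E ≃ₗ[ℂ] (Fin (Module.finrank ℂ E) → ℂ) :=
  (Module.finBasis ℂ E).equivFun

section Two

variable {g h : E → ℂ}

theorem IsPolyFun.exists_common (hg : IsPolyFun g) (hh : IsPolyFun h) :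
    ∃ (ι : Type) (_ : Fintype ι) (φ : E →ₗ[ℂ] (ι → ℂ)) (p q : MvPolynomial ι ℂ),
      (∀ v, g v = eval (φ v) p) ∧ ∀ v, h v = eval (φ v) q := by
  obtain ⟨n, φ, p, hp⟩ := hg
  obtain ⟨m, ψ, q, hq⟩ := hh
  refine ⟨Fin n ⊕ Fin m, inferInstance,
    LinearMap.pi (Sum.elim (fun i => LinearMap.proj i ∘ₗ φ) (fun i => LinearMap.proj i ∘ₗ ψ)),
    rename Sum.inl p, rename Sum.inr q, fun v => ?_, fun v => ?_⟩
  · rw [eval_rename, hp]; rfl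
  · rw [eval_rename, hq]; rfl

theorem IsPolyFun.of_fintype {ι : Type*} [Fintype ι] (φ : E →ₗ[ℂ] (ι → ℂ)) (p : MvPolynomial ι ℂ)
    (hp : ∀ v, g v = eval (φ v) p) : IsPolyFun g := by
  let e := Fintype.equivFin ι
  refine ⟨Fintype.card ι, LinearMap.funLeft ℂ ℂ e.symm ∘ₗ φ, rename e p, fun v => ?_⟩
  rw [hp, eval_rename]
  congr 2
  ext i; simp [LinearMap.funLeft]

theorem IsPolyFun.add (hg : IsPolyFun g) (hh : IsPolyFun h) : IsPolyFun (fun v => g v + h v) := by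
  obtain ⟨ι, _, φ, p, q, hp, hq⟩ := hg.exists_common hh
  exact .of_fintype φ (p + q) fun v => by rw [hp, hq, map_add]

theorem IsPolyFun.mul (hg : IsPolyFun g) (hh : IsPolyFun h) : IsPolyFun (fun v => g v * h v) := by
  obtain ⟨ι, _, φ, p, q, hp, hq⟩ := hg.exists_common hh
  exact .of_fintype φ (p * q) fun v => by rw [hp, hq, map_mul]

end Two

theorem IsPolyFun.sum {ι : Type*} (s : Finset ι) {g : ι → E → ℂ} (hg : ∀ i ∈ s, IsPolyFun (g i)) :
    IsPolyFun (fun v => ∑ i ∈ s, g i v) := by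
  classical
  induction s using Finset.induction_on with
  | empty => simpa using IsPolyFun.const 0
  | insert a s ha ih =>
    simp_rw [Finset.sum_insert ha]
    exact (hg a (by simp)).add (ih fun i hi => hg i (by simp [hi]))

theorem IsPolyFun.prod {ι : Type*} (s : Finset ι) {g : ι → E → ℂ} (hg : ∀ i ∈ s, IsPolyFun (g i)) :
    IsPolyFun (fun v => ∏ i ∈ s, g i v) := by
  classical
  induction s using Finset.induction_on with
  | empty => simpa using IsPolyFun.const 1
  | insert a s ha ih =>
    simp_rw [Finset.prod_insert ha]
    exact (hg a (by simp)).mul (ih fun i hi => hg i (by simp [hi]))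

theorem IsPolyFun.eval {σ : Type*} {g : σ → E → ℂ} (hg : ∀ i, IsPolyFun (g i))
    (p : MvPolynomial σ ℂ) : IsPolyFun (fun v => MvPolynomial.eval (fun i => g i v) p) := by
  induction p using MvPolynomial.induction_on with
  | C c => simpa using IsPolyFun.const c
  | add p q hp hq => simp_rw [map_add]; exact hp.add hq
  | mul_X p i hp => simp_rw [map_mul, eval_X]; exact hp.mul (hg i)

theorem IsPolyFun.det {ι : Type*} [Fintype ι] [DecidableEq ι] {A : E → Matrix ι ι ℂ}
    (hA : ∀ i j, IsPolyFun (fun v => A v i j)) : IsPolyFun (fun v => (A v).det) := by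
  simp_rw [Matrix.det_apply']
  exact .sum _ fun σ _ => (IsPolyFun.const _).mul (.prod _ fun i _ => hA _ _)

/-- The polynomial function attached to a polynomial in the chosen coordinates. -/
theorem isPolyFun_iff [FiniteDimensional ℂ E] {g : E → ℂ} :
    IsPolyFun g ↔ ∃ p : MvPolynomial (Fin (Module.finrank ℂ E)) ℂ,
      ∀ v, g v = MvPolynomial.eval (coordE E v) p := by
  constructor
  · rintro ⟨n, φ, p, hp⟩
    let b := Module.finBasis ℂ E
    refine ⟨aeval (fun i : Fin n => ∑ j, C (φ (b j) i) * X j) p, fun v => ?_⟩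
    rw [hp]
    rw [← MvPolynomial.coe_aeval_eq_eval, ← MvPolynomial.coe_aeval_eq_eval]
    simp only [RingHom.coe_coe]
    rw [← AlgHom.comp_apply, comp_aeval]
    congr 2
    ext i
    have := congrFun (congrArg φ (b.sum_equivFun v)) i
    simp only [aeval_X, map_sum, map_mul, aeval_C, Algebra.algebraMap_self, RingHom.id_apply]
    rw [← this, map_sum, Finset.sum_apply]
    exact Finset.sum_congr rfl fun j _ => by
      rw [map_smul, Pi.smul_apply, smul_eq_mul, mul_comm]; rfl
  · rintro ⟨p, hp⟩
    exact .of_fintype (coordE E).toLinearMap p hp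

/-- A map all of whose polynomial pullbacks are polynomial. -/
def IsPolyMap (Φ : E' → E) : Prop := ∀ φ : E →ₗ[ℂ] ℂ, IsPolyFun (fun v => φ (Φ v))

theorem IsPolyFun.comp {g : E → ℂ} (hg : IsPolyFun g) {Φ : E' → E} (hΦ : IsPolyMap Φ) :
    IsPolyFun (fun v => g (Φ v)) := by
  obtain ⟨n, φ, p, hp⟩ := hg
  simp_rw [hp]
  exact IsPolyFun.eval (g := fun i v => φ (Φ v) i) (fun i => hΦ (LinearMap.proj i ∘ₗ φ)) p

end PolyFun

section Closed

variable {E : Type*} [AddCommGroup E] [Module ℂ E]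

theorem IsZClosed.iInter {ι : Sort*} {A : ι → Set E} (h : ∀ i, IsZClosed (A i)) :
    IsZClosed (⋂ i, A i) := by
  choose G hG hA using h
  refine ⟨⋃ i, G i, ?_, ?_⟩
  · simp only [Set.mem_iUnion]
    rintro g ⟨i, hi⟩
    exact hG i g hi
  · ext v
    simp only [Set.mem_iInter, Set.mem_iUnion, Set.mem_ofPred_eq, hA]
    exact ⟨fun h g ⟨i, hi⟩ => h i g hi, fun h i g hi => h g ⟨i, hi⟩⟩

theorem IsZClosed.union {A B : Set E} (hA : IsZClosed A) (hB : IsZClosed B) :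
    IsZClosed (A ∪ B) := by
  obtain ⟨G, hG, rfl⟩ := hA
  obtain ⟨H, hH, rfl⟩ := hB
  refine ⟨{k | ∃ g ∈ G, ∃ h ∈ H, k = fun v => g v * h v}, ?_, ?_⟩
  · rintro _ ⟨g, hg, h, hh, rfl⟩
    exact (hG g hg).mul (hH h hh)
  · ext v
    constructor
    · rintro (h | h) _ ⟨g, hg, k, hk, rfl⟩
      · simp [h g hg]
      · simp [h k hk]
    · intro h
      by_contra hcon
      simp only [Set.mem_union, Set.mem_ofPred_eq, not_or, not_forall] at hcon
      obtain ⟨⟨g, hg, hgv⟩, ⟨k, hk, hkv⟩⟩ := hcon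
      have := h _ ⟨g, hg, k, hk, rfl⟩
      simp only [mul_eq_zero] at this
      tauto

theorem isZClosed_empty : IsZClosed (∅ : Set E) :=
  ⟨{fun _ => 1}, by rintro _ rfl; exact .const 1, by ext; simp⟩

theorem isClosed_zariski_iff {A : Set E} : @IsClosed E (zariskiTopology E) A ↔ IsZClosed A := by
  constructor
  · intro h
    have h2 : TopologicalSpace.GenerateOpen {U : Set E | IsZClosed Uᶜ} Aᶜ :=
      (@isOpen_compl_iff E A (zariskiTopology E)).mpr h
    rw [← compl_compl A]
    generalize Aᶜ = U at h2
    induction h2 with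
    | basic s hs => exact hs
    | univ => simpa using isZClosed_empty
    | inter s t _ _ hs ht => rw [Set.compl_inter]; exact hs.union ht
    | sUnion S _ h =>
      rw [Set.compl_sUnion, Set.sInter_image]
      exact .iInter fun s => .iInter fun hs => h s hs
  · intro h
    rw [← @isOpen_compl_iff E A (zariskiTopology E)]
    exact TopologicalSpace.GenerateOpen.basic _ (by simpa using h)

theorem isZClosed_zclosure (A : Set E) : IsZClosed (zclosure A) :=
  isClosed_zariski_iff.mp (@isClosed_closure E (zariskiTopology E) A)

theorem subset_zclosure (A : Set E) : A ⊆ zclosure A := @subset_closure E (zariskiTopology E) A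

theorem zclosure_subset {A B : Set E} (h : A ⊆ B) (hB : IsZClosed B) : zclosure A ⊆ B :=
  @closure_minimal E (zariskiTopology E) A B h (isClosed_zariski_iff.mpr hB)

theorem isClosed_zariski_subtype_iff {A : Set E} {Z : Set A} :
    @IsClosed A (TopologicalSpace.induced Subtype.val (zariskiTopology E)) Z ↔
      ∃ C : Set E, IsZClosed C ∧ Subtype.val ⁻¹' C = Z := by
  rw [@_root_.isClosed_induced_iff A E (zariskiTopology E)]
  simp_rw [isClosed_zariski_iff]

/-- Any `d + 1` polynomial functions are algebraically dependent on `A`. -/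
def AD (A : Set E) (d : ℕ) : Prop :=
  ∀ f : Fin (d + 1) → E → ℂ, (∀ i, IsPolyFun (f i)) →
    ∃ F : MvPolynomial (Fin (d + 1)) ℂ, F ≠ 0 ∧ ∀ a ∈ A, eval (fun i => f i a) F = 0

theorem AD.mono {A B : Set E} {d : ℕ} (h : AD B d) (hAB : A ⊆ B) : AD A d := by
  intro f hf
  obtain ⟨F, h0, h1⟩ := h f hf
  exact ⟨F, h0, fun a ha => h1 a (hAB ha)⟩

theorem AD.mono_dim {A : Set E} {d e : ℕ} (h : AD A d) (hde : d ≤ e) : AD A e := by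
  intro f hf
  have hle : d + 1 ≤ e + 1 := by omega
  obtain ⟨F, h0, h1⟩ := h (fun i => f (Fin.castLE hle i)) fun i => hf _
  refine ⟨rename (Fin.castLE hle) F, fun hz => h0 ?_, fun a ha => ?_⟩
  · rw [← map_zero (rename (Fin.castLE hle))] at hz
    exact rename_injective _ (Fin.castLE_injective hle) hz
  · rw [eval_rename]; exact h1 a ha

theorem AD.union {A B : Set E} {d : ℕ} (hA : AD A d) (hB : AD B d) : AD (A ∪ B) d := by
  intro f hf
  obtain ⟨F, h0, h1⟩ := hA f hf
  obtain ⟨G, g0, g1⟩ := hB f hf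
  refine ⟨F * G, mul_ne_zero h0 g0, ?_⟩
  rintro a (ha | ha)
  · simp [h1 a ha]
  · simp [g1 a ha]

theorem AD.empty (d : ℕ) : AD (∅ : Set E) d := fun _ _ => ⟨1, one_ne_zero, by simp⟩

theorem AD.biUnion {ι : Type*} (s : Finset ι) {A : ι → Set E} {d : ℕ}
    (h : ∀ i ∈ s, AD (A i) d) : AD (⋃ i ∈ s, A i) d := by
  classical
  induction s using Finset.induction_on with
  | empty => simpa using AD.empty d
  | insert a s ha ih =>
    rw [Finset.set_biUnion_insert]
    exact (h a (by simp)).union (ih fun i hi => h i (by simp [hi]))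

theorem AD.iUnion {ι : Type*} [Finite ι] {A : ι → Set E} {d : ℕ}
    (h : ∀ i, AD (A i) d) : AD (⋃ i, A i) d := by
  have := Fintype.ofFinite ι
  have := AD.biUnion Finset.univ fun i _ => h i
  simpa using this

theorem AD.image {E' : Type*} [AddCommGroup E'] [Module ℂ E'] {A : Set E} {d : ℕ} (h : AD A d)
    {Φ : E → E'} (hΦ : IsPolyMap Φ) : AD (Φ '' A) d := by
  intro f hf
  obtain ⟨F, h0, h1⟩ := h (fun i v => f i (Φ v)) fun i => (hf i).comp hΦ
  refine ⟨F, h0, ?_⟩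
  rintro _ ⟨a, ha, rfl⟩
  exact h1 a ha

variable [FiniteDimensional ℂ E]

/-- The ideal of polynomials (in the chosen coordinates) vanishing on `A`. -/
def vI (A : Set E) : Ideal (MvPolynomial (Fin (Module.finrank ℂ E)) ℂ) where
  carrier := {p | ∀ v ∈ A, eval (coordE E v) p = 0}
  zero_mem' := by simp
  add_mem' {p q} hp hq v hv := by simp [hp v hv, hq v hv]
  smul_mem' c p hp v hv := by simp [hp v hv]

/-- The zero set of an ideal (in the chosen coordinates). -/
def vZ (I : Ideal (MvPolynomial (Fin (Module.finrank ℂ E)) ℂ)) : Set E :=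
  {v | ∀ p ∈ I, eval (coordE E v) p = 0}

theorem mem_vI {A : Set E} {p : MvPolynomial (Fin (Module.finrank ℂ E)) ℂ} :
    p ∈ vI A ↔ ∀ v ∈ A, eval (coordE E v) p = 0 := Iff.rfl

theorem vI_anti {A B : Set E} (h : A ⊆ B) : vI B ≤ vI A := fun _ hp v hv => hp v (h hv)

theorem isZClosed_vZ (I : Ideal (MvPolynomial (Fin (Module.finrank ℂ E)) ℂ)) :
    IsZClosed (vZ (E := E) I) := by
  refine ⟨{g | ∃ p ∈ I, g = fun v => eval (coordE E v) p}, ?_, ?_⟩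
  · rintro _ ⟨p, _, rfl⟩
    exact isPolyFun_iff.mpr ⟨p, fun _ => rfl⟩
  · ext v
    constructor
    · rintro h _ ⟨p, hp, rfl⟩
      exact h p hp
    · exact fun h p hp => h _ ⟨p, hp, rfl⟩

theorem IsZClosed.vZ_vI {A : Set E} (hA : IsZClosed A) : vZ (vI A) = A := by
  apply le_antisymm
  · obtain ⟨G, hG, rfl⟩ := hA
    intro v hv g hg
    obtain ⟨p, hp⟩ := isPolyFun_iff.mp (hG g hg)
    rw [hp]
    exact hv p fun w hw => by rw [← hp]; exact hw g hg
  · exact fun v hv p hp => hp v hv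

theorem zclosure_eq (A : Set E) : zclosure A = vZ (vI A) := by
  apply le_antisymm
  · exact zclosure_subset (fun v hv p hp => hp v hv) (isZClosed_vZ _)
  · rw [← (isZClosed_zclosure A).vZ_vI]
    exact fun v hv p hp => hv p (vI_anti (subset_zclosure A) hp)

theorem vI_zclosure (A : Set E) : vI (zclosure A) = vI A := by
  apply le_antisymm (vI_anti (subset_zclosure A))
  intro p hp v hv
  rw [zclosure_eq] at hv
  exact hv p hp

theorem vI_vZ_of_isPrime (P : Ideal (MvPolynomial (Fin (Module.finrank ℂ E)) ℂ)) [P.IsPrime] :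
    vI (vZ (E := E) P) = P := by
  conv_rhs => rw [← IsPrime.vanishingIdeal_zeroLocus (K := ℂ) P]
  ext p
  rw [mem_vI, mem_vanishingIdeal_iff]
  constructor
  · intro h x hx
    have := h ((coordE E).symm x) fun q hq => by simpa [coe_aeval_eq_eval] using hx q hq
    simpa [coe_aeval_eq_eval] using this
  · intro h v hv
    exact h _ hv

theorem isRadical_vI (A : Set E) : (vI A).IsRadical := by
  rintro p ⟨n, hn⟩ v hv
  have := hn v hv
  rw [map_pow] at this
  exact eq_zero_of_pow_eq_zero this

theorem eval_aeval {σ τ : Type*} (x : τ → ℂ) (f : σ → MvPolynomial τ ℂ) (F : MvPolynomial σ ℂ) :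
    eval x (aeval f F) = eval (fun i => eval x (f i)) F := by
  rw [← coe_aeval_eq_eval, ← coe_aeval_eq_eval]
  simp only [RingHom.coe_coe]
  rw [← AlgHom.comp_apply, comp_aeval]

theorem AD.pdim_le {A : Set E} {d : ℕ} (h : AD A d)
    (P : Ideal (MvPolynomial (Fin (Module.finrank ℂ E)) ℂ)) [P.IsPrime] (hP : vI A ≤ P) :
    pdim P ≤ d := by
  by_contra! hd
  obtain ⟨f, hf⟩ := exists_independent_pdim P
  have hle : d + 1 ≤ pdim P := hd
  obtain ⟨F, hF0, hF⟩ := h (fun i v => eval (coordE E v) (f (Fin.castLE hle i)))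
    fun i => isPolyFun_iff.mpr ⟨_, fun _ => rfl⟩
  apply hF0
  have h1 : aeval f (rename (Fin.castLE hle) F) ∈ P := by
    apply hP
    intro v hv
    rw [aeval_rename, eval_aeval]
    exact hF v hv
  have := hf _ h1
  rw [← map_zero (rename (Fin.castLE hle))] at this
  exact rename_injective _ (Fin.castLE_injective hle) this

theorem ad_of_minimalPrimes {A : Set E} {d : ℕ}
    (h : ∀ P ∈ (vI A).minimalPrimes, pdim P ≤ d) : AD A d := by
  intro f hf
  choose p hp using fun i => isPolyFun_iff.mp (hf i)
  have hfin := (vI A).finite_minimalPrimes_of_isNoetherianRing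
  have key : ∀ P ∈ (vI A).minimalPrimes, ∃ F : MvPolynomial (Fin (d + 1)) ℂ, F ≠ 0 ∧
      aeval p F ∈ P := fun P hP =>
    have := hP.1.1
    exists_dependent_of_pdim_le P (h P hP) p
  choose! F hF0 hF using key
  refine ⟨∏ P ∈ hfin.toFinset, F P, Finset.prod_ne_zero_iff.mpr fun P hP => hF0 P (by simpa using hP),
    ?_⟩
  have hmem : aeval p (∏ P ∈ hfin.toFinset, F P) ∈ vI A := by
    suffices hs : ∀ P ∈ (vI A).minimalPrimes, aeval p (∏ P ∈ hfin.toFinset, F P) ∈ P by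
      have := Ideal.mem_sInf.mpr fun {P} hP => hs P hP
      rwa [Ideal.sInf_minimalPrimes, (isRadical_vI A).radical] at this
    intro P hP
    rw [map_prod]
    have := Finset.dvd_prod_of_mem (fun P => aeval p (F P)) (hfin.mem_toFinset.mpr hP)
    exact P.mem_of_dvd this (hF P hP)
  intro a ha
  have := hmem a ha
  rw [eval_aeval] at this
  rw [← this]
  congr 2
  ext i
  exact hp i a

theorem AD.zclosure {A : Set E} {d : ℕ} (h : AD A d) : AD (zclosure A) d := by
  apply ad_of_minimalPrimes
  intro P hP
  have := hP.1.1
  exact h.pdim_le P (by rw [← vI_zclosure]; exact hP.1.2)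

theorem AD.of_finrank (A : Set E) : AD A (Module.finrank ℂ E) := by
  intro f hf
  choose p hp using fun i => isPolyFun_iff.mp (hf i)
  have hb : (⊥ : Ideal (MvPolynomial (Fin (Module.finrank ℂ E)) ℂ)).IsPrime := Ideal.isPrime_bot
  have hd : pdim (⊥ : Ideal (MvPolynomial (Fin (Module.finrank ℂ E)) ℂ)) ≤ Module.finrank ℂ E := by
    have h1 := ringKrullDim_quotient_eq_pdim (⊥ : Ideal (MvPolynomial (Fin (Module.finrank ℂ E)) ℂ))
    have h2 := ringKrullDim_quotient_le (⊥ : Ideal (MvPolynomial (Fin (Module.finrank ℂ E)) ℂ))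
    rw [h1, MvPolynomial.ringKrullDim_of_isNoetherianRing, ringKrullDim_eq_zero_of_field] at h2
    simp only [zero_add, Nat.card_fin] at h2
    exact_mod_cast h2
  obtain ⟨F, h0, h1⟩ := exists_dependent_of_pdim_le _ hd p
  refine ⟨F, h0, fun a _ => ?_⟩
  rw [Ideal.mem_bot] at h1
  have h2 := congrArg (eval (coordE E a)) h1
  rw [eval_aeval, map_zero] at h2
  rw [← h2]
  congr 2
  ext i
  exact hp i a

theorem AD.of_finrank_le (A : Set E) {d : ℕ} (h : Module.finrank ℂ E ≤ d) : AD A d :=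
  (AD.of_finrank A).mono_dim h

end Closed

section ZDim

variable {E : Type*} [AddCommGroup E] [Module ℂ E] [FiniteDimensional ℂ E]

theorem isPrime_vI_of_isIrreducible {A : Set E} {Z : Set A}
    (hZ : @IsIrreducible A (TopologicalSpace.induced Subtype.val (zariskiTopology E)) Z) :
    (vI (Subtype.val '' Z)).IsPrime := by
  let := TopologicalSpace.induced (Subtype.val : A → E) (zariskiTopology E)
  obtain ⟨⟨z, hz⟩, hirr⟩ := hZ
  rw [isPreirreducible_iff_isClosed_union_isClosed] at hirr
  refine Ideal.isPrime_iff.mpr ⟨fun h => ?_, fun {p q} hpq => ?_⟩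
  · have : (1 : MvPolynomial (Fin (Module.finrank ℂ E)) ℂ) ∈ vI (Subtype.val '' Z) := by
      rw [h]; trivial
    simpa using this z ⟨z, hz, rfl⟩
  · have hcl : ∀ p : MvPolynomial (Fin (Module.finrank ℂ E)) ℂ,
        IsClosed {a : A | eval (coordE E a) p = 0} := fun p => by
      refine isClosed_zariski_subtype_iff.mpr ⟨{v | eval (coordE E v) p = 0}, ⟨{fun v => eval (coordE E v) p},
        ?_, ?_⟩, rfl⟩
      · rintro _ rfl
        exact isPolyFun_iff.mpr ⟨p, fun _ => rfl⟩
      · ext; simp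
    rcases hirr _ _ (hcl p) (hcl q) (fun a ha => by
      have := hpq a ⟨a, ha, rfl⟩
      rw [map_mul, mul_eq_zero] at this
      exact this) with h | h
    · left; rintro _ ⟨a, ha, rfl⟩; exact h ha
    · right; rintro _ ⟨a, ha, rfl⟩; exact h ha

theorem AD.zdim_le {A : Set E} {d : ℕ} (h : AD A d) : zdim A ≤ d := by
  let := TopologicalSpace.induced (Subtype.val : A → E) (zariskiTopology E)
  have hpr : ∀ Z : TopologicalSpace.IrreducibleCloseds A, (vI (Subtype.val '' (Z : Set A))).IsPrime :=
    fun Z => isPrime_vI_of_isIrreducible Z.isIrreducible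
  have hd : ∀ Z : TopologicalSpace.IrreducibleCloseds A, pdim (vI (Subtype.val '' (Z : Set A))) ≤ d :=
    fun Z => by
      have := hpr Z
      refine h.pdim_le _ (vI_anti ?_)
      rintro _ ⟨a, -, rfl⟩; exact a.2
  have h1 : Order.krullDim (TopologicalSpace.IrreducibleCloseds A) ≤ Order.krullDim (Fin (d + 1)) := by
    refine Order.krullDim_le_of_strictMono
      (fun Z => (⟨pdim (vI (Subtype.val '' (Z : Set A))), Nat.lt_succ_of_le (hd Z)⟩ : Fin (d + 1))) ?_
    intro Z W hZW
    have := hpr Z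
    have := hpr W
    refine Nat.lt_of_succ_le (pdim_lt_of_lt (lt_of_le_of_ne
      (vI_anti (Set.image_mono hZW.le)) fun heq => hZW.ne ?_))
    have key : ∀ Z : TopologicalSpace.IrreducibleCloseds A,
        Subtype.val ⁻¹' (vZ (vI (Subtype.val '' (Z : Set A)))) = (Z : Set A) := fun Z => by
      obtain ⟨C, hC, hCZ⟩ := isClosed_zariski_subtype_iff.mp Z.isClosed
      apply le_antisymm
      · intro a ha
        have h2 : vZ (vI (Subtype.val '' (Z : Set A))) ⊆ C := by
          rw [← hC.vZ_vI]
          refine fun v hv p hp => hv p (vI_anti ?_ hp)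
          rintro _ ⟨a, ha, rfl⟩
          rw [← hCZ] at ha
          exact ha
        rw [← hCZ]; exact h2 ha
      · intro a ha p hp
        exact hp a ⟨a, ha, rfl⟩
    apply TopologicalSpace.IrreducibleCloseds.ext
    rw [← key Z, ← key W, heq]
  refine h1.trans ?_
  refine iSup_le fun l => ?_
  have := l.length_lt_card
  rw [Fintype.card_fin] at this
  exact_mod_cast Nat.le_of_lt_succ this

theorem le_zdim_zclosure {A : Set E} {d : ℕ} {f : Fin d → E → ℂ} (hf : ∀ i, IsPolyFun (f i))
    (hind : ∀ F : MvPolynomial (Fin d) ℂ, (∀ a ∈ A, eval (fun i => f i a) F = 0) → F = 0) :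
    d ≤ zdim (zclosure A) := by
  let := TopologicalSpace.induced (Subtype.val : zclosure A → E) (zariskiTopology E)
  choose p hp using fun i => isPolyFun_iff.mp (hf i)
  obtain ⟨P, hP, hPp⟩ : ∃ P ∈ (vI A).minimalPrimes,
      ∀ F : MvPolynomial (Fin d) ℂ, aeval p F ∈ P → F = 0 := by
    by_contra! hcon
    choose! F hF hF0 using hcon
    have hfin := (vI A).finite_minimalPrimes_of_isNoetherianRing
    have hmem : ∀ P ∈ (vI A).minimalPrimes, aeval p (∏ P ∈ hfin.toFinset, F P) ∈ P := fun P hP => by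
      rw [map_prod]
      exact P.mem_of_dvd (Finset.dvd_prod_of_mem (fun P => aeval p (F P))
        (hfin.mem_toFinset.mpr hP)) (hF P hP)
    have h2 := Ideal.mem_sInf.mpr fun {P} hP => hmem P hP
    rw [Ideal.sInf_minimalPrimes, (isRadical_vI A).radical] at h2
    have h3 := hind _ fun a ha => by
      have := h2 a ha
      rw [eval_aeval] at this
      simp_rw [hp]
      exact this
    exact Finset.prod_ne_zero_iff.mpr (fun P hP => hF0 P (by simpa using hP)) h3
  have := hP.1.1
  have hd : (d : WithBot ℕ∞) ≤
      ringKrullDim (MvPolynomial (Fin (Module.finrank ℂ E)) ℂ ⧸ P) := by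
    rw [ringKrullDim_quotient_eq_pdim]
    exact_mod_cast le_pdim_of_independent P p hPp
  refine hd.trans ?_
  rw [ringKrullDim, ← Order.krullDim_orderDual]
  have hsub : ∀ Q : PrimeSpectrum (MvPolynomial (Fin (Module.finrank ℂ E)) ℂ ⧸ P),
      vZ (E := E) (Q.asIdeal.comap (Ideal.Quotient.mk P)) ⊆ zclosure A := fun Q => by
    rw [zclosure_eq]
    intro v hv q hq
    apply hv
    rw [Ideal.mem_comap, Ideal.Quotient.eq_zero_iff_mem.mpr (hP.1.2 hq)]
    exact Q.asIdeal.zero_mem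
  have himg : ∀ Q : PrimeSpectrum (MvPolynomial (Fin (Module.finrank ℂ E)) ℂ ⧸ P),
      vI (Subtype.val '' (Subtype.val ⁻¹' vZ (E := E) (Q.asIdeal.comap (Ideal.Quotient.mk P)) :
        Set (zclosure A))) = Q.asIdeal.comap (Ideal.Quotient.mk P) := fun Q => by
    rw [Set.image_preimage_eq_of_subset (by simpa using hsub Q), vI_vZ_of_isPrime]
  refine Order.krullDim_le_of_strictMono (fun Q =>
    (⟨Subtype.val ⁻¹' vZ (E := E) ((OrderDual.ofDual Q).asIdeal.comap (Ideal.Quotient.mk P)), ?_,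
      isClosed_zariski_subtype_iff.mpr ⟨_, isZClosed_vZ _, rfl⟩⟩ :
        TopologicalSpace.IrreducibleCloseds (zclosure A))) ?_
  · generalize OrderDual.ofDual Q = Q
    have hQ : (Q.asIdeal.comap (Ideal.Quotient.mk P)).IsPrime := inferInstance
    have hI := himg Q
    constructor
    · by_contra hne
      rw [Set.not_nonempty_iff_eq_empty] at hne
      rw [hne, Set.image_empty] at hI
      apply hQ.ne_top
      rw [← hI, Ideal.eq_top_iff_one]
      intro v hv; exact hv.elim
    · rw [isPreirreducible_iff_isClosed_union_isClosed]
      intro Z W hZ hW hZW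
      obtain ⟨C, hC, rfl⟩ := isClosed_zariski_subtype_iff.mp hZ
      obtain ⟨D, hD, rfl⟩ := isClosed_zariski_subtype_iff.mp hW
      by_contra! hcon
      obtain ⟨h1, h2⟩ := hcon
      obtain ⟨⟨x, hx⟩, hx1, hx2⟩ := Set.not_subset.mp h1
      obtain ⟨⟨y, hy⟩, hy1, hy2⟩ := Set.not_subset.mp h2
      obtain ⟨G, hG, rfl⟩ := hC
      obtain ⟨H, hH, rfl⟩ := hD
      simp only [Set.mem_preimage, Set.mem_ofPred_eq, not_forall] at hx2 hy2
      obtain ⟨g, hg, hgx⟩ := hx2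
      obtain ⟨k, hk, hky⟩ := hy2
      obtain ⟨p1, hp1⟩ := isPolyFun_iff.mp (hG g hg)
      obtain ⟨p2, hp2⟩ := isPolyFun_iff.mp (hH k hk)
      have : p1 * p2 ∈ Q.asIdeal.comap (Ideal.Quotient.mk P) := by
        rw [← hI]
        rintro _ ⟨a, ha, rfl⟩
        rw [map_mul, ← hp1, ← hp2]
        rcases hZW ha with h | h
        · rw [h g hg, zero_mul]
        · rw [h k hk, mul_zero]
      rcases hQ.mem_or_mem this with h | h
      · apply hgx; rw [hp1]; exact hx1 _ h
      · apply hky; rw [hp2]; exact hy1 _ h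
  · intro Q R hQR
    have hlt : (OrderDual.ofDual R).asIdeal < (OrderDual.ofDual Q).asIdeal := hQR
    refine lt_of_le_of_ne ?_ fun heq => ?_
    · intro a ha q hq
      exact ha q (hlt.le hq)
    · have h1 := himg (OrderDual.ofDual Q)
      have h2 := himg (OrderDual.ofDual R)
      have h3 : (Subtype.val ⁻¹' vZ (E := E)
            ((OrderDual.ofDual Q).asIdeal.comap (Ideal.Quotient.mk P)) : Set (zclosure A)) =
          Subtype.val ⁻¹' vZ (E := E)
            ((OrderDual.ofDual R).asIdeal.comap (Ideal.Quotient.mk P)) :=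
        congrArg (fun Z : TopologicalSpace.IrreducibleCloseds (zclosure A) =>
          (Z : Set (zclosure A))) heq
      rw [h3, h2] at h1
      have h4 := Ideal.comap_injective_of_surjective (Ideal.Quotient.mk P)
        Ideal.Quotient.mk_surjective h1
      exact hlt.ne h4

end ZDim

section Slices

theorem exists_notMem_mul_mem_of_mem_minimalPrimes {R : Type*} [CommRing R] [IsNoetherianRing R]
    {I P : Ideal R} (hI : I.IsRadical) (hP : P ∈ I.minimalPrimes) :
    ∃ g ∉ P, ∀ q ∈ P, g * q ∈ I := by
  classical
  have hfin := I.finite_minimalPrimes_of_isNoetherianRing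
  have := hP.1.1
  obtain ⟨g, hg, hgP⟩ : ∃ g ∈ (hfin.toFinset.erase P).inf id, g ∉ P := by
    rw [← SetLike.not_le_iff_exists, Ideal.IsPrime.inf_le' inferInstance]
    rintro ⟨Q, hQ, hQP⟩
    rw [Finset.mem_erase, hfin.mem_toFinset] at hQ
    exact hQ.1 (le_antisymm hQP (hP.2 hQ.2.1 hQP))
  refine ⟨g, hgP, fun q hq => ?_⟩
  rw [← hI.radical, ← Ideal.sInf_minimalPrimes, Ideal.mem_sInf]
  intro Q hQ
  by_cases h : Q = P
  · rw [h]; exact P.mul_mem_left _ hq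
  · refine Q.mul_mem_right _ ?_
    have : (hfin.toFinset.erase P).inf id ≤ id Q := Finset.inf_le (by simp [h, hQ])
    exact this hg

variable {E : Type*} [AddCommGroup E] [Module ℂ E] [FiniteDimensional ℂ E]

theorem exists_mem_vZ_of_mem_minimalPrimes {A : Set E}
    {P : Ideal (MvPolynomial (Fin (Module.finrank ℂ E)) ℂ)} (hP : P ∈ (vI A).minimalPrimes) :
    ∃ a ∈ A, a ∈ vZ (E := E) P := by
  obtain ⟨g, hg, h⟩ := exists_notMem_mul_mem_of_mem_minimalPrimes (isRadical_vI A) hP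
  have : ∃ a ∈ A, eval (coordE E a) g ≠ 0 := by
    by_contra! hcon
    exact hg (hP.1.2 hcon)
  obtain ⟨a, ha, hga⟩ := this
  refine ⟨a, ha, fun q hq => ?_⟩
  have := h q hq a ha
  rw [map_mul] at this
  exact (mul_eq_zero.mp this).resolve_left hga

theorem ad_of_slices {A X : Set E} (hX : IsZClosed X) (hAX : A ⊆ X) {e d : ℕ}
    (hed : Module.finrank ℂ E ≤ d + e)
    (h : ∀ p ∈ A, ∃ L : Submodule ℂ E, e ≤ Module.finrank ℂ L ∧ ∃ k : E → ℂ, IsPolyFun k ∧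
      k p ≠ 0 ∧ ∀ l ∈ L, l ≠ 0 → k (p + l) ≠ 0 → p + l ∉ X) : AD A d := by
  apply ad_of_minimalPrimes
  intro P hP
  have := hP.1.1
  obtain ⟨p, hpA, hpP⟩ := exists_mem_vZ_of_mem_minimalPrimes hP
  obtain ⟨L, hL, k, hk, hkp, hiso⟩ := h p hpA
  obtain ⟨K, hK⟩ := isPolyFun_iff.mp hk
  let m := RingHom.ker (eval (coordE E p) : MvPolynomial (Fin (Module.finrank ℂ E)) ℂ →+* ℂ)
  have hm : m.IsMaximal := RingHom.ker_isMaximal_of_surjective _ fun c => ⟨C c, by simp⟩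
  let n := Module.finrank ℂ (E ⧸ L)
  have hn : n ≤ d := by
    have := L.finrank_quotient_add_finrank
    omega
  have hg : ∀ j : Fin n, IsPolyFun (fun v : E => coordE (E ⧸ L) (L.mkQ v) j + -coordE (E ⧸ L) (L.mkQ p) j) :=
    fun j => (IsPolyFun.linear
      (LinearMap.proj j ∘ₗ (coordE (E ⧸ L)).toLinearMap ∘ₗ L.mkQ)).add (IsPolyFun.const _)
  choose g hg using fun j => isPolyFun_iff.mp (hg j)
  refine le_trans (pdim_le_card_of_mem_minimalPrimes (P := P) (m := m) g ?_) hn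
  refine ⟨⟨hm.isPrime, ?_⟩, ?_⟩
  · refine sup_le (fun q hq => hpP q hq) (Ideal.span_le.mpr ?_)
    rintro _ ⟨j, rfl⟩
    simp only [m, SetLike.mem_coe, RingHom.mem_ker]
    rw [← hg]; ring
  · rintro Q ⟨hQ, hJQ⟩ hQm f hf
    have hKQ : K ∉ Q := fun hKQ => hkp (by rw [hK]; exact hQm hKQ)
    refine (hQ.mem_or_mem (x := K) ?_).resolve_left hKQ
    rw [← vI_vZ_of_isPrime Q]
    intro v hv
    rw [map_mul, ← hK]
    by_cases hvp : v = p
    · rw [hvp, show eval (coordE E p) f = 0 from hf, mul_zero]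
    have hvX : v ∈ X := by
      rw [← hX.vZ_vI]
      exact fun q hq => hv q (hJQ (Ideal.mem_sup_left (hP.1.2 (vI_anti hAX hq))))
    have hvL : v - p ∈ L := by
      rw [← Submodule.Quotient.mk_eq_zero, ← Submodule.mkQ_apply, map_sub, sub_eq_zero]
      apply (coordE (E ⧸ L)).injective
      ext j
      have := hv (g j) (hJQ (Ideal.mem_sup_right (Ideal.subset_span ⟨j, rfl⟩)))
      rw [← hg] at this
      linear_combination this
    have := hiso (v - p) hvL (sub_ne_zero.mpr hvp)
    rw [add_sub_cancel] at this
    rw [not_not.mp (fun hne => this hne hvX), zero_mul]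

end Slices

section Cones

variable {t : ℕ}

/-- The maximal ideal of the origin. -/
def originIdeal (t : ℕ) : Ideal (MvPolynomial (Fin t) ℂ) :=
  RingHom.ker (eval (0 : Fin t → ℂ) : MvPolynomial (Fin t) ℂ →+* ℂ)

theorem mem_originIdeal {f : MvPolynomial (Fin t) ℂ} : f ∈ originIdeal t ↔ eval 0 f = 0 := Iff.rfl

instance originIdeal_isMaximal : (originIdeal t).IsMaximal :=
  RingHom.ker_isMaximal_of_surjective _ fun c => ⟨C c, by simp⟩

theorem mem_of_forall_eval {P : Ideal (MvPolynomial (Fin t) ℂ)} [P.IsPrime] {f : MvPolynomial (Fin t) ℂ}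
    (h : ∀ x, (∀ q ∈ P, eval x q = 0) → eval x f = 0) : f ∈ P := by
  rw [← IsPrime.vanishingIdeal_zeroLocus (K := ℂ) P, mem_vanishingIdeal_iff]
  intro x hx
  have := h x fun q hq => by simpa [coe_aeval_eq_eval] using hx q hq
  simpa [coe_aeval_eq_eval] using this

theorem originIdeal_le {P : Ideal (MvPolynomial (Fin t) ℂ)} [P.IsPrime]
    (h : ∀ x, (∀ q ∈ P, eval x q = 0) → x = 0) : originIdeal t ≤ P :=
  fun f hf => mem_of_forall_eval fun x hx => by rw [h x hx]; exact hf

theorem pdim_le_of_forall_eq_zero {P : Ideal (MvPolynomial (Fin t) ℂ)} [P.IsPrime]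
    (hP0 : P ≤ originIdeal t) {d : ℕ} (g : Fin d → MvPolynomial (Fin t) ℂ) (hg : ∀ j, eval 0 (g j) = 0)
    (h : ∀ x, (∀ q ∈ P, eval x q = 0) → (∀ j, eval x (g j) = 0) → x = 0) : pdim P ≤ d := by
  refine pdim_le_card_of_mem_minimalPrimes (m := originIdeal t) g ⟨⟨inferInstance, ?_⟩, ?_⟩
  · refine sup_le hP0 (Ideal.span_le.mpr ?_)
    rintro _ ⟨j, rfl⟩
    exact hg j
  · rintro Q ⟨hQ, hJQ⟩ -
    exact originIdeal_le fun x hx => h x (fun q hq => hx q (hJQ (Ideal.mem_sup_left hq)))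
      fun j => hx _ (hJQ (Ideal.mem_sup_right (Ideal.subset_span ⟨j, rfl⟩)))

theorem pdim_originIdeal : pdim (originIdeal t) = 0 := by
  refine Nat.le_zero.mp (pdim_le_of_forall_eq_zero le_rfl Fin.elim0 (fun j => j.elim0) ?_)
  intro x hx _
  ext i
  simpa using hx (X i) (by simp [mem_originIdeal])

/-- The linear form with given coefficients. -/
def linP : (Fin t → ℂ) →ₗ[ℂ] MvPolynomial (Fin t) ℂ where
  toFun c := ∑ i, C (c i) * X i
  map_add' c d := by simp [add_mul, Finset.sum_add_distrib]
  map_smul' a c := by simp [Finset.smul_sum, smul_eq_C_mul, mul_assoc]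

@[simp] theorem eval_linP (c x : Fin t → ℂ) : eval x (linP c) = c ⬝ᵥ x := by
  simp [linP, dotProduct]

theorem linP_isHomogeneous (c : Fin t → ℂ) : (linP c).IsHomogeneous 1 := by
  refine IsHomogeneous.sum _ _ _ fun i _ => ?_
  simpa using (isHomogeneous_C (Fin t) (c i)).mul (isHomogeneous_X ℂ i)

/-- The common zeros of `F` meet some linear subspace of codimension at most `d` only at the
origin. -/
def Cut (F : Set (MvPolynomial (Fin t) ℂ)) (d : ℕ) : Prop :=
  ∃ l : Fin d → Fin t → ℂ, ∀ x, (∀ f ∈ F, eval x f = 0) → (∀ j, l j ⬝ᵥ x = 0) → x = 0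

/-- All members are homogeneous of positive degree. -/
def HomSet (F : Set (MvPolynomial (Fin t) ℂ)) : Prop :=
  ∀ f ∈ F, ∃ i, 0 < i ∧ f.IsHomogeneous i

theorem cut_self (F : Set (MvPolynomial (Fin t) ℂ)) : Cut F t :=
  ⟨fun i => Pi.single i 1, fun x _ hx => by ext i; simpa using hx i⟩

theorem Cut.pdim_le {F : Set (MvPolynomial (Fin t) ℂ)} {d : ℕ} (h : Cut F d)
    (P : Ideal (MvPolynomial (Fin t) ℂ)) [P.IsPrime] (hFP : F ⊆ P) (hP0 : P ≤ originIdeal t) :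
    pdim P ≤ d := by
  obtain ⟨l, hl⟩ := h
  refine pdim_le_of_forall_eq_zero hP0 (fun j => linP (l j))
    (fun j => by rw [eval_linP, dotProduct_zero]) fun x hx hlx => ?_
  exact hl x (fun f hf => hx f (hFP hf)) (by simpa using hlx)

theorem eval_aeval_line (f : MvPolynomial (Fin t) ℂ) (x : Fin t → ℂ) (s : ℂ) :
    Polynomial.eval s (aeval (fun j => Polynomial.C (x j) * Polynomial.X) f)
      = eval (s • x) f := by
  induction f using MvPolynomial.induction_on with
  | C a => rw [eval_C, aeval_C]; exact Polynomial.eval_C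
  | add p q hp hq => rw [map_add, map_add, Polynomial.eval_add, hp, hq]
  | mul_X p i hp =>
    rw [map_mul, map_mul, Polynomial.eval_mul, hp, aeval_X, eval_X, Polynomial.eval_mul,
      Polynomial.eval_C, Polynomial.eval_X, Pi.smul_apply, smul_eq_mul, mul_comm (x i)]

theorem eval_smul_of_isHomogeneous {f : MvPolynomial (Fin t) ℂ} {i : ℕ} (hf : f.IsHomogeneous i)
    (x : Fin t → ℂ) (s : ℂ) : eval (s • x) f = s ^ i * eval x f := by
  rw [eval_eq, eval_eq, Finset.mul_sum]
  refine Finset.sum_congr rfl fun m hm => ?_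
  have : ∑ j, m j = i := by
    rw [← hf (mem_support_iff.mp hm)]
    simp [Finsupp.weight_apply, Finsupp.sum_fintype]
  simp only [Pi.smul_apply, smul_eq_mul, mul_pow, Finset.prod_mul_distrib]
  have h2 : ∏ j ∈ m.support, s ^ m j = s ^ i := by
    rw [← this, ← Finset.prod_pow_eq_pow_sum]
    exact Finset.prod_subset (Finset.subset_univ _) fun j _ hj => by
      simp [Finsupp.notMem_support_iff.mp hj]
  rw [h2]; ring

theorem aeval_line {f : MvPolynomial (Fin t) ℂ} {i : ℕ} (hf : f.IsHomogeneous i) (x : Fin t → ℂ) :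
    aeval (fun j => Polynomial.C (x j) * Polynomial.X) f
      = Polynomial.C (eval x f) * (Polynomial.X : Polynomial ℂ) ^ i := by
  apply Polynomial.funext
  intro s
  rw [eval_aeval_line, eval_smul_of_isHomogeneous hf]
  rw [Polynomial.eval_mul, Polynomial.eval_C, Polynomial.eval_pow, Polynomial.eval_X, mul_comm]

/-- The prime ideal of the line through `x`. -/
def lineIdeal (x : Fin t → ℂ) : Ideal (MvPolynomial (Fin t) ℂ) :=
  RingHom.ker (aeval (fun j => Polynomial.C (x j) * Polynomial.X) :
    MvPolynomial (Fin t) ℂ →ₐ[ℂ] Polynomial ℂ)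

instance (x : Fin t → ℂ) : (lineIdeal x).IsPrime := RingHom.ker_isPrime _

theorem lineIdeal_le (x : Fin t → ℂ) : lineIdeal x ≤ originIdeal t := by
  intro f hf
  have h := eval_aeval_line f x 0
  rw [show aeval (fun j => Polynomial.C (x j) * Polynomial.X) f = 0 from hf] at h
  simpa [mem_originIdeal] using h.symm

theorem exists_linP_notMem (s : Set (Ideal (MvPolynomial (Fin t) ℂ))) (hs : s.Finite)
    (h : ∀ P ∈ s, ∃ i, X i ∉ P) : ∃ c : Fin t → ℂ, ∀ P ∈ s, linP c ∉ P := by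
  have : Finite s := hs
  have hne : ∀ P : s, (P.1.restrictScalars ℂ).comap (linP (t := t)) ≠ ⊤ := by
    rintro ⟨P, hP⟩ htop
    obtain ⟨i, hi⟩ := h P hP
    have : (Pi.single i 1 : Fin t → ℂ) ∈ (P.restrictScalars ℂ).comap (linP (t := t)) := by
      rw [htop]; trivial
    apply hi
    simpa [linP, Pi.single_apply] using this
  obtain ⟨c, hc⟩ := Submodule.exists_forall_notMem_of_forall_ne_top _ hne
  exact ⟨c, fun P hP => hc ⟨P, hP⟩⟩

theorem exists_X_notMem {P : Ideal (MvPolynomial (Fin t) ℂ)} [P.IsPrime] (hP : P ≤ originIdeal t)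
    (hne : P ≠ originIdeal t) : ∃ i, X i ∉ P := by
  by_contra! h
  refine hne (le_antisymm hP (originIdeal_le fun x hx => ?_))
  ext i
  simpa using hx _ (h i)

theorem cut_of_forall_pdim_le {F : Set (MvPolynomial (Fin t) ℂ)} (hF : HomSet F) {d : ℕ}
    (h : ∀ P : Ideal (MvPolynomial (Fin t) ℂ), P.IsPrime → F ⊆ P → P ≤ originIdeal t → pdim P ≤ d) :
    Cut F d := by
  induction d generalizing F with
  | zero =>
    refine ⟨Fin.elim0, fun x hx _ => ?_⟩
    by_contra hne
    have h1 := h (lineIdeal x) inferInstance (fun f hf => by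
      obtain ⟨i, -, hi⟩ := hF f hf
      change aeval _ f = 0
      rw [aeval_line hi, hx f hf]; simp) (lineIdeal_le x)
    have hlt : lineIdeal x < originIdeal t := by
      refine lt_of_le_of_ne (lineIdeal_le x) fun heq => hne ?_
      ext i
      have : X i ∈ lineIdeal x := by rw [heq]; simp [mem_originIdeal]
      change aeval _ (X i) = 0 at this
      simpa using this
    have := pdim_lt_of_lt hlt
    omega
  | succ d ih =>
    have hfin := (Ideal.span F).finite_minimalPrimes_of_isNoetherianRing
    obtain ⟨c, hc⟩ := exists_linP_notMem
      {P ∈ (Ideal.span F).minimalPrimes | P ≤ originIdeal t ∧ P ≠ originIdeal t}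
      (hfin.subset fun P hP => hP.1) fun P hP => by
        have := hP.1.1.1
        exact exists_X_notMem hP.2.1 hP.2.2
    obtain ⟨l, hl⟩ := ih (F := insert (linP c) F) (by
      rintro f (rfl | hf)
      · exact ⟨1, one_pos, linP_isHomogeneous c⟩
      · exact hF f hf) (by
      intro P hP hFP hP0
      obtain ⟨Q, hQ, hQP⟩ := Ideal.exists_minimalPrimes_le
        (Ideal.span_le.mpr ((Set.subset_insert _ _).trans hFP))
      have := hQ.1.1
      by_cases hQ0 : Q = originIdeal t
      · have : P = originIdeal t := le_antisymm hP0 (hQ0 ▸ hQP)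
        rw [this, pdim_originIdeal]; omega
      · have hlt : Q < P := lt_of_le_of_ne hQP fun heq =>
          hc Q ⟨hQ, hQP.trans hP0, hQ0⟩ (heq ▸ hFP (Set.mem_insert _ _))
        have h1 := pdim_lt_of_lt hlt
        have h2 := h Q hQ.1.1 (Ideal.span_le.mp hQ.1.2) (hQP.trans hP0)
        omega)
    refine ⟨Fin.cons c l, fun x hx hlx => hl x ?_ fun j => by simpa using hlx j.succ⟩
    rintro f (rfl | hf)
    · simpa using hlx 0
    · exact hx f hf

theorem cut_iff {F : Set (MvPolynomial (Fin t) ℂ)} (hF : HomSet F) {d : ℕ} :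
    Cut F d ↔ ∀ P : Ideal (MvPolynomial (Fin t) ℂ), P.IsPrime → F ⊆ P → P ≤ originIdeal t →
      pdim P ≤ d :=
  ⟨fun h P _ h1 h2 => h.pdim_le P h1 h2, cut_of_forall_pdim_le hF⟩

theorem Cut.drop {F : Set (MvPolynomial (Fin t) ℂ)} (hF : HomSet F) {q : MvPolynomial (Fin t) ℂ}
    (hq : eval 0 q = 0) {d : ℕ} (h : Cut (insert q F) d) : Cut F (d + 1) := by
  refine cut_of_forall_pdim_le hF fun P hP hFP hP0 => ?_
  obtain ⟨l, hl⟩ := h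
  refine pdim_le_of_forall_eq_zero hP0 (Fin.cons q fun j => linP (l j)) (fun j => ?_) fun x hx hlx => ?_
  · refine Fin.cases ?_ (fun j => ?_) j
    · simpa using hq
    · rw [Fin.cons_succ, eval_linP, dotProduct_zero]
  · refine hl x ?_ fun j => by simpa using hlx j.succ
    rintro f (rfl | hf)
    · simpa using hlx 0
    · exact hx f (hFP hf)

theorem Cut.mono_dim {F : Set (MvPolynomial (Fin t) ℂ)} (hF : HomSet F) {d e : ℕ} (h : Cut F d)
    (hde : d ≤ e) : Cut F e :=
  cut_of_forall_pdim_le hF fun P _ h1 h2 => (h.pdim_le P h1 h2).trans hde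

theorem isPolyFun_pi_iff {g : (Fin t → ℂ) → ℂ} :
    IsPolyFun g ↔ ∃ p : MvPolynomial (Fin t) ℂ, ∀ v, g v = eval v p := by
  constructor
  · rintro ⟨n, φ, p, h⟩
    refine ⟨aeval (fun i => linP fun j => φ (Pi.single j 1) i) p, fun v => ?_⟩
    rw [h, eval_aeval]
    congr 2
    ext i
    conv_lhs => rw [← Finset.univ_sum_single v]
    rw [eval_linP, map_sum, Finset.sum_apply]
    refine Finset.sum_congr rfl fun j _ => ?_
    rw [show Pi.single j (v j) = v j • (Pi.single j 1 : Fin t → ℂ) by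
      rw [← Pi.single_smul, smul_eq_mul, mul_one], map_smul, Pi.smul_apply, smul_eq_mul, mul_comm]
  · rintro ⟨p, h⟩
    exact ⟨t, LinearMap.id, p, h⟩

theorem ad_of_cut {F : Set (MvPolynomial (Fin t) ℂ)} (hF : HomSet F) {d : ℕ} (h : Cut F d) :
    AD {x : Fin t → ℂ | ∀ f ∈ F, eval x f = 0} d := by
  intro f hf
  choose p hp using fun i => isPolyFun_pi_iff.mp (hf i)
  set I := (Ideal.span F).radical with hI
  have hIr : I.IsRadical := Ideal.radical_isRadical _
  have hmemI : ∀ g : MvPolynomial (Fin t) ℂ,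
      (∀ x, (∀ f ∈ F, eval x f = 0) → eval x g = 0) ↔ g ∈ I := by
    intro g
    rw [hI, ← vanishingIdeal_zeroLocus_eq_radical (K := ℂ), mem_vanishingIdeal_iff]
    simp [zeroLocus_span]
  have hfin := I.finite_minimalPrimes_of_isNoetherianRing
  have key : ∀ P ∈ I.minimalPrimes, ∃ G : MvPolynomial (Fin (d + 1)) ℂ, G ≠ 0 ∧
      aeval p G ∈ P := fun P hP => by
    have := hP.1.1
    have hFP : F ⊆ P := fun q hq => hP.1.2 (Ideal.le_radical (Ideal.subset_span hq))
    refine exists_dependent_of_pdim_le P (h.pdim_le P hFP fun q hq => ?_) p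
    obtain ⟨g, hg, hgP⟩ := exists_notMem_mul_mem_of_mem_minimalPrimes hIr hP
    have : ∃ x, (∀ f ∈ F, eval x f = 0) ∧ eval x g ≠ 0 := by
      by_contra! hcon
      exact hg (hP.1.2 ((hmemI g).mp hcon))
    obtain ⟨x, hx, hgx⟩ := this
    have h1 : aeval (fun j => Polynomial.C (x j) * Polynomial.X) (g * q) = (0 : Polynomial ℂ) := by
      apply Polynomial.funext
      intro s
      rw [eval_aeval_line, Polynomial.eval_zero]
      refine (hmemI _).mpr (hgP q hq) _ fun f hf => ?_
      obtain ⟨i, -, hi⟩ := hF f hf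
      rw [← eval_aeval_line, aeval_line hi, hx f hf]; simp
    rw [map_mul] at h1
    refine lineIdeal_le x ((mul_eq_zero.mp h1).resolve_left fun h0 => hgx ?_)
    have := eval_aeval_line g x 1
    rw [h0] at this
    simpa using this.symm
  choose! G hG0 hG using key
  refine ⟨∏ P ∈ hfin.toFinset, G P, Finset.prod_ne_zero_iff.mpr fun P hP => hG0 P (by simpa using hP),
    ?_⟩
  have hmem : aeval p (∏ P ∈ hfin.toFinset, G P) ∈ I := by
    suffices hs : ∀ P ∈ I.minimalPrimes, aeval p (∏ P ∈ hfin.toFinset, G P) ∈ P by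
      have := Ideal.mem_sInf.mpr fun {P} hP => hs P hP
      rwa [Ideal.sInf_minimalPrimes, hIr.radical] at this
    intro P hP
    rw [map_prod]
    exact P.mem_of_dvd (Finset.dvd_prod_of_mem (fun P => aeval p (G P)) (hfin.mem_toFinset.mpr hP))
      (hG P hP)
  intro a ha
  have := (hmemI _).mpr hmem a ha
  rw [eval_aeval] at this
  simp_rw [hp]
  exact this

end Cones

section Families

variable {t : ℕ} {E : Type*} [AddCommGroup E] [Module ℂ E]

theorem eval_homogeneousComponent_eq_zero {G : MvPolynomial (Fin t) ℂ} {x : Fin t → ℂ}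
    (h : ∀ s : ℂ, eval (s • x) G = 0) (n : ℕ) : eval x (homogeneousComponent n G) = 0 := by
  by_cases hn : G.totalDegree < n
  · rw [homogeneousComponent_eq_zero _ _ hn, map_zero]
  let p : Polynomial ℂ := ∑ i ∈ Finset.range (G.totalDegree + 1),
    Polynomial.C (eval x (homogeneousComponent i G)) * Polynomial.X ^ i
  have hp : p = 0 := by
    apply Polynomial.funext
    intro s
    rw [Polynomial.eval_zero, ← h s, ← sum_homogeneousComponent G, map_sum,
      Polynomial.eval_finsetSum]
    refine Finset.sum_congr rfl fun i _ => ?_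
    rw [Polynomial.eval_mul, Polynomial.eval_C, Polynomial.eval_pow, Polynomial.eval_X,
      eval_smul_of_isHomogeneous (homogeneousComponent_isHomogeneous i G), mul_comm]
  have h2 : p.coeff n = 0 := by rw [hp, Polynomial.coeff_zero]
  simp only [p, Polynomial.finsetSum_coeff, Polynomial.coeff_C_mul_X_pow] at h2
  rwa [Finset.sum_ite_eq, if_pos (by simp; omega)] at h2

/-- A family of polynomials whose coefficients are polynomial functions of the parameter. -/
def PolyFam (q : E → MvPolynomial (Fin t) ℂ) : Prop :=
  ∀ m, IsPolyFun fun v => coeff m (q v)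

theorem PolyFam.const (q : MvPolynomial (Fin t) ℂ) : PolyFam fun _ : E => q :=
  fun m => IsPolyFun.const (coeff m q)

theorem PolyFam.sum {ι : Type*} (s : Finset ι) {q : ι → E → MvPolynomial (Fin t) ℂ}
    (h : ∀ i ∈ s, PolyFam (q i)) : PolyFam fun v => ∑ i ∈ s, q i v := by
  intro m
  simp only [coeff_sum]
  exact IsPolyFun.sum s fun i hi => h i hi m

theorem PolyFam.add {p q : E → MvPolynomial (Fin t) ℂ} (hp : PolyFam p) (hq : PolyFam q) :
    PolyFam fun v => p v + q v := by
  intro m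
  simp only [coeff_add]
  exact (hp m).add (hq m)

theorem PolyFam.mul {p q : E → MvPolynomial (Fin t) ℂ} (hp : PolyFam p) (hq : PolyFam q) :
    PolyFam fun v => p v * q v := by
  intro m
  simp only [coeff_mul]
  exact IsPolyFun.sum _ fun i _ => (hp _).mul (hq _)

theorem PolyFam.pow {p : E → MvPolynomial (Fin t) ℂ} (hp : PolyFam p) (n : ℕ) :
    PolyFam fun v => p v ^ n := by
  induction n with
  | zero => simpa using PolyFam.const 1
  | succ n ih => simpa only [pow_succ] using ih.mul hp

theorem PolyFam.prod {ι : Type*} (s : Finset ι) {q : ι → E → MvPolynomial (Fin t) ℂ}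
    (h : ∀ i ∈ s, PolyFam (q i)) : PolyFam fun v => ∏ i ∈ s, q i v := by
  classical
  induction s using Finset.induction_on with
  | empty => simpa using PolyFam.const 1
  | insert a s ha ih =>
    simp only [Finset.prod_insert ha]
    exact (h a (by simp)).mul (ih fun i hi => h i (by simp [hi]))

theorem PolyFam.C {g : E → ℂ} (hg : IsPolyFun g) :
    PolyFam (fun v => (MvPolynomial.C (g v) : MvPolynomial (Fin t) ℂ)) := by
  intro m
  simp only [coeff_C]
  split_ifs
  · exact hg
  · exact IsPolyFun.const 0

theorem PolyFam.homogeneousComponent {q : E → MvPolynomial (Fin t) ℂ} (hq : PolyFam q) (n : ℕ) :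
    PolyFam fun v => homogeneousComponent n (q v) := by
  intro m
  simp only [coeff_homogeneousComponent]
  split_ifs
  · exact hq m
  · exact IsPolyFun.const 0

theorem PolyFam.aeval {s : ℕ} {f : E → MvPolynomial (Fin s) ℂ} (hf : PolyFam f)
    (S : Finset (Fin s →₀ ℕ)) (hS : ∀ v, (f v).support ⊆ S)
    {g : Fin s → E → MvPolynomial (Fin t) ℂ} (hg : ∀ j, PolyFam (g j)) :
    PolyFam fun v => aeval (fun j => g j v) (f v) := by
  have : (fun v => MvPolynomial.aeval (fun j => g j v) (f v)) = fun v => ∑ m ∈ S,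
      MvPolynomial.C (coeff m (f v)) * ∏ j, g j v ^ m j := by
    ext1 v
    rw [aeval_def, eval₂_eq', Finset.sum_subset (hS v)]
    · rfl
    · intro m _ hm
      simp [notMem_support_iff.mp hm]
  rw [this]
  exact PolyFam.sum _ fun m _ => (PolyFam.C (hf m)).mul (PolyFam.prod _ fun j _ => (hg j).pow _)

theorem exists_isPolyFun_forall_eq_zero {κ : Type*} [Fintype κ] {Q : κ → E → MvPolynomial (Fin t) ℂ}
    (hQ : ∀ k, PolyFam (Q k)) (hom : ∀ k v, ∃ i, 0 < i ∧ (Q k v).IsHomogeneous i) {v₀ : E}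
    (h0 : ∀ x, (∀ k, eval x (Q k v₀) = 0) → x = 0) :
    ∃ H : E → ℂ, IsPolyFun H ∧ H v₀ ≠ 0 ∧
      ∀ v, H v ≠ 0 → ∀ x, (∀ k, eval x (Q k v) = 0) → x = 0 := by
  classical
  let J := Ideal.span (Set.range fun k => Q k v₀)
  have hrad : originIdeal t ≤ J.radical := by
    rw [← vanishingIdeal_zeroLocus_eq_radical (K := ℂ)]
    intro f hf
    rw [mem_vanishingIdeal_iff]
    intro x hx
    have : x = 0 := h0 x fun k => by
      simpa [coe_aeval_eq_eval] using hx (Q k v₀) (Ideal.subset_span ⟨k, rfl⟩)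
    rw [this]
    exact hf
  obtain ⟨n, hn⟩ := Ideal.exists_pow_le_of_le_radical_of_fg hrad
    ((isNoetherianRing_iff_ideal_fg _).mp inferInstance _)
  have hn' : originIdeal t ^ (n + 1) ≤ J := (Ideal.pow_le_pow_right (Nat.le_succ n)).trans hn
  let T : Set (Fin t →₀ ℕ) := {m | m.degree = n + 1}
  have hT : T.Finite := Finsupp.finite_of_degree_eq (n + 1)
  have : Fintype T := hT.fintype
  have hmem : ∀ m : T, (monomial m.1 1 : MvPolynomial (Fin t) ℂ) ∈ J := by
    rintro ⟨m, hm⟩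
    apply hn'
    rw [monomial_eq, Finsupp.prod_fintype _ _ (by simp), map_one, one_mul]
    rw [← show m.degree = n + 1 from hm, Finsupp.degree_eq_sum, ← Finset.prod_pow_eq_pow_sum]
    exact Ideal.prod_mem_prod fun i _ => Ideal.pow_mem_pow (by simp [mem_originIdeal]) _
  choose b hb using fun m => (Ideal.mem_span_range_iff_exists_fun.mp (hmem m))
  let G : T → E → MvPolynomial (Fin t) ℂ := fun m v => ∑ k, b m k * Q k v
  have hG : ∀ m, PolyFam (G m) := fun m => PolyFam.sum _ fun k _ => (PolyFam.const _).mul (hQ k)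
  refine ⟨fun v => (Matrix.of fun m m' : T => coeff m'.1 (G m v)).det,
    IsPolyFun.det fun m m' => hG m m'.1, ?_, ?_⟩
  · have : (Matrix.of fun m m' : T => coeff m'.1 (G m v₀)) = 1 := by
      ext m m'
      simp only [Matrix.of_apply, G, hb, coeff_monomial, Matrix.one_apply, Subtype.ext_iff]
    beta_reduce
    rw [this, Matrix.det_one]
    exact one_ne_zero
  · intro v hv x hx
    have hker : (Matrix.of fun m m' : T => coeff m'.1 (G m v)).mulVec
        (fun m' => ∏ j, x j ^ m'.1 j) = 0 := by
      ext m
      have h1 : eval x (homogeneousComponent (n + 1) (G m v)) = 0 := by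
        apply eval_homogeneousComponent_eq_zero
        intro s
        simp only [G, map_sum, map_mul]
        refine Finset.sum_eq_zero fun k _ => ?_
        obtain ⟨i, -, hi⟩ := hom k v
        rw [eval_smul_of_isHomogeneous hi, hx k, mul_zero, mul_zero]
      rw [Pi.zero_apply, ← h1, eval_eq', Matrix.mulVec, dotProduct]
      simp only [Matrix.of_apply]
      rw [← Finset.sum_subtype hT.toFinset (by simp [T])
        (fun m' => coeff m' (G m v) * ∏ j, x j ^ m' j)]
      symm
      rw [support_homogeneousComponent]
      refine Finset.sum_subset_zero_on_sdiff (fun c hc => ?_) (fun c hc => ?_) fun c hc => ?_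
      · simpa [T] using (Finset.mem_filter.mp hc).2
      · have h2 : c.degree = n + 1 := by simpa [T] using (Finset.mem_sdiff.mp hc).1
        have h3 : c ∉ (G m v).support := fun h => (Finset.mem_sdiff.mp hc).2
          (Finset.mem_filter.mpr ⟨h, h2⟩)
        rw [notMem_support_iff.mp h3, zero_mul]
      · rw [coeff_homogeneousComponent, if_pos (Finset.mem_filter.mp hc).2]
    have hz := Matrix.eq_zero_of_mulVec_eq_zero hv hker
    ext i
    have := congrFun hz ⟨Finsupp.single i (n + 1), by simp [T]⟩
    simp only [Pi.zero_apply] at this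
    rw [Finset.prod_eq_zero_iff] at this
    obtain ⟨j, -, hj⟩ := this
    by_cases hij : i = j
    · subst hij; simpa using hj
    · simp [hij] at hj

theorem isZClosed_of_forall_exists {X : Set E}
    (h : ∀ v ∉ X, ∃ H : E → ℂ, IsPolyFun H ∧ H v ≠ 0 ∧ ∀ w ∈ X, H w = 0) : IsZClosed X := by
  refine ⟨{g | IsPolyFun g ∧ ∀ w ∈ X, g w = 0}, fun g hg => hg.1, ?_⟩
  ext v
  refine ⟨fun hv g hg => hg.2 v hv, fun hv => ?_⟩
  by_contra hX
  obtain ⟨H, h1, h2, h3⟩ := h v hX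
  exact h2 (hv H ⟨h1, h3⟩)

theorem exists_isPolyFun_cut {κ : Type*} [Fintype κ] {q : κ → E → MvPolynomial (Fin t) ℂ}
    (hq : ∀ k, PolyFam (q k)) (hom : ∀ k v, ∃ i, 0 < i ∧ (q k v).IsHomogeneous i) {d : ℕ} {v₀ : E}
    (h0 : Cut (Set.range fun k => q k v₀) d) :
    ∃ H : E → ℂ, IsPolyFun H ∧ H v₀ ≠ 0 ∧ ∀ v, H v ≠ 0 → Cut (Set.range fun k => q k v) d := by
  obtain ⟨l, hl⟩ := h0
  obtain ⟨H, h1, h2, h3⟩ := exists_isPolyFun_forall_eq_zero (κ := κ ⊕ Fin d)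
    (Q := Sum.elim q fun j _ => linP (l j)) (v₀ := v₀)
    (by rintro (k | j); exacts [hq k, PolyFam.const _])
    (by rintro (k | j) v; exacts [hom k v, ⟨1, one_pos, linP_isHomogeneous _⟩])
    (fun x hx => hl x (by rintro _ ⟨k, rfl⟩; exact hx (.inl k)) fun j => by
      simpa using hx (.inr j))
  refine ⟨H, h1, h2, fun v hv => ⟨l, fun x hx hlx => h3 v hv x ?_⟩⟩
  rintro (k | j)
  · exact hx _ ⟨k, rfl⟩
  · simpa using hlx j

theorem isZClosed_not_cut {κ : Type*} [Fintype κ] {q : κ → E → MvPolynomial (Fin t) ℂ}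
    (hq : ∀ k, PolyFam (q k)) (hom : ∀ k v, ∃ i, 0 < i ∧ (q k v).IsHomogeneous i) (d : ℕ) :
    IsZClosed {v | ¬ Cut (Set.range fun k => q k v) d} := by
  refine isZClosed_of_forall_exists fun v hv => ?_
  obtain ⟨H, h1, h2, h3⟩ := exists_isPolyFun_cut hq hom (not_not.mp hv)
  exact ⟨H, h1, h2, fun w hw => by_contra fun hne => hw (h3 w hne)⟩

end Families

section Homs

variable {t : ℕ}

/-- The homogeneous components of `q` of degrees in `J`. -/
def homs (J : Finset ℕ) (q : MvPolynomial (Fin t) ℂ) : Set (MvPolynomial (Fin t) ℂ) :=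
  (fun i => homogeneousComponent i q) '' J

theorem homSet_homs {J : Finset ℕ} (hJ : ∀ i ∈ J, 2 ≤ i) (q : MvPolynomial (Fin t) ℂ) :
    HomSet (homs J q) := by
  rintro _ ⟨i, hi, rfl⟩
  exact ⟨i, by have := hJ i hi; omega, homogeneousComponent_isHomogeneous i q⟩

theorem homs_subset_iff {J : Finset ℕ} {q : MvPolynomial (Fin t) ℂ} {P : Ideal (MvPolynomial (Fin t) ℂ)} :
    homs J q ⊆ P ↔ ∀ i ∈ J, homogeneousComponent i q ∈ P := by
  simp [homs, Set.subset_def]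

theorem homs_mono {J J' : Finset ℕ} (h : J ⊆ J') (q : MvPolynomial (Fin t) ℂ) : homs J q ⊆ homs J' q :=
  Set.image_mono (by exact_mod_cast h)

theorem homs_insert (i : ℕ) (J : Finset ℕ) (q : MvPolynomial (Fin t) ℂ) :
    homs (insert i J) q = insert (homogeneousComponent i q) (homs J q) := by
  simp [homs, Set.image_insert_eq]

theorem exists_eval_ne_zero_of_notMem {P : Ideal (MvPolynomial (Fin t) ℂ)} [P.IsPrime]
    {f : MvPolynomial (Fin t) ℂ} (h : f ∉ P) : ∃ x, (∀ q ∈ P, eval x q = 0) ∧ eval x f ≠ 0 := by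
  by_contra! hcon
  exact h (mem_of_forall_eval hcon)

/-- The minimal primes over the components of `q` in `S`, through the origin, of dimension `m`,
and containing the components of `q` in `J`. -/
def badPrimes (S J : Finset ℕ) (m : ℕ) (q : MvPolynomial (Fin t) ℂ) :
    Set (Ideal (MvPolynomial (Fin t) ℂ)) :=
  {P ∈ (Ideal.span (homs S q)).minimalPrimes | homs J q ⊆ P ∧ P ≤ originIdeal t ∧ pdim P = m}

theorem finite_badPrimes (S J : Finset ℕ) (m : ℕ) (q : MvPolynomial (Fin t) ℂ) :
    (badPrimes S J m q).Finite :=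
  ((Ideal.span (homs S q)).finite_minimalPrimes_of_isNoetherianRing).subset fun _ h => h.1

theorem mem_minimalPrimes_of_pdim {F : Set (MvPolynomial (Fin t) ℂ)} {m : ℕ} (h : Cut F m)
    {P : Ideal (MvPolynomial (Fin t) ℂ)} [P.IsPrime] (hFP : F ⊆ P) (hP0 : P ≤ originIdeal t)
    (hm : m ≤ pdim P) : P ∈ (Ideal.span F).minimalPrimes ∧ pdim P = m := by
  obtain ⟨Q, hQ, hQP⟩ := Ideal.exists_minimalPrimes_le (Ideal.span_le.mpr hFP)
  have := hQ.1.1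
  have h1 := h.pdim_le Q (Ideal.span_le.mp hQ.1.2) (hQP.trans hP0)
  rcases hQP.lt_or_eq with hlt | rfl
  · have := pdim_lt_of_lt hlt
    omega
  · exact ⟨hQ, le_antisymm h1 hm⟩

theorem exists_isPolyFun_cut_add {S J : Finset ℕ} (hSJ : S ⊆ J) (hJ : ∀ i ∈ J, 2 ≤ i) {m : ℕ}
    {q : MvPolynomial (Fin t) ℂ} (hcut : Cut (homs S q) (m + 1))
    (L : Submodule ℂ (MvPolynomial (Fin t) ℂ)) (hLS : ∀ l ∈ L, ∀ i ∈ S, homogeneousComponent i l = 0)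
    (hL : ∀ P ∈ badPrimes S J (m + 1) q, ∀ l ∈ L, l ≠ 0 → ∃ i ∈ J, homogeneousComponent i l ∉ P) :
    ∃ K : MvPolynomial (Fin t) ℂ → ℂ, IsPolyFun K ∧ K q ≠ 0 ∧
      ∀ l ∈ L, l ≠ 0 → K (q + l) ≠ 0 → Cut (homs J (q + l)) m := by
  classical
  have hfin := (Ideal.span (homs S q)).finite_minimalPrimes_of_isNoetherianRing
  have key : ∀ P ∈ (Ideal.span (homs S q)).minimalPrimes,
      ∃ K : MvPolynomial (Fin t) ℂ → ℂ, IsPolyFun K ∧ K q ≠ 0 ∧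
        ∀ r, K r ≠ 0 → homs J r ⊆ P → homs J q ⊆ P := by
    intro P hP
    have := hP.1.1
    by_cases hJP : homs J q ⊆ P
    · exact ⟨fun _ => 1, IsPolyFun.const 1, one_ne_zero, fun _ _ _ => hJP⟩
    · rw [homs_subset_iff] at hJP
      push Not at hJP
      obtain ⟨i, hi, hiP⟩ := hJP
      obtain ⟨x, hx, hxi⟩ := exists_eval_ne_zero_of_notMem hiP
      refine ⟨fun r => eval x (homogeneousComponent i r),
        IsPolyFun.linear ((MvPolynomial.aeval x).toLinearMap ∘ₗ homogeneousComponent i), hxi, ?_⟩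
      intro r hr hrP
      exact (hr (hx _ (homs_subset_iff.mp hrP i hi))).elim
  choose! K hK1 hK2 hK3 using key
  refine ⟨fun r => ∏ P ∈ hfin.toFinset, K P r, IsPolyFun.prod _ fun P hP => hK1 P (by simpa using hP),
    Finset.prod_ne_zero_iff.mpr fun P hP => hK2 P (by simpa using hP), ?_⟩
  intro l hl hl0 hKl
  refine cut_of_forall_pdim_le (homSet_homs hJ _) fun P hP hFP hP0 => ?_
  by_contra! hd
  have hSP : homs S q ⊆ P := by
    rw [homs_subset_iff] at hFP ⊢
    intro i hi
    have := hFP i (hSJ hi)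
    rwa [map_add, hLS l hl i hi, add_zero] at this
  obtain ⟨hmin, hm⟩ := mem_minimalPrimes_of_pdim hcut hSP hP0 hd
  have hJP := hK3 P hmin (q + l) (Finset.prod_ne_zero_iff.mp hKl P (by simpa using hmin)) hFP
  obtain ⟨i, hi, hiP⟩ := hL P ⟨hmin, hJP, hP0, hm⟩ l hl hl0
  apply hiP
  have h1 := homs_subset_iff.mp hFP i hi
  rw [map_add] at h1
  exact (P.add_mem_iff_right (homs_subset_iff.mp hJP i hi)).mp h1

/-- Polynomials with homogeneous components of degrees `2, …, n` only. -/
def Pol (t n : ℕ) : Submodule ℂ (MvPolynomial (Fin t) ℂ) :=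
  (restrictTotalDegree (Fin t) ℂ n) ⊓
    (LinearMap.ker (homogeneousComponent 0) ⊓ LinearMap.ker (homogeneousComponent 1))

theorem mem_pol_iff {n : ℕ} {q : MvPolynomial (Fin t) ℂ} :
    q ∈ Pol t n ↔ ∀ m ∈ q.support, 2 ≤ m.degree ∧ m.degree ≤ n := by
  have hk : ∀ k, homogeneousComponent k q = 0 ↔ ∀ m ∈ q.support, m.degree ≠ k := fun k => by
    rw [← support_eq_empty, support_homogeneousComponent, Finset.filter_eq_empty_iff]
  have hn : q.totalDegree ≤ n ↔ ∀ m ∈ q.support, m.degree ≤ n := Finset.sup_le_iff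
  rw [Pol, Submodule.mem_inf, Submodule.mem_inf, mem_restrictTotalDegree, LinearMap.mem_ker,
    LinearMap.mem_ker, hk, hk, hn]
  constructor
  · rintro ⟨h1, h2, h3⟩ m hm
    have := h1 m hm; have := h2 m hm; have := h3 m hm
    omega
  · intro h
    refine ⟨fun m hm => (h m hm).2, fun m hm => ?_, fun m hm => ?_⟩ <;>
    · have := (h m hm).1
      omega

theorem homogeneousComponent_mem_pol {n i : ℕ} (h2 : 2 ≤ i) (hn : i ≤ n) (q : MvPolynomial (Fin t) ℂ) :
    homogeneousComponent i q ∈ Pol t n := by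
  rw [mem_pol_iff]
  intro m hm
  rw [support_homogeneousComponent, Finset.mem_filter] at hm
  omega

theorem sum_homogeneousComponent_of_mem_pol {n : ℕ} {q : MvPolynomial (Fin t) ℂ} (hq : q ∈ Pol t n) :
    ∑ i ∈ Finset.Icc 2 n, homogeneousComponent i q = q := by
  ext m
  rw [coeff_sum]
  simp only [coeff_homogeneousComponent, Finset.sum_ite_eq, Finset.mem_Icc]
  rw [mem_pol_iff] at hq
  split_ifs with h
  · rfl
  · by_contra hne
    exact h (hq m (mem_support_iff.mpr (Ne.symm hne)))

theorem finite_pol (t n : ℕ) : Module.Finite ℂ (Pol t n) :=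
  Submodule.finiteDimensional_inf_left _ _

end Homs

section Points

theorem exists_disjoint_submodule {V : Type*} [AddCommGroup V] [Module ℂ V] [FiniteDimensional ℂ V]
    {ι : Type*} [Finite ι] (K : ι → Submodule ℂ V) (e : ℕ) (he : e ≤ Module.finrank ℂ V)
    (hK : ∀ i, Module.finrank ℂ (K i) + e ≤ Module.finrank ℂ V) :
    ∃ L : Submodule ℂ V, Module.finrank ℂ L = e ∧ ∀ i, Disjoint L (K i) := by
  induction e with
  | zero => exact ⟨⊥, finrank_bot ℂ V, fun i => disjoint_bot_left⟩
  | succ e ih =>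
    obtain ⟨L, hL, hdis⟩ := ih (by omega) fun i => by have := hK i; omega
    let p : Option ι → Submodule ℂ V := fun o => o.elim L fun i => L ⊔ K i
    have hp : ∀ o, p o ≠ ⊤ := by
      intro o htop
      have h1 : Module.finrank ℂ (p o) < Module.finrank ℂ V := by
        rcases o with _ | i
        · change Module.finrank ℂ L < _
          omega
        · have h2 := Submodule.finrank_add_le_finrank_add_finrank L (K i)
          have := hK i
          change Module.finrank ℂ ↥(L ⊔ K i) < _
          omega
      rw [htop, finrank_top] at h1
      exact lt_irrefl _ h1
    obtain ⟨v, hv⟩ := Submodule.exists_forall_notMem_of_forall_ne_top p hp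
    have hvL : v ∉ L := hv none
    have hdv : Disjoint L (ℂ ∙ v) := by
      rw [Submodule.disjoint_span_singleton]
      exact fun h => (hvL h).elim
    refine ⟨L ⊔ ℂ ∙ v, ?_, fun i => ?_⟩
    · have h1 := Submodule.finrank_sup_add_finrank_inf_eq L (ℂ ∙ v)
      rw [hdv.eq_bot, finrank_bot, finrank_span_singleton (K := ℂ) (v := v) (by rintro rfl; exact hvL L.zero_mem), hL] at h1
      omega
    · rw [Submodule.disjoint_def]
      intro x hx hxK
      obtain ⟨l, hl, w, hw, rfl⟩ := Submodule.mem_sup.mp hx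
      obtain ⟨c, rfl⟩ := Submodule.mem_span_singleton.mp hw
      by_cases hc : c = 0
      · subst hc
        rw [zero_smul, add_zero] at hxK ⊢
        exact (Submodule.disjoint_def.mp (hdis i)) l hl hxK
      · refine (hv (some i) ?_).elim
        change v ∈ L ⊔ K i
        have h2 : c • v ∈ L ⊔ K i := by
          rw [show c • v = -l + (l + c • v) by abel]
          exact Submodule.add_mem_sup (L.neg_mem hl) hxK
        exact ((L ⊔ K i).smul_mem_iff hc).mp h2

variable {t : ℕ}

theorem exists_linP_eq (φ : (Fin t → ℂ) →ₗ[ℂ] ℂ) : ∃ c : Fin t → ℂ, ∀ x, c ⬝ᵥ x = φ x := by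
  refine ⟨fun j => φ (Pi.single j 1), fun x => ?_⟩
  conv_rhs => rw [← Finset.univ_sum_single x]
  rw [map_sum, dotProduct]
  refine Finset.sum_congr rfl fun j _ => ?_
  rw [show Pi.single j (x j) = x j • (Pi.single j 1 : Fin t → ℂ) by
    rw [← Pi.single_smul, smul_eq_mul, mul_one], map_smul, smul_eq_mul, mul_comm]

theorem exists_linP_of_notMem {W : Submodule ℂ (Fin t → ℂ)} {x : Fin t → ℂ} (hx : x ∉ W) :
    ∃ c : Fin t → ℂ, c ⬝ᵥ x ≠ 0 ∧ ∀ w ∈ W, c ⬝ᵥ w = 0 := by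
  obtain ⟨φ, h1, h2⟩ := Submodule.exists_le_ker_of_notMem hx
  obtain ⟨c, hc⟩ := exists_linP_eq φ
  exact ⟨c, by rwa [hc], fun w hw => by rw [hc]; exact h2 hw⟩

theorem exists_zero_notMem_of_finite {P : Ideal (MvPolynomial (Fin t) ℂ)} [P.IsPrime]
    {ι : Type*} (s : Finset ι) (W : ι → Submodule ℂ (Fin t → ℂ))
    (h : ∀ i ∈ s, ∃ x, (∀ q ∈ P, eval x q = 0) ∧ x ∉ W i) :
    ∃ x, (∀ q ∈ P, eval x q = 0) ∧ ∀ i ∈ s, x ∉ W i := by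
  have key : ∀ i ∈ s, ∃ c : Fin t → ℂ, linP c ∉ P ∧ ∀ w ∈ W i, c ⬝ᵥ w = 0 := fun i hi => by
    obtain ⟨x, hx, hxW⟩ := h i hi
    obtain ⟨c, hc, hcW⟩ := exists_linP_of_notMem hxW
    exact ⟨c, fun hcP => hc (by simpa using hx _ hcP), hcW⟩
  choose! c hc hcW using key
  have : ∏ i ∈ s, linP (c i) ∉ P := by
    rw [Ideal.IsPrime.prod_mem_iff]
    push Not
    exact hc
  obtain ⟨x, hx, hxe⟩ := exists_eval_ne_zero_of_notMem this
  refine ⟨x, hx, fun i hi hxW => hxe ?_⟩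
  rw [map_prod]
  exact Finset.prod_eq_zero hi (by rw [eval_linP, hcW i hi x hxW])

theorem exists_general_points {P : Ideal (MvPolynomial (Fin t) ℂ)} [P.IsPrime] {k : ℕ} (hk : 1 ≤ k)
    (h : ∀ W : Submodule ℂ (Fin t → ℂ), Module.finrank ℂ W ≤ k →
      ∃ x, (∀ q ∈ P, eval x q = 0) ∧ x ∉ W) (N : ℕ) :
    ∃ Y : Finset (Fin t → ℂ), Y.card = N ∧ (∀ y ∈ Y, ∀ q ∈ P, eval y q = 0) ∧
      ∀ y ∈ Y, ∀ s ⊆ Y, s.card ≤ k → y ∉ s → y ∉ Submodule.span ℂ (s : Set (Fin t → ℂ)) := by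
  classical
  induction N with
  | zero => exact ⟨∅, rfl, by simp, by simp⟩
  | succ N ih =>
    obtain ⟨Y, hY, hYP, hYs⟩ := ih
    obtain ⟨z, hz, hzs⟩ := exists_zero_notMem_of_finite (P := P)
      (Y.powerset.filter fun s => s.card ≤ k)
      (fun s => Submodule.span ℂ (s : Set (Fin t → ℂ))) fun s hs =>
        h _ ((finrank_span_finset_le_card s).trans (Finset.mem_filter.mp hs).2)
    have hzs' : ∀ s ⊆ Y, s.card ≤ k → z ∉ Submodule.span ℂ (s : Set (Fin t → ℂ)) :=
      fun s hs hsk => hzs s (Finset.mem_filter.mpr ⟨Finset.mem_powerset.mpr hs, hsk⟩)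
    have hzY : z ∉ Y := fun hzY => hzs' {z} (by simpa using hzY) (by simpa using hk)
      (Submodule.subset_span (by simp))
    refine ⟨insert z Y, by rw [Finset.card_insert_of_notMem hzY, hY], ?_, ?_⟩
    · intro y hy
      rcases Finset.mem_insert.mp hy with rfl | hy
      · exact hz
      · exact hYP y hy
    · intro y hy s hs hsk hys
      by_cases hzs0 : z ∈ s
      · have hyz : y ≠ z := fun h => hys (h ▸ hzs0)
        have hyY : y ∈ Y := (Finset.mem_insert.mp hy).resolve_left hyz
        have hs' : s.erase z ⊆ Y := by
          rw [← Finset.subset_insert_iff]; exact hs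
        have hcard : (s.erase z).card + 1 = s.card := Finset.card_erase_add_one hzs0
        have hys' : y ∉ s.erase z := fun h => hys (Finset.mem_of_mem_erase h)
        intro hspan
        rw [← Finset.insert_erase hzs0, Finset.coe_insert] at hspan
        have h1 := mem_span_insert_exchange hspan (hYs y hyY _ hs' (by omega) hys')
        rw [← Finset.coe_insert] at h1
        refine hzs' _ (Finset.insert_subset hyY hs') ?_ h1
        rw [Finset.card_insert_of_notMem hys']
        omega
      · have hsY : s ⊆ Y := by
          rwa [Finset.subset_insert_iff, Finset.erase_eq_of_notMem hzs0] at hs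
        rcases Finset.mem_insert.mp hy with rfl | hyY
        · exact hzs' s hsY hsk
        · exact hYs y hyY s hsY hsk hys

theorem exists_separating_form {k : ℕ} (i : ℕ) (y : Fin t → ℂ) (Z : Finset (Fin t → ℂ))
    (hZ : Z.card ≤ i * k)
    (h : ∀ s ⊆ Z, s.card ≤ k → y ∉ Submodule.span ℂ (s : Set (Fin t → ℂ))) :
    ∃ f : MvPolynomial (Fin t) ℂ, f.IsHomogeneous i ∧ eval y f ≠ 0 ∧ ∀ z ∈ Z, eval z f = 0 := by
  classical
  induction i generalizing Z with
  | zero =>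
    refine ⟨1, isHomogeneous_one _ _, by simp, ?_⟩
    have : Z = ∅ := by simpa using hZ
    simp [this]
  | succ i ih =>
    obtain ⟨s, hsZ, hs⟩ := Finset.exists_subset_card_eq (min_le_right k Z.card)
    obtain ⟨f, hf, hfy, hfz⟩ := ih (Z \ s) (by
      rw [Finset.card_sdiff_of_subset hsZ, hs]
      rw [Nat.succ_mul] at hZ
      omega) fun r hr => h r (hr.trans Finset.sdiff_subset)
    obtain ⟨c, hc, hcs⟩ := exists_linP_of_notMem (h s hsZ (by omega))
    refine ⟨f * linP c, hf.mul (linP_isHomogeneous c), ?_, fun z hz => ?_⟩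
    · rw [map_mul, eval_linP]
      exact mul_ne_zero hfy hc
    · rw [map_mul, eval_linP]
      by_cases hzs : z ∈ s
      · rw [hcs z (Submodule.subset_span hzs), mul_zero]
      · rw [hfz z (Finset.mem_sdiff.mpr ⟨hz, hzs⟩), zero_mul]

/-- There is an `e`-dimensional linear family of perturbations of `q`, generically improving
the degree `J` components to meet a codimension `m` subspace properly. -/
def HasSlice (J : Finset ℕ) (n m e : ℕ) (q : MvPolynomial (Fin t) ℂ) : Prop :=
  ∃ L : Submodule ℂ (MvPolynomial (Fin t) ℂ), L ≤ Pol t n ∧ e ≤ Module.finrank ℂ L ∧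
    ∃ K : MvPolynomial (Fin t) ℂ → ℂ, IsPolyFun K ∧ K q ≠ 0 ∧
      ∀ l ∈ L, l ≠ 0 → K (q + l) ≠ 0 → Cut (homs J (q + l)) m

theorem hasSlice_of_points {n : ℕ} {S : Finset ℕ} (hS : S ⊆ Finset.Icc 2 n) {k m : ℕ} (hk : 1 ≤ k)
    {q : MvPolynomial (Fin t) ℂ} (hcut : Cut (homs S q) (m + 1))
    (hP : ∀ P : Ideal (MvPolynomial (Fin t) ℂ), P.IsPrime → homs (Finset.Icc 2 n) q ⊆ P →
      P ≤ originIdeal t → pdim P = m + 1 → ∀ W : Submodule ℂ (Fin t → ℂ), Module.finrank ℂ W ≤ k →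
        ∃ x, (∀ q ∈ P, eval x q = 0) ∧ x ∉ W)
    (hne : ¬ Cut (homs (Finset.Icc 2 n) q) m) :
    HasSlice (Finset.Icc 2 n) n m (∑ i ∈ Finset.Icc 2 n \ S, (i * k + 1)) q := by
  classical
  set A := Finset.Icc 2 n \ S with hA
  set J := Finset.Icc 2 n with hJ
  have hJ2 : ∀ i ∈ J, 2 ≤ i := fun i hi => (Finset.mem_Icc.mp hi).1
  let W : Submodule ℂ (MvPolynomial (Fin t) ℂ) :=
    Pol t n ⊓ ⨅ i ∈ S, LinearMap.ker (homogeneousComponent i)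
  have hWmem : ∀ l, l ∈ W ↔ l ∈ Pol t n ∧ ∀ i ∈ S, homogeneousComponent i l = 0 := fun l => by
    simp [W, Submodule.mem_iInf]
  have hWA : ∀ i ∈ A, ∀ f : MvPolynomial (Fin t) ℂ, f.IsHomogeneous i → f ∈ W := by
    intro i hi f hf
    rw [hWmem]
    have hi' := Finset.mem_sdiff.mp hi
    have hi2 := Finset.mem_Icc.mp hi'.1
    refine ⟨?_, fun j hj => ?_⟩
    · rw [← homogeneousComponent_eq_self hf]
      exact homogeneousComponent_mem_pol hi2.1 hi2.2 f
    · rw [homogeneousComponent_of_mem hf, if_neg]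
      rintro rfl
      exact hi'.2 hj
  have := finite_pol t n
  have hWfin : FiniteDimensional ℂ W := Submodule.finiteDimensional_inf_left _ _
  have hYex : ∀ (P : badPrimes S J (m + 1) q) (i : ℕ), ∃ Y : Finset (Fin t → ℂ), Y.card = i * k + 1 ∧
      (∀ y ∈ Y, ∀ q ∈ P.1, eval y q = 0) ∧
      ∀ y ∈ Y, ∀ s ⊆ Y, s.card ≤ k → y ∉ s → y ∉ Submodule.span ℂ (s : Set (Fin t → ℂ)) :=
    fun P i => by
      have := P.2.1.1.1
      exact exists_general_points hk (hP P.1 this P.2.2.1 P.2.2.2.1 P.2.2.2.2) _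
  choose Y hY hYP hYs using hYex
  have hfex : ∀ (P : badPrimes S J (m + 1) q) (i : ℕ), ∀ y ∈ Y P i, ∃ f : MvPolynomial (Fin t) ℂ,
      f.IsHomogeneous i ∧ eval y f ≠ 0 ∧ ∀ z ∈ (Y P i).erase y, eval z f = 0 := fun P i y hy =>
    exists_separating_form i y _ (by rw [Finset.card_erase_of_mem hy, hY]; omega) fun s hs hsk =>
      hYs P i y hy s (hs.trans (Finset.erase_subset _ _)) hsk fun hys => by
        simpa using hs hys
  choose! f hf1 hf2 hf3 using hfex
  let ev : ∀ P : badPrimes S J (m + 1) q, W →ₗ[ℂ] ((i : A) → (Y P i) → ℂ) := fun P =>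
    (LinearMap.pi fun i => LinearMap.pi fun y =>
      (MvPolynomial.aeval y.1).toLinearMap ∘ₗ homogeneousComponent i.1) ∘ₗ W.subtype
  have hev : ∀ P w i y, ev P w i y = eval y.1 (homogeneousComponent i.1 w.1) := fun _ _ _ _ => rfl
  have hsurj : ∀ P, Function.Surjective (ev P) := by
    intro P c
    refine ⟨∑ i : A, ∑ y : Y P i, (c i y / eval y.1 (f P i y)) • ⟨f P i y,
      hWA i i.2 _ (hf1 P i y y.2)⟩, ?_⟩
    ext i y
    rw [hev]
    simp only [Submodule.coe_sum, Submodule.coe_smul, map_sum, map_smul]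
    rw [Finset.sum_eq_single i, Finset.sum_eq_single y]
    · rw [homogeneousComponent_eq_self (hf1 P i y y.2), smul_eval]
      field_simp [hf2 P i y y.2]
    · intro z _ hz
      rw [homogeneousComponent_eq_self (hf1 P i z z.2), smul_eval, hf3 P i z z.2 y.1, mul_zero]
      exact Finset.mem_erase.mpr ⟨fun h => hz (Subtype.ext h.symm), y.2⟩
    · simp
    · intro j _ hj
      refine Finset.sum_eq_zero fun z _ => ?_
      rw [homogeneousComponent_of_mem (hf1 P j z z.2), if_neg, smul_zero, map_zero]
      exact fun h => hj (Subtype.ext h.symm)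
    · simp
  have hfr : ∀ P : badPrimes S J (m + 1) q,
      Module.finrank ℂ (LinearMap.ker (ev P)) + ∑ i ∈ A, (i * k + 1) = Module.finrank ℂ W := by
    intro P
    have h1 := LinearMap.finrank_range_add_finrank_ker (ev P)
    rw [LinearMap.range_eq_top.mpr (hsurj P), finrank_top, Module.finrank_pi_fintype] at h1
    simp only [Module.finrank_fintype_fun_eq_card, Fintype.card_coe, hY] at h1
    rw [Finset.sum_coe_sort A (fun i => i * k + 1)] at h1
    omega
  have : Finite (badPrimes S J (m + 1) q) := finite_badPrimes S J (m + 1) q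
  have hbad : Nonempty (badPrimes S J (m + 1) q) := by
    by_contra hemp
    refine hne (cut_of_forall_pdim_le (homSet_homs hJ2 q) fun P hPp hFP hP0 => ?_)
    by_contra! hd
    obtain ⟨h1, h2⟩ := mem_minimalPrimes_of_pdim hcut ((homs_mono hS q).trans hFP) hP0 hd
    exact hemp ⟨P, h1, hFP, hP0, h2⟩
  obtain ⟨L, hL, hdis⟩ := exists_disjoint_submodule (fun P => LinearMap.ker (ev P))
    (∑ i ∈ A, (i * k + 1)) (by have := hfr hbad.some; omega) fun P => (hfr P).le
  refine ⟨L.map W.subtype, ?_, ?_, ?_⟩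
  · rintro _ ⟨l, -, rfl⟩
    exact ((hWmem _).mp l.2).1
  · rw [Submodule.finrank_map_subtype_eq, hL]
  · refine exists_isPolyFun_cut_add hS hJ2 hcut _ ?_ ?_
    · rintro _ ⟨l, -, rfl⟩
      exact ((hWmem _).mp l.2).2
    · rintro P hPb _ ⟨l, hl, rfl⟩ hl0
      by_contra! hcon
      apply hl0
      have : l = 0 := Submodule.disjoint_def.mp (hdis ⟨P, hPb⟩) l hl (by
        rw [LinearMap.mem_ker]
        ext i y
        rw [hev]
        exact hYP ⟨P, hPb⟩ i y y.2 _ (hcon i (Finset.mem_sdiff.mp i.2).1))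
      rw [this, map_zero]

end Points

theorem finrank_homogeneousSubmodule (m i : ℕ) :
    Module.finrank ℂ (homogeneousSubmodule (Fin m) ℂ i) = (m + i - 1).choose i := by
  have h1 : homogeneousSubmodule (Fin m) ℂ i = Submodule.span ℂ
      (Set.range fun d : (Finset.univ : Finset (Fin m)).finsuppAntidiag i =>
        monomial (R := ℂ) d.1 1) := by
    apply le_antisymm
    · intro f hf
      rw [mem_homogeneousSubmodule] at hf
      rw [f.as_sum]
      refine Submodule.sum_mem _ fun d hd => ?_
      rw [show monomial d (coeff d f) = coeff d f • monomial (R := ℂ) d 1 by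
        rw [smul_monomial, smul_eq_mul, mul_one]]
      refine Submodule.smul_mem _ _ (Submodule.subset_span ⟨⟨d, ?_⟩, rfl⟩)
      rw [Finset.mem_finsuppAntidiag]
      refine ⟨?_, Finset.subset_univ _⟩
      have := hf (mem_support_iff.mp hd)
      simpa [Finsupp.weight_apply, Finsupp.sum_fintype] using this
    · rw [Submodule.span_le]
      rintro _ ⟨d, rfl⟩
      refine isHomogeneous_monomial _ ?_
      rw [Finsupp.degree_eq_sum]
      exact (Finset.mem_finsuppAntidiag.mp d.2).1
  rw [h1, finrank_span_eq_card, Fintype.card_coe, Finset.card_finsuppAntidiag_nat_eq_choose,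
    Finset.card_fin]
  exact (basisMonomials (Fin m) ℂ).linearIndependent.comp _ Subtype.val_injective

theorem exists_forms_line {m : ℕ} {y : Fin (m + 1) → ℂ} (hy : y ≠ 0) :
    ∃ c : Fin m → Fin (m + 1) → ℂ, ∀ z, (∀ j, c j ⬝ᵥ z = 0) → ∃ s : ℂ, z = s • y := by
  obtain ⟨j, hj⟩ := Function.ne_iff.mp hy
  rw [Pi.zero_apply] at hj
  refine ⟨fun k => y j • Pi.single (j.succAbove k) 1 - y (j.succAbove k) • Pi.single j 1,
    fun z hz => ⟨z j / y j, ?_⟩⟩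
  ext i
  rw [Pi.smul_apply, smul_eq_mul, div_mul_eq_mul_div, eq_div_iff hj]
  rcases Fin.eq_self_or_eq_succAbove j i with rfl | ⟨k, rfl⟩
  · ring
  · have := hz k
    simp only [sub_dotProduct, smul_dotProduct, single_dotProduct, one_mul, smul_eq_mul,
      sub_eq_zero] at this
    linear_combination this

section Forms

variable {t : ℕ}

theorem aeval_linP_mem_iff {m i : ℕ} (hi : 0 < i) (l : Fin (m + 1) → Fin t → ℂ)
    {P : Ideal (MvPolynomial (Fin t) ℂ)} [P.IsPrime] (hP0 : P ≤ originIdeal t)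
    (hl : ∀ x, (∀ q ∈ P, eval x q = 0) → (∀ j, l j ⬝ᵥ x = 0) → x = 0) (hPm : m < pdim P)
    {μ : MvPolynomial (Fin (m + 1)) ℂ} (hμ : μ.IsHomogeneous i)
    (h : aeval (fun j => linP (l j)) μ ∈ P) : μ = 0 := by
  by_contra hne
  obtain ⟨y, hy⟩ : ∃ y, eval y μ ≠ 0 := by
    by_contra! hcon
    exact hne (MvPolynomial.funext fun y => by rw [hcon, map_zero])
  have hy0 : y ≠ 0 := by
    rintro rfl
    apply hy
    have := eval_smul_of_isHomogeneous hμ 0 0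
    rwa [zero_smul, zero_pow hi.ne', zero_mul] at this
  obtain ⟨c, hc⟩ := exists_forms_line hy0
  refine absurd (pdim_le_of_forall_eq_zero hP0 (d := m)
    (fun j => aeval (fun k => linP (l k)) (linP (c j)))
    (fun j => ?_) fun x hx hcx => ?_) (not_le.mpr hPm)
  · rw [eval_aeval, eval_linP]
    simp only [eval_linP, dotProduct_zero]
    exact dotProduct_zero _
  · obtain ⟨s, hs⟩ := hc (fun k => l k ⬝ᵥ x) fun j => by
      have := hcx j
      rw [eval_aeval, eval_linP] at this
      simpa only [eval_linP] using this
    have h1 := hx _ h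
    rw [eval_aeval] at h1
    simp only [eval_linP] at h1
    rw [hs, eval_smul_of_isHomogeneous hμ] at h1
    have hs0 : s = 0 := by
      rcases mul_eq_zero.mp h1 with h1 | h1
      · exact pow_eq_zero_iff hi.ne' |>.mp h1
      · exact (hy h1).elim
    refine hl x hx fun j => ?_
    rw [show l j ⬝ᵥ x = (s • y) j from congrFun hs j, hs0, zero_smul, Pi.zero_apply]

theorem hasSlice_of_forms {n i m : ℕ} (hi : 2 ≤ i) (hin : i ≤ n) {q : MvPolynomial (Fin t) ℂ}
    (hcut : Cut (homs (Finset.Icc 2 (i - 1)) q) (m + 1)) (hne : ¬ Cut (homs (Finset.Icc 2 i) q) m) :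
    HasSlice (Finset.Icc 2 i) n m ((m + i).choose i) q := by
  have hS : Finset.Icc 2 (i - 1) ⊆ Finset.Icc 2 i := Finset.Icc_subset_Icc_right (by omega)
  have hJ2 : ∀ j ∈ Finset.Icc 2 i, 2 ≤ j := fun j hj => (Finset.mem_Icc.mp hj).1
  obtain ⟨l, hl⟩ := hcut
  let ψ : homogeneousSubmodule (Fin (m + 1)) ℂ i →ₗ[ℂ] MvPolynomial (Fin t) ℂ :=
    (aeval fun j => linP (l j)).toLinearMap ∘ₗ Submodule.subtype _
  have hψ : ∀ μ, (ψ μ).IsHomogeneous i := fun μ => by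
    have := IsHomogeneous.aeval μ.2 (fun j => linP (l j)) fun j => linP_isHomogeneous (l j)
    rwa [one_mul] at this
  have key : ∀ P ∈ badPrimes (Finset.Icc 2 (i - 1)) (Finset.Icc 2 i) (m + 1) q, ∀ μ, ψ μ ∈ P → μ = 0 := by
    intro P hP μ hμ
    have := hP.1.1.1
    refine Subtype.ext (aeval_linP_mem_iff (by omega) l hP.2.2.1 (fun x hx hlx => ?_)
      (by rw [hP.2.2.2]; omega) μ.2 hμ)
    exact hl x (fun f hf => hx f (hP.2.1 (homs_mono hS q hf))) hlx
  have hbad : ∃ P, P ∈ badPrimes (Finset.Icc 2 (i - 1)) (Finset.Icc 2 i) (m + 1) q := by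
    by_contra hemp
    refine hne (cut_of_forall_pdim_le (homSet_homs hJ2 q) fun P hPp hFP hP0 => ?_)
    by_contra! hd
    obtain ⟨h1, h2⟩ := mem_minimalPrimes_of_pdim ⟨l, hl⟩ ((homs_mono hS q).trans hFP) hP0 hd
    exact hemp ⟨P, h1, hFP, hP0, h2⟩
  obtain ⟨P₀, hP₀⟩ := hbad
  have hinj : Function.Injective ψ := by
    rw [injective_iff_map_eq_zero]
    exact fun μ hμ => key P₀ hP₀ μ (hμ ▸ P₀.zero_mem)
  refine ⟨LinearMap.range ψ, ?_, ?_, ?_⟩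
  · rintro _ ⟨μ, rfl⟩
    rw [← homogeneousComponent_eq_self (hψ μ)]
    exact homogeneousComponent_mem_pol hi hin _
  · rw [LinearMap.finrank_range_of_inj hinj, finrank_homogeneousSubmodule,
      show m + 1 + i - 1 = m + i by omega]
  · refine exists_isPolyFun_cut_add hS hJ2 ⟨l, hl⟩ _ ?_ ?_
    · rintro _ ⟨μ, rfl⟩ j hj
      rw [homogeneousComponent_of_mem (hψ μ), if_neg]
      have := Finset.mem_Icc.mp hj
      omega
    · rintro P hP _ ⟨μ, rfl⟩ hne0
      refine ⟨i, by simp [hi], fun hmem => hne0 ?_⟩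
      rw [homogeneousComponent_eq_self (hψ μ)] at hmem
      rw [key P hP μ hmem, map_zero]

end Forms

section Triangular

variable {t : ℕ}

/-- The `j`-th component of the triangular change of equations given by `c` and `a`. -/
def triComp (c : ℕ → ℂ) (a : ℕ → ℕ → MvPolynomial (Fin t) ℂ) (j : ℕ) :
    MvPolynomial (Fin t) ℂ →ₗ[ℂ] MvPolynomial (Fin t) ℂ :=
  c j • homogeneousComponent j +
    ∑ k ∈ Finset.Ico 2 j, LinearMap.mulLeft ℂ (a j k) ∘ₗ homogeneousComponent k

theorem triComp_apply (c : ℕ → ℂ) (a : ℕ → ℕ → MvPolynomial (Fin t) ℂ) (j : ℕ)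
    (q : MvPolynomial (Fin t) ℂ) : triComp c a j q =
      c j • homogeneousComponent j q + ∑ k ∈ Finset.Ico 2 j, a j k * homogeneousComponent k q := by
  simp [triComp]

theorem triComp_isHomogeneous {c : ℕ → ℂ} {a : ℕ → ℕ → MvPolynomial (Fin t) ℂ}
    (ha : ∀ j k, (a j k).IsHomogeneous (j - k)) (j : ℕ) (q : MvPolynomial (Fin t) ℂ) :
    (triComp c a j q).IsHomogeneous j := by
  rw [triComp_apply]
  refine IsHomogeneous.add ?_ (IsHomogeneous.sum _ _ _ fun k hk => ?_)
  · exact (homogeneousSubmodule (Fin t) ℂ j).smul_mem _ (homogeneousComponent_isHomogeneous j q)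
  · have := (ha j k).mul (homogeneousComponent_isHomogeneous k q)
    rwa [Nat.sub_add_cancel (Finset.mem_Ico.mp hk).2.le] at this

theorem triComp_mem_iff {c : ℕ → ℂ} (hc : ∀ j, c j ≠ 0) (a : ℕ → ℕ → MvPolynomial (Fin t) ℂ)
    (P : Ideal (MvPolynomial (Fin t) ℂ)) (n : ℕ) (q : MvPolynomial (Fin t) ℂ) :
    (∀ j ∈ Finset.Icc 2 n, triComp c a j q ∈ P) ↔
      ∀ j ∈ Finset.Icc 2 n, homogeneousComponent j q ∈ P := by
  have hlow : ∀ j ∈ Finset.Icc 2 n, (∀ k ∈ Finset.Ico 2 j, homogeneousComponent k q ∈ P) →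
      (triComp c a j q ∈ P ↔ homogeneousComponent j q ∈ P) := by
    intro j _ h
    rw [triComp_apply, P.add_mem_iff_left (Ideal.sum_mem _ fun k hk => P.mul_mem_left _ (h k hk))]
    exact (P.restrictScalars ℂ).smul_mem_iff (hc j)
  constructor
  · intro h j
    induction j using Nat.strong_induction_on with
    | _ j ih =>
      intro hj
      refine (hlow j hj fun k hk => ?_).mp (h j hj)
      simp only [Finset.mem_Ico, Finset.mem_Icc] at *
      exact ih k hk.2 ⟨hk.1, by omega⟩
  · intro h j hj
    refine (hlow j hj fun k hk => h k ?_).mpr (h j hj)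
    simp only [Finset.mem_Ico, Finset.mem_Icc] at *
    exact ⟨hk.1, by omega⟩

theorem exists_triComp_cut {q : MvPolynomial (Fin t) ℂ} (i : ℕ) {ν : ℕ} (hν : ν ≤ t)
    (hcut : Cut (homs (Finset.Icc 2 i) q) ν) :
    ∃ S ⊆ Finset.Icc 2 i, S.card + ν ≤ t ∧ ∃ (c : ℕ → ℂ) (a : ℕ → ℕ → MvPolynomial (Fin t) ℂ),
      (∀ j, c j ≠ 0) ∧ (∀ j k, (a j k).IsHomogeneous (j - k)) ∧
        Cut ((fun j => triComp c a j q) '' S) ν := by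
  classical
  induction i generalizing ν with
  | zero =>
    refine ⟨∅, by simp, by simpa using hν, fun _ => 1, fun _ _ => 0, by simp,
      fun _ _ => isHomogeneous_zero _ _ _, ?_⟩
    simpa [homs] using hcut
  | succ i ih =>
    by_cases hi : i = 0
    · subst hi
      refine ⟨∅, by simp, by simpa using hν, fun _ => 1, fun _ _ => 0, by simp,
        fun _ _ => isHomogeneous_zero _ _ _, ?_⟩
      simpa [homs] using hcut
    have hins : Finset.Icc 2 (i + 1) = insert (i + 1) (Finset.Icc 2 i) := by
      ext j
      simp only [Finset.mem_Icc, Finset.mem_insert]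
      omega
    have hsub : Finset.Icc 2 i ⊆ Finset.Icc 2 (i + 1) := Finset.Icc_subset_Icc_right (by omega)
    by_cases hc0 : Cut (homs (Finset.Icc 2 i) q) ν
    · obtain ⟨S, hS, h⟩ := ih hν hc0
      exact ⟨S, hS.trans hsub, h⟩
    have hJ2 : ∀ j ∈ Finset.Icc 2 i, 2 ≤ j := fun j hj => (Finset.mem_Icc.mp hj).1
    have hνt : ν + 1 ≤ t := by
      rcases hν.lt_or_eq with h | rfl
      · exact h
      · exact (hc0 (cut_self _)).elim
    have hdrop : Cut (homs (Finset.Icc 2 i) q) (ν + 1) := by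
      refine Cut.drop (homSet_homs hJ2 q) (q := homogeneousComponent (i + 1) q) ?_ ?_
      · have := eval_smul_of_isHomogeneous (homogeneousComponent_isHomogeneous (i + 1) q) 0 0
        rwa [zero_smul, zero_pow (by omega), zero_mul] at this
      · rwa [← homs_insert, ← hins]
    obtain ⟨S, hS, hSc, c, a, hc, ha, hScut⟩ := ih hνt hdrop
    have hiS : i + 1 ∉ S := fun h => by
      have := (Finset.mem_Icc.mp (hS h)).2
      omega
    set F := (fun j => triComp c a j q) '' (S : Set ℕ) with hF
    let B := {P ∈ (Ideal.span F).minimalPrimes | P ≤ originIdeal t ∧ pdim P = ν + 1}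
    have hB : B.Finite :=
      ((Ideal.span F).finite_minimalPrimes_of_isNoetherianRing).subset fun _ h => h.1
    have : Finite B := hB
    let Φ : (ℂ × ((k : ℕ) → homogeneousSubmodule (Fin t) ℂ (i + 1 - k))) →ₗ[ℂ] MvPolynomial (Fin t) ℂ :=
      (LinearMap.toSpanSingleton ℂ _ (homogeneousComponent (i + 1) q)) ∘ₗ LinearMap.fst ℂ _ _ +
        ∑ k ∈ Finset.Ico 2 (i + 1), LinearMap.mulRight ℂ (homogeneousComponent k q) ∘ₗ
          Submodule.subtype _ ∘ₗ LinearMap.proj k ∘ₗ LinearMap.snd ℂ _ _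
    have hΦ : ∀ v, Φ v = v.1 • homogeneousComponent (i + 1) q +
        ∑ k ∈ Finset.Ico 2 (i + 1), (v.2 k : MvPolynomial (Fin t) ℂ) * homogeneousComponent k q := by
      intro v
      simp [Φ]
    let p : Option B → Submodule ℂ (ℂ × ((k : ℕ) → homogeneousSubmodule (Fin t) ℂ (i + 1 - k))) :=
      fun o => o.elim (LinearMap.ker (LinearMap.fst ℂ _ _)) fun P => (P.1.restrictScalars ℂ).comap Φ
    have hp : ∀ o, p o ≠ ⊤ := by
      intro o htop
      rcases o with _ | ⟨P, hP⟩
      · have : ((1 : ℂ), (0 : (k : ℕ) → homogeneousSubmodule (Fin t) ℂ (i + 1 - k))) ∈ p none := by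
          rw [htop]; trivial
        exact one_ne_zero (α := ℂ) this
      · have hPp := hP.1.1.1
        have hnot : ∃ k ∈ Finset.Icc 2 (i + 1), homogeneousComponent k q ∉ P := by
          by_contra! hcon
          have := hcut.pdim_le P (homs_subset_iff.mpr hcon) hP.2.1
          have := hP.2.2
          omega
        obtain ⟨k, hk, hkP⟩ := hnot
        rw [Finset.mem_Icc] at hk
        have hall : ∀ v, Φ v ∈ P := fun v => by
          have : v ∈ p (some ⟨P, hP⟩) := by rw [htop]; trivial
          exact this
        by_cases hki : k = i + 1
        · subst hki
          apply hkP
          have := hall (1, 0)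
          rw [hΦ] at this
          simpa using this
        · obtain ⟨x, hx⟩ := exists_X_notMem hP.2.1 (by
            rintro rfl
            have := hP.2.2
            rw [pdim_originIdeal] at this
            omega)
          have := hall (0, Pi.single k ⟨X x ^ (i + 1 - k), by
            simpa using (isHomogeneous_X ℂ x).pow (i + 1 - k)⟩)
          rw [hΦ, Finset.sum_eq_single k] at this
          · simp only [zero_smul, zero_add, Pi.single_eq_same] at this
            rcases hPp.mem_or_mem this with h | h
            · exact hx (hPp.mem_of_pow_mem _ h)
            · exact hkP h
          · intro k' _ hk'
            simp [Pi.single_eq_of_ne hk']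
          · intro h
            exact (h (Finset.mem_Ico.mpr ⟨hk.1, by omega⟩)).elim
    obtain ⟨v, hv⟩ := Submodule.exists_forall_notMem_of_forall_ne_top p hp
    have hv0 : v.1 ≠ 0 := hv none
    refine ⟨insert (i + 1) S, ?_, ?_, fun j => if j = i + 1 then v.1 else c j,
      fun j k => if j = i + 1 then (v.2 k : MvPolynomial (Fin t) ℂ) else a j k, ?_, ?_, ?_⟩
    · rw [hins]
      exact Finset.insert_subset_insert _ hS
    · rw [Finset.card_insert_of_notMem hiS]
      omega
    · intro j
      dsimp only
      split_ifs
      exacts [hv0, hc j]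
    · intro j k
      dsimp only
      split_ifs with h
      · subst h; exact (v.2 k).2
      · exact ha j k
    · have himg : (fun j => triComp (fun j => if j = i + 1 then v.1 else c j)
          (fun j k => if j = i + 1 then (v.2 k : MvPolynomial (Fin t) ℂ) else a j k) j q) ''
            ((insert (i + 1) S : Finset ℕ) : Set ℕ) = insert (Φ v) F := by
        rw [Finset.coe_insert, Set.image_insert_eq, hF]
        congr 1
        · rw [triComp_apply, hΦ]
          simp
        · refine Set.image_congr fun j hj => ?_
          have hji : j ≠ i + 1 := fun h => hiS (h ▸ hj)
          rw [triComp_apply, triComp_apply]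
          simp [hji]
      rw [himg]
      have hFhom : HomSet (insert (Φ v) F) := by
        intro f hf
        rcases hf with rfl | ⟨j, hj, rfl⟩
        · refine ⟨i + 1, by omega, ?_⟩
          rw [hΦ]
          refine IsHomogeneous.add ?_ (IsHomogeneous.sum _ _ _ fun k hk => ?_)
          · exact (homogeneousSubmodule (Fin t) ℂ _).smul_mem _ (homogeneousComponent_isHomogeneous _ q)
          · have := (show IsHomogeneous (v.2 k).1 _ from (v.2 k).2).mul
              (homogeneousComponent_isHomogeneous k q)
            rwa [Nat.sub_add_cancel (Finset.mem_Ico.mp hk).2.le] at this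
        · have := hJ2 j (hS hj)
          exact ⟨j, by omega, triComp_isHomogeneous ha j q⟩
      refine cut_of_forall_pdim_le hFhom fun P hPp hFP hP0 => ?_
      by_contra! hd
      obtain ⟨h1, h2⟩ := mem_minimalPrimes_of_pdim hScut ((Set.subset_insert _ _).trans hFP) hP0 hd
      exact hv (some ⟨P, h1, hP0, h2⟩) (hFP (Set.mem_insert _ _))

/-- The triangular change of equations given by `c` and `a`, in degrees `2, …, n`. -/
def triMap (c : ℕ → ℂ) (a : ℕ → ℕ → MvPolynomial (Fin t) ℂ) (n : ℕ) :
    MvPolynomial (Fin t) ℂ →ₗ[ℂ] MvPolynomial (Fin t) ℂ :=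
  ∑ j ∈ Finset.Icc 2 n, triComp c a j

theorem homogeneousComponent_triMap {c : ℕ → ℂ} {a : ℕ → ℕ → MvPolynomial (Fin t) ℂ}
    (ha : ∀ j k, (a j k).IsHomogeneous (j - k)) {n j : ℕ} (hj : j ∈ Finset.Icc 2 n)
    (q : MvPolynomial (Fin t) ℂ) : homogeneousComponent j (triMap c a n q) = triComp c a j q := by
  rw [triMap, LinearMap.sum_apply, map_sum, Finset.sum_eq_single j]
  · exact homogeneousComponent_eq_self (triComp_isHomogeneous ha j q)
  · intro k _ hk
    rw [homogeneousComponent_of_mem (triComp_isHomogeneous ha k q), if_neg hk.symm]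
  · exact fun h => (h hj).elim

theorem triMap_mem_pol {c : ℕ → ℂ} {a : ℕ → ℕ → MvPolynomial (Fin t) ℂ}
    (ha : ∀ j k, (a j k).IsHomogeneous (j - k)) (n : ℕ) (q : MvPolynomial (Fin t) ℂ) :
    triMap c a n q ∈ Pol t n := by
  rw [triMap, LinearMap.sum_apply]
  refine Submodule.sum_mem _ fun j hj => ?_
  rw [← homogeneousComponent_eq_self (triComp_isHomogeneous ha j q)]
  exact homogeneousComponent_mem_pol (Finset.mem_Icc.mp hj).1 (Finset.mem_Icc.mp hj).2 _

theorem homs_triMap_subset_iff {c : ℕ → ℂ} (hc : ∀ j, c j ≠ 0)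
    {a : ℕ → ℕ → MvPolynomial (Fin t) ℂ} (ha : ∀ j k, (a j k).IsHomogeneous (j - k)) (n : ℕ)
    (q : MvPolynomial (Fin t) ℂ) (P : Ideal (MvPolynomial (Fin t) ℂ)) :
    homs (Finset.Icc 2 n) (triMap c a n q) ⊆ P ↔ homs (Finset.Icc 2 n) q ⊆ P := by
  rw [homs_subset_iff, homs_subset_iff, ← triComp_mem_iff hc a P n q]
  exact forall₂_congr fun j hj => by rw [homogeneousComponent_triMap ha hj]

theorem cut_triMap_iff {c : ℕ → ℂ} (hc : ∀ j, c j ≠ 0)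
    {a : ℕ → ℕ → MvPolynomial (Fin t) ℂ} (ha : ∀ j k, (a j k).IsHomogeneous (j - k)) (n : ℕ)
    (q : MvPolynomial (Fin t) ℂ) (m : ℕ) :
    Cut (homs (Finset.Icc 2 n) (triMap c a n q)) m ↔ Cut (homs (Finset.Icc 2 n) q) m := by
  have hJ2 : ∀ j ∈ Finset.Icc 2 n, 2 ≤ j := fun j hj => (Finset.mem_Icc.mp hj).1
  rw [cut_iff (homSet_homs hJ2 _), cut_iff (homSet_homs hJ2 _)]
  simp only [homs_triMap_subset_iff hc ha]

theorem triMap_injOn {c : ℕ → ℂ} (hc : ∀ j, c j ≠ 0)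
    {a : ℕ → ℕ → MvPolynomial (Fin t) ℂ} (ha : ∀ j k, (a j k).IsHomogeneous (j - k)) (n : ℕ)
    {q : MvPolynomial (Fin t) ℂ} (hq : q ∈ Pol t n) (h : triMap c a n q = 0) : q = 0 := by
  have h1 := (homs_triMap_subset_iff hc ha n q ⊥).mp (by
    rw [h, homs_subset_iff]
    simp)
  rw [homs_subset_iff] at h1
  rw [← sum_homogeneousComponent_of_mem_pol hq]
  exact Finset.sum_eq_zero fun j hj => by simpa using h1 j hj

theorem HasSlice.of_triMap {c : ℕ → ℂ} (hc : ∀ j, c j ≠ 0)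
    {a : ℕ → ℕ → MvPolynomial (Fin t) ℂ} (ha : ∀ j k, (a j k).IsHomogeneous (j - k)) {n m e : ℕ}
    {q : MvPolynomial (Fin t) ℂ} (h : HasSlice (Finset.Icc 2 n) n m e (triMap c a n q)) :
    HasSlice (Finset.Icc 2 n) n m e q := by
  obtain ⟨L, hL, he, K, hK, hKq, hKL⟩ := h
  have := finite_pol t n
  let U : Pol t n →ₗ[ℂ] Pol t n :=
    ((triMap c a n).comp (Pol t n).subtype).codRestrict _ fun q => triMap_mem_pol ha n q
  have hU : Function.Injective U := by
    rw [injective_iff_map_eq_zero]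
    exact fun q hq => Subtype.ext (triMap_injOn hc ha n q.2 (congrArg Subtype.val hq))
  let e' := LinearEquiv.ofInjectiveEndo U hU
  let L' : Submodule ℂ (Pol t n) := L.comap (Pol t n).subtype
  refine ⟨(L'.comap U).map (Pol t n).subtype, ?_, ?_, fun q => K (triMap c a n q),
    hK.comp_linear _, hKq, ?_⟩
  · rintro _ ⟨l, -, rfl⟩
    exact l.2
  · rw [Submodule.finrank_map_subtype_eq]
    have h1 : L'.comap U = L'.map e'.symm.toLinearMap := by
      rw [← Submodule.comap_equiv_eq_map_symm]
      rfl
    rw [h1, LinearEquiv.finrank_map_eq, LinearEquiv.finrank_eq (Submodule.comapSubtypeEquivOfLe hL)]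
    exact he
  · rintro _ ⟨l, hl, rfl⟩ hl0 hKl
    rw [← cut_triMap_iff hc ha, map_add]
    dsimp only at hKl
    rw [map_add] at hKl
    refine hKL _ hl (fun h => hl0 ?_) hKl
    exact triMap_injOn hc ha n l.2 h

theorem exists_hasSlice_of_points {n k m : ℕ} (hk : 1 ≤ k) (hm : m + 1 ≤ t)
    {q : MvPolynomial (Fin t) ℂ} (hcut : Cut (homs (Finset.Icc 2 n) q) (m + 1))
    (hP : ∀ P : Ideal (MvPolynomial (Fin t) ℂ), P.IsPrime → homs (Finset.Icc 2 n) q ⊆ P →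
      P ≤ originIdeal t → pdim P = m + 1 → ∀ W : Submodule ℂ (Fin t → ℂ), Module.finrank ℂ W ≤ k →
        ∃ x, (∀ q ∈ P, eval x q = 0) ∧ x ∉ W)
    (hne : ¬ Cut (homs (Finset.Icc 2 n) q) m) :
    ∃ S ⊆ Finset.Icc 2 n, S.card + (m + 1) ≤ t ∧
      HasSlice (Finset.Icc 2 n) n m (∑ i ∈ Finset.Icc 2 n \ S, (i * k + 1)) q := by
  obtain ⟨S, hS, hSc, c, a, hc, ha, hScut⟩ := exists_triComp_cut n hm hcut
  refine ⟨S, hS, hSc, HasSlice.of_triMap hc ha (hasSlice_of_points hS hk ?_ ?_ ?_)⟩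
  · convert hScut using 1
    exact Set.image_congr fun j hj => homogeneousComponent_triMap ha (hS hj) q
  · intro P hPp hFP
    exact hP P hPp ((homs_triMap_subset_iff hc ha n q P).mp hFP)
  · rwa [cut_triMap_iff hc ha]

end Triangular

section Charts

variable {t M : ℕ}

theorem aeval_homogeneousComponent {g : Fin M → MvPolynomial (Fin t) ℂ} (hg : ∀ j, (g j).IsHomogeneous 1)
    (i : ℕ) (f : MvPolynomial (Fin M) ℂ) :
    aeval g (homogeneousComponent i f) = homogeneousComponent i (aeval g f) := by
  have hh : ∀ j, (aeval g (homogeneousComponent j f)).IsHomogeneous j := fun j => by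
    have := IsHomogeneous.aeval (homogeneousComponent_isHomogeneous j f) g hg
    rwa [one_mul] at this
  conv_rhs => rw [← sum_homogeneousComponent f, map_sum, map_sum]
  simp_rw [homogeneousComponent_of_mem (hh _)]
  rw [Finset.sum_ite_eq]
  split_ifs with h
  · rfl
  · rw [homogeneousComponent_eq_zero, map_zero]
    simpa using h

/-- The parameters of the chart given by `σ` on the `t`-dimensional subspaces of `ℂ^M`. -/
abbrev Chart (σ : Fin t ↪ Fin M) : Type := {j // j ∉ Set.range σ} → Fin t → ℂ

/-- The rows of the matrix parametrizing a `t`-dimensional subspace in the chart given by `σ`. -/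
def chartRow (σ : Fin t ↪ Fin M) (τ : Chart σ) (j : Fin M) : Fin t → ℂ :=
  open Classical in
  if h : j ∈ Set.range σ then Pi.single h.choose 1 else τ ⟨j, h⟩

theorem chartRow_apply (σ : Fin t ↪ Fin M) (τ : Chart σ) (i : Fin t) :
    chartRow σ τ (σ i) = Pi.single i 1 := by
  have h : σ i ∈ Set.range σ := ⟨i, rfl⟩
  rw [chartRow, dif_pos h, σ.injective h.choose_spec]

/-- Restriction of a polynomial to a `t`-dimensional subspace in the chart given by `σ`. -/
def chartPull (σ : Fin t ↪ Fin M) (τ : Chart σ) :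
    MvPolynomial (Fin M) ℂ →ₐ[ℂ] MvPolynomial (Fin t) ℂ :=
  aeval fun j => linP (chartRow σ τ j)

theorem linP_single (i : Fin t) : linP (Pi.single i 1 : Fin t → ℂ) = X i := by
  simp [linP, Pi.single_apply]

theorem eval_chartPull (σ : Fin t ↪ Fin M) (τ : Chart σ)
    (f : MvPolynomial (Fin M) ℂ) (x : Fin t → ℂ) :
    eval x (chartPull σ τ f) = eval (fun j => chartRow σ τ j ⬝ᵥ x) f := by
  rw [chartPull, eval_aeval]
  simp only [eval_linP]

theorem chartPull_homogeneousComponent (σ : Fin t ↪ Fin M) (τ : Chart σ)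
    (i : ℕ) (f : MvPolynomial (Fin M) ℂ) :
    chartPull σ τ (homogeneousComponent i f) = homogeneousComponent i (chartPull σ τ f) :=
  aeval_homogeneousComponent (fun _ => linP_isHomogeneous _) i f

theorem chartPull_rename (σ : Fin t ↪ Fin M) (τ : Chart σ)
    (q : MvPolynomial (Fin t) ℂ) : chartPull σ τ (rename σ q) = q := by
  rw [chartPull, aeval_rename]
  conv_rhs => rw [← aeval_X_left_apply q]
  congr 2
  ext1 i
  rw [Function.comp_apply, chartRow_apply, linP_single]

theorem rename_mem_pol {n : ℕ} (hn : n ≤ M) (σ : Fin t ↪ Fin M) {q : MvPolynomial (Fin t) ℂ}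
    (hq : q ∈ Pol t n) : rename σ q ∈ Pol M M := by
  rw [← sum_homogeneousComponent_of_mem_pol hq, map_sum]
  refine Submodule.sum_mem _ fun i hi => ?_
  rw [Finset.mem_Icc] at hi
  rw [← homogeneousComponent_eq_self
    ((homogeneousComponent_isHomogeneous i q).rename_isHomogeneous (f := σ))]
  exact homogeneousComponent_mem_pol hi.1 (hi.2.trans hn) _

theorem polyFam_chartPull (σ : Fin t ↪ Fin M) :
    PolyFam fun v : Chart σ × Pol M M =>
      chartPull σ v.1 (v.2 : MvPolynomial (Fin M) ℂ) := by
  refine PolyFam.aeval (fun m => IsPolyFun.linear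
      (lcoeff ℂ m ∘ₗ (Pol M M).subtype ∘ₗ LinearMap.snd ℂ (Chart σ) (Pol M M)))
    ((Finset.range (M + 1)).biUnion fun i => Finset.univ.finsuppAntidiag i) ?_ fun j m => ?_
  · intro v m hm
    rw [Finset.mem_biUnion]
    refine ⟨m.degree, ?_, ?_⟩
    · have := (mem_pol_iff.mp v.2.2 m hm).2
      rw [Finset.mem_range]
      omega
    · rw [Finset.mem_finsuppAntidiag]
      exact ⟨by rw [Finsupp.degree_eq_sum], Finset.subset_univ _⟩
  · by_cases h : j ∈ Set.range σ
    · simp only [chartRow, dif_pos h]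
      exact IsPolyFun.const _
    · simp only [chartRow, dif_neg h]
      let φ : Chart σ →ₗ[ℂ] Fin t → ℂ := LinearMap.proj
        (φ := fun _ : {j // j ∉ Set.range σ} => Fin t → ℂ) ⟨j, h⟩
      exact (IsPolyFun.linear (lcoeff ℂ m ∘ₗ linP)).comp_linear
        (φ ∘ₗ LinearMap.fst ℂ (Chart σ) (Pol M M))

theorem ad_of_hasSlice {n m e d : ℕ} (hn : n ≤ M) {J : Finset ℕ} (hJ : ∀ i ∈ J, 2 ≤ i)
    (hed : (M - t) * t + Module.finrank ℂ (Pol M M) ≤ d + e) {B : Set (Pol M M)}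
    (h : ∀ f ∈ B, ∃ (σ : Fin t ↪ Fin M) (τ : Chart σ),
      ¬ Cut (homs J (chartPull σ τ f)) m ∧ HasSlice J n m e (chartPull σ τ f)) : AD B d := by
  have := finite_pol M M
  have := finite_pol t n
  let A : (σ : Fin t ↪ Fin M) → Set (Chart σ × Pol M M) := fun σ =>
    {v | ¬ Cut (homs J (chartPull σ v.1 v.2)) m ∧ HasSlice J n m e (chartPull σ v.1 v.2)}
  suffices hA : ∀ σ, AD (A σ) d by
    refine (AD.iUnion fun σ => (hA σ).image (Φ := Prod.snd) fun φ => ?_).mono ?_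
    · exact IsPolyFun.linear (φ ∘ₗ LinearMap.snd ℂ (Chart σ) (Pol M M))
    · intro f hf
      obtain ⟨σ, τ, h1⟩ := h f hf
      exact Set.mem_iUnion.mpr ⟨σ, (τ, f), h1, rfl⟩
  intro σ
  refine ad_of_slices (X := {v | ¬ Cut (homs J (chartPull σ v.1 v.2)) m}) ?_ (fun v hv => hv.1)
    (e := e) ?_ ?_
  · have h0 : ∀ i : J, PolyFam fun v : Chart σ × Pol M M =>
        homogeneousComponent i.1 (chartPull σ v.1 (v.2 : MvPolynomial (Fin M) ℂ)) :=
      fun i => PolyFam.homogeneousComponent (polyFam_chartPull σ) i.1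
    have h1 := isZClosed_not_cut h0
      (fun i v => ⟨i, by have := hJ i.1 i.2; omega, homogeneousComponent_isHomogeneous _ _⟩) m
    have h2 : ∀ v : Chart σ × Pol M M, homs J (chartPull σ v.1 v.2) = Set.range fun i : J =>
        homogeneousComponent i.1 (chartPull σ v.1 (v.2 : MvPolynomial (Fin M) ℂ)) := fun v => by
      rw [homs, Set.image_eq_range]
      rfl
    simp only [h2]
    exact h1
  · rw [Module.finrank_prod, Module.finrank_pi_fintype]
    simp only [Module.finrank_fintype_fun_eq_card, Fintype.card_fin, Finset.sum_const,
      Finset.card_univ, smul_eq_mul]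
    rw [Fintype.card_subtype_compl, Fintype.card_fin, Fintype.card_range, Fintype.card_fin]
    exact hed
  · rintro ⟨τ, f⟩ ⟨-, L, hL, he, K, hK, hKq, hKL⟩
    let ρ : Pol t n →ₗ[ℂ] Chart σ × Pol M M :=
      LinearMap.inr ℂ (Chart σ) (Pol M M) ∘ₗ LinearMap.codRestrict (Pol M M)
        ((rename σ).toLinearMap ∘ₗ (Pol t n).subtype) fun q => rename_mem_pol hn σ q.2
    have hρ : ∀ q, ρ q = (0, ⟨rename σ q.1, rename_mem_pol hn σ q.2⟩) := fun _ => rfl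
    have hρi : Function.Injective ρ := by
      intro p q hpq
      rw [hρ, hρ, Prod.mk.injEq, Subtype.mk.injEq] at hpq
      exact Subtype.ext (rename_injective _ σ.injective hpq.2)
    have hadd : ∀ q : Pol t n, chartPull σ τ ((f + (ρ q).2 : Pol M M) : MvPolynomial (Fin M) ℂ) =
        chartPull σ τ f + q := fun q => by
      rw [Submodule.coe_add, map_add, hρ, chartPull_rename]
    refine ⟨(L.comap (Pol t n).subtype).map ρ, ?_, fun v => K (chartPull σ τ v.2), ?_, hKq, ?_⟩
    · rw [← LinearEquiv.finrank_eq (Submodule.equivMapOfInjective ρ hρi _),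
        LinearEquiv.finrank_eq (Submodule.comapSubtypeEquivOfLe hL)]
      exact he
    · exact hK.comp_linear ((chartPull σ τ).toLinearMap ∘ₗ (Pol M M).subtype ∘ₗ LinearMap.snd ℂ (Chart σ) (Pol M M))
    · rintro _ ⟨q, hq, rfl⟩ hq0 hKq'
      have h1 : τ + (ρ q).1 = τ := by rw [hρ, add_zero]
      simp only [Prod.fst_add, Prod.snd_add, hadd, h1, Set.mem_ofPred_eq, not_not] at hKq' ⊢
      refine hKL _ hq (fun h0 => hq0 ?_) hKq'
      rw [show q = 0 from Subtype.ext h0, map_zero]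

theorem exists_chart {T : Submodule ℂ (Fin M → ℂ)} (hT : Module.finrank ℂ T = t) :
    ∃ (σ : Fin t ↪ Fin M) (τ : Chart σ),
      ∀ z, z ∈ T ↔ ∃ x, z = fun j => chartRow σ τ j ⬝ᵥ x := by
  let v : Fin M → Module.Dual ℂ T := fun j => LinearMap.proj j ∘ₗ T.subtype
  obtain ⟨κ, a, ha, hspan, hli⟩ := exists_linearIndependent' ℂ v
  have hker : ∀ z : T, (∀ k, v (a k) z = 0) → z = 0 := by
    intro z hz
    have h1 : Submodule.span ℂ (Set.range v) ≤ LinearMap.ker (Module.Dual.eval ℂ T z) := by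
      rw [← hspan, Submodule.span_le]
      rintro _ ⟨k, rfl⟩
      exact hz k
    ext j
    exact h1 (Submodule.subset_span ⟨j, rfl⟩)
  have : Finite κ := Finite.of_injective a ha
  have := Fintype.ofFinite κ
  have hcard : Fintype.card κ = t := by
    apply le_antisymm
    · have := hli.fintype_card_le_finrank
      rwa [Subspace.dual_finrank_eq, hT] at this
    · have h2 : Function.Injective (LinearMap.pi fun k => v (a k) : T →ₗ[ℂ] κ → ℂ) := by
        rw [injective_iff_map_eq_zero]
        exact fun z hz => hker z fun k => congrFun hz k
      have := LinearMap.finrank_le_finrank_of_injective h2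
      rwa [Module.finrank_fintype_fun_eq_card, hT] at this
  let ε : Fin t ≃ κ := (Fintype.equivFinOfCardEq hcard).symm
  let σ : Fin t ↪ Fin M := ⟨a ∘ ε, ha.comp ε.injective⟩
  let π : T →ₗ[ℂ] Fin t → ℂ := LinearMap.pi fun i => v (σ i)
  have hπ : Function.Injective π := by
    rw [injective_iff_map_eq_zero]
    intro z hz
    refine hker z fun k => ?_
    have := congrFun hz (ε.symm k)
    simpa [π, σ] using this
  let π' := LinearEquiv.ofInjectiveOfFinrankEq π hπ (by rw [hT, Module.finrank_fin_fun])
  choose c hc using fun j => exists_linP_eq (v j ∘ₗ π'.symm.toLinearMap)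
  have hrow : ∀ j x, chartRow σ (fun j => c j) j ⬝ᵥ x = v j (π'.symm x) := by
    intro j x
    by_cases h : j ∈ Set.range σ
    · obtain ⟨i, rfl⟩ := h
      rw [chartRow_apply, single_dotProduct, one_mul]
      exact (congrFun (π'.apply_symm_apply x) i).symm
    · rw [chartRow, dif_neg h]
      exact hc j x
  refine ⟨σ, fun j => c j, fun z => ⟨fun hz => ⟨π' ⟨z, hz⟩, ?_⟩, ?_⟩⟩
  · ext j
    rw [hrow, LinearEquiv.symm_apply_apply]
    rfl
  · rintro ⟨x, rfl⟩
    simp_rw [hrow]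
    exact (π'.symm x).2

end Charts

theorem choose_two_le_choose {n i : ℕ} (hi : 2 ≤ i) (hin : i + 2 ≤ n) : n.choose 2 ≤ n.choose i := by
  induction n generalizing i with
  | zero => omega
  | succ n ih =>
    rcases hi.lt_or_eq with h2 | rfl
    · rcases hin.lt_or_eq with h | h
      · obtain ⟨i, rfl⟩ : ∃ j, i = j + 1 := ⟨i - 1, by omega⟩
        have h1 := ih (i := i) (by omega) (by omega)
        have h3 := ih (i := i + 1) (by omega) (by omega)
        have h4 := Nat.choose_succ_succ n 1
        have h5 : n ≤ n.choose 2 := by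
          rw [Nat.choose_two_right, Nat.le_div_iff_mul_le two_pos]
          exact Nat.mul_le_mul_left n (by omega)
        rw [Nat.choose_one_right] at h4
        rw [h4, Nat.choose_succ_succ]
        simp only [Nat.succ_eq_add_one, Nat.reduceAdd]
        omega
      · rw [← Nat.choose_symm_of_eq_add h.symm]
    · rfl

theorem card_mul_le_two_mul_sum (A : Finset ℕ) (hA : ∀ i ∈ A, 2 ≤ i) :
    A.card * (A.card + 3) ≤ 2 * ∑ i ∈ A, i := by
  induction A using Finset.induction_on_max with
  | empty => simp
  | insert a s hs ih =>
    have has : a ∉ s := fun h => lt_irrefl _ (hs a h)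
    have h1 : s ⊆ Finset.Ico 2 a := fun i hi =>
      Finset.mem_Ico.mpr ⟨hA i (Finset.mem_insert_of_mem hi), hs i hi⟩
    have h2 := Finset.card_le_card h1
    rw [Nat.card_Ico] at h2
    have h3 := hA a (Finset.mem_insert_self a s)
    have h4 := ih fun i hi => hA i (Finset.mem_insert_of_mem hi)
    rw [Finset.card_insert_of_notMem has, Finset.sum_insert has]
    nlinarith [show s.card + 2 ≤ a by omega]

section Strata

variable {t M : ℕ}

theorem HasSlice.mono {J : Finset ℕ} {n m e e' : ℕ} {q : MvPolynomial (Fin t) ℂ}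
    (h : HasSlice J n m e q) (he : e' ≤ e) : HasSlice J n m e' q := by
  obtain ⟨L, hL, hLe, h⟩ := h
  exact ⟨L, hL, he.trans hLe, h⟩

/-- The restriction of the first equations of `f` to some `t`-dimensional subspace has a zero locus
of dimension at least two. -/
def ExcessOn (t : ℕ) (f : MvPolynomial (Fin M) ℂ) : Prop :=
  ∃ (σ : Fin t ↪ Fin M) (τ : Chart σ), ¬ Cut (homs (Finset.Icc 2 (M - 2)) (chartPull σ τ f)) 1

theorem not_excessOn_of_le_one (ht : t ≤ 1) (f : MvPolynomial (Fin M) ℂ) : ¬ ExcessOn t f := by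
  rintro ⟨σ, τ, h⟩
  exact h ((cut_self _).mono_dim (homSet_homs (fun j hj => (Finset.mem_Icc.mp hj).1) _) ht)

/-- The linear parametrization of the subspace given by a chart. -/
def chartMap (σ : Fin t ↪ Fin M) (τ : Chart σ) : (Fin t → ℂ) →ₗ[ℂ] (Fin M → ℂ) :=
  (Matrix.of (chartRow σ τ)).mulVecLin

theorem chartMap_apply (σ : Fin t ↪ Fin M) (τ : Chart σ) (x : Fin t → ℂ) :
    chartMap σ τ x = fun j => chartRow σ τ j ⬝ᵥ x := rfl

theorem chartMap_injective (σ : Fin t ↪ Fin M) (τ : Chart σ) :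
    Function.Injective (chartMap σ τ) := by
  intro x y h
  ext i
  have := congrFun h (σ i)
  simpa [chartMap_apply, chartRow_apply] using this

theorem exists_cut_of_not_excessOn {s : ℕ} {f : MvPolynomial (Fin M) ℂ} (hf : ¬ ExcessOn s f)
    (σ : Fin t ↪ Fin M) (τ : Chart σ) {W : Submodule ℂ (Fin t → ℂ)} (hW : Module.finrank ℂ W = s) :
    ∃ c : Fin t → ℂ, ∀ x ∈ W, (∀ q ∈ homs (Finset.Icc 2 (M - 2)) (chartPull σ τ f), eval x q = 0) →
      c ⬝ᵥ x = 0 → x = 0 := by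
  have hT : Module.finrank ℂ (W.map (chartMap σ τ)) = s := by
    rw [← LinearEquiv.finrank_eq (Submodule.equivMapOfInjective _ (chartMap_injective σ τ) W), hW]
  obtain ⟨σ', τ', hT'⟩ := exists_chart hT
  have hcut : Cut (homs (Finset.Icc 2 (M - 2)) (chartPull σ' τ' f)) 1 := by
    by_contra h
    exact hf ⟨σ', τ', h⟩
  obtain ⟨l, hl⟩ := hcut
  obtain ⟨c, hc⟩ := exists_linP_eq ((dotProductEquiv ℂ (Fin s) (l 0)) ∘ₗ
    LinearMap.funLeft ℂ ℂ σ' ∘ₗ chartMap σ τ)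
  refine ⟨c, fun x hx hxq hcx => ?_⟩
  obtain ⟨y, hy⟩ := (hT' (chartMap σ τ x)).mp (Submodule.mem_map_of_mem hx)
  have hfun : chartMap σ τ x ∘ σ' = y := by
    ext i
    rw [hy, Function.comp_apply, chartRow_apply, single_dotProduct, one_mul]
  have hy0 : y = 0 := by
    refine hl y ?_ fun j => ?_
    · rintro _ ⟨i, hi, rfl⟩
      have h1 := hxq _ ⟨i, hi, rfl⟩
      dsimp only at h1 ⊢
      rw [← chartPull_homogeneousComponent, eval_chartPull] at h1 ⊢
      rwa [← hy]
    · rw [Subsingleton.elim j 0]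
      rw [hc] at hcx
      rw [← hfun]
      exact hcx
  rw [hy0] at hy
  refine chartMap_injective σ τ ?_
  rw [hy, map_zero]
  ext j
  simp

theorem exists_notMem_of_not_excessOn {k : ℕ} {f : MvPolynomial (Fin M) ℂ}
    (hf : ∀ s ≤ k, ¬ ExcessOn s f) (σ : Fin t ↪ Fin M) (τ : Chart σ)
    {P : Ideal (MvPolynomial (Fin t) ℂ)} [P.IsPrime]
    (hP : homs (Finset.Icc 2 (M - 2)) (chartPull σ τ f) ⊆ P) (hP0 : P ≤ originIdeal t)
    (hd : 2 ≤ pdim P) {W : Submodule ℂ (Fin t → ℂ)} (hW : Module.finrank ℂ W ≤ k) :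
    ∃ x, (∀ q ∈ P, eval x q = 0) ∧ x ∉ W := by
  by_contra! hcon
  obtain ⟨c, hc⟩ := exists_cut_of_not_excessOn (hf _ hW) σ τ rfl
  have := pdim_le_of_forall_eq_zero hP0 (d := 1) (fun _ => linP c)
    (fun j => by rw [eval_linP, dotProduct_zero]) fun x hx hcx => by
      refine hc x (hcon x hx) (fun q hq => hx q (hP hq)) ?_
      simpa using hcx 0
  omega

theorem ad_excessOn (ht : 2 ≤ t) (htM : 2 * t + 3 ≤ M) (hM : 8 ≤ M) {d : ℕ}
    (hd : Module.finrank ℂ (Pol M M) ≤ d + (M - 7) * (M - 6) / 2) :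
    AD {f : Pol M M | ExcessOn t (f : MvPolynomial (Fin M) ℂ) ∧
      ∀ s < t, ¬ ExcessOn s (f : MvPolynomial (Fin M) ℂ)} d := by
  refine ad_of_hasSlice (t := t) (n := M - 2) (m := 1)
    (e := (M - t) * t + (M - 7) * (M - 6) / 2) (by omega)
    (J := Finset.Icc 2 (M - 2)) (fun i hi => (Finset.mem_Icc.mp hi).1) (by omega) ?_
  rintro f ⟨⟨σ, τ, hne⟩, hmin⟩
  refine ⟨σ, τ, hne, ?_⟩
  have hmin' : ∀ s ≤ t - 1, ¬ ExcessOn s (f : MvPolynomial (Fin M) ℂ) := fun s hs => hmin s (by omega)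
  have hcut : Cut (homs (Finset.Icc 2 (M - 2)) (chartPull σ τ (f : MvPolynomial (Fin M) ℂ))) 2 := by
    let i0 : Fin t := ⟨0, by omega⟩
    have hW : Module.finrank ℂ (LinearMap.ker (LinearMap.proj (R := ℂ) (φ := fun _ : Fin t => ℂ) i0)) =
        t - 1 := by
      have h1 := LinearMap.finrank_range_add_finrank_ker
        (LinearMap.proj (R := ℂ) (φ := fun _ : Fin t => ℂ) i0)
      rw [LinearMap.range_eq_top.mpr (LinearMap.proj_surjective i0), finrank_top, Module.finrank_self,
        Module.finrank_fin_fun] at h1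
      omega
    obtain ⟨c, hc⟩ := exists_cut_of_not_excessOn (hmin' _ le_rfl) σ τ hW
    refine ⟨![Pi.single i0 1, c], fun x hx hlx => hc x ?_ hx (hlx 1)⟩
    have := hlx 0
    simpa using this
  obtain ⟨S, hS, hSc, hslice⟩ := exists_hasSlice_of_points (k := t - 1) (by omega) ht hcut
    (fun P _ hFP hP0 hd W hW => exists_notMem_of_not_excessOn hmin' σ τ hFP hP0 hd.ge hW) hne
  refine hslice.mono ?_
  have h1 := card_mul_le_two_mul_sum (Finset.Icc 2 (M - 2) \ S) fun i hi =>
    (Finset.mem_Icc.mp (Finset.mem_sdiff.mp hi).1).1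
  have h2 := Finset.card_sdiff_of_subset hS
  rw [Nat.card_Icc] at h2
  rw [Finset.sum_add_distrib, ← Finset.sum_mul, Finset.sum_const, smul_eq_mul, mul_one]
  set A := Finset.Icc 2 (M - 2) \ S
  obtain ⟨u, rfl⟩ : ∃ u, t = u + 2 := ⟨t - 2, by omega⟩
  obtain ⟨v, rfl⟩ : ∃ v, M = 2 * (u + 2) + 3 + v := ⟨M - (2 * (u + 2) + 3), by omega⟩
  have hc : u + 4 + v ≤ A.card := by omega
  have h3 : (u + 4 + v) * (u + 4 + v + 3) ≤ 2 * ∑ i ∈ A, i :=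
    (Nat.mul_le_mul hc (by omega)).trans h1
  have h4 : 2 * ((2 * (u + 2) + 3 + v - 7) * (2 * (u + 2) + 3 + v - 6) / 2) ≤
      (2 * u + v) * (2 * u + v + 1) := by
    rw [show 2 * (u + 2) + 3 + v - 7 = 2 * u + v by omega,
      show 2 * (u + 2) + 3 + v - 6 = 2 * u + v + 1 by omega]
    exact Nat.mul_div_le _ _
  rw [show 2 * (u + 2) + 3 + v - (u + 2) = u + 5 + v by omega, show u + 2 - 1 = u + 1 by omega]
  generalize (2 * (u + 2) + 3 + v - 7) * (2 * (u + 2) + 3 + v - 6) / 2 = r at *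
  generalize ∑ i ∈ A, i = s at *
  have h5 : (u + 1) * ((u + 4 + v) * (u + 4 + v + 3)) ≤ (u + 1) * (2 * s) := Nat.mul_le_mul_left _ h3
  have huv : 1 ≤ 2 * u + v := by omega
  have key : 2 * ((u + 5 + v) * (u + 2)) + (2 * u + v) * (2 * u + v + 1) ≤
      (u + 1) * ((u + 4 + v) * (u + 4 + v + 3)) + 2 * (u + 4 + v) := by
    nlinarith [Nat.zero_le (u * u * u), Nat.zero_le (u * u * v), Nat.zero_le (u * v * v),
      Nat.zero_le (u * v), Nat.zero_le (u * u), Nat.zero_le (v * v)]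
  nlinarith

end Strata

section Strata

variable {M : ℕ}

theorem ad_not_cut {n : ℕ} (hM : 8 ≤ M) (hn : M - 2 ≤ n) (hnM : n ≤ M) {d : ℕ}
    (hd : Module.finrank ℂ (Pol M M) ≤ d + (M - 7) * (M - 6) / 2) :
    AD {f : Pol M M | (∃ (σ : Fin n ↪ Fin M) (τ : Chart σ),
      ¬ Cut (homs (Finset.Icc 2 n) (chartPull σ τ (f : MvPolynomial (Fin M) ℂ))) 1) ∧
      ∀ s ≤ (M - 3) / 2, ¬ ExcessOn s (f : MvPolynomial (Fin M) ℂ)} d := by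
  obtain ⟨u, rfl⟩ : ∃ u, M = u + 8 := ⟨M - 8, by omega⟩
  have hr : 2 * ((u + 8 - 7) * (u + 8 - 6) / 2) ≤ (u + 1) * (u + 2) := by
    rw [show u + 8 - 7 = u + 1 by omega, show u + 8 - 6 = u + 2 by omega]
    exact Nat.mul_div_le _ _
  let B : ℕ → Set (Pol (u + 8) (u + 8)) := fun i => {f | (∃ (σ : Fin n ↪ Fin (u + 8)) (τ : Chart σ),
      ¬ Cut (homs (Finset.Icc 2 i) (chartPull σ τ (f : MvPolynomial (Fin (u + 8)) ℂ))) (n + 1 - i) ∧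
      Cut (homs (Finset.Icc 2 (i - 1)) (chartPull σ τ (f : MvPolynomial (Fin (u + 8)) ℂ)))
        (n + 1 - i + 1)) ∧ ∀ s ≤ (u + 8 - 3) / 2, ¬ ExcessOn s (f : MvPolynomial (Fin (u + 8)) ℂ)}
  have hB : ∀ i ∈ Finset.Icc 2 n, AD (B i) d := by
    intro i hi
    rw [Finset.mem_Icc] at hi
    refine ad_of_hasSlice (t := n) (n := n) (m := n + 1 - i) (J := Finset.Icc 2 i)
      (e := (u + 8 - n) * n + (u + 8 - 7) * (u + 8 - 6) / 2) hnM
      (fun j hj => (Finset.mem_Icc.mp hj).1) (by omega) ?_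
    rintro f ⟨⟨σ, τ, hne, hcut⟩, hf⟩
    refine ⟨σ, τ, hne, ?_⟩
    rcases hi.2.lt_or_eq with hin | rfl
    · refine (hasSlice_of_forms hi.1 hi.2 hcut hne).mono ?_
      rw [show n + 1 - i + i = n + 1 by omega]
      refine le_trans ?_ (choose_two_le_choose hi.1 (by omega))
      have h1 : (n + 1).choose 2 * 2 = (n + 1) * n := by
        rw [Nat.choose_two_right, Nat.add_sub_cancel, Nat.div_mul_cancel]
        exact (Nat.even_mul_succ_self n).two_dvd.trans (by rw [mul_comm])
      generalize (u + 8 - 7) * (u + 8 - 6) / 2 = r at *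
      have h3 : n = u + 6 ∨ n = u + 7 ∨ n = u + 8 := by omega
      rcases h3 with rfl | rfl | rfl
      · rw [show u + 8 - (u + 6) = 2 by omega]
        nlinarith
      · rw [show u + 8 - (u + 7) = 1 by omega]
        nlinarith
      · rw [Nat.sub_self]
        nlinarith
    · have hm : i + 1 - i = 1 := by omega
      rw [hm] at hne hcut ⊢
      refine (hasSlice_of_points (Finset.Icc_subset_Icc_right (by omega)) (k := (u + 8 - 3) / 2)
        (by omega) hcut (fun P _ hFP hP0 hd W hW => exists_notMem_of_not_excessOn hf σ τ
          ((homs_mono (Finset.Icc_subset_Icc_right hn) _).trans hFP) hP0 hd.ge hW) hne).mono ?_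
      refine le_trans ?_ (Finset.single_le_sum (f := fun j => j * ((u + 8 - 3) / 2) + 1)
        (fun _ _ => Nat.zero_le _) (a := i) ?_)
      · have hK : u + 4 ≤ 2 * ((u + 8 - 3) / 2) := by omega
        generalize (u + 8 - 7) * (u + 8 - 6) / 2 = r at *
        generalize (u + 8 - 3) / 2 = K at *
        have h3 : i = u + 6 ∨ i = u + 7 ∨ i = u + 8 := by omega
        have h4 := Nat.mul_le_mul_left i hK
        rcases h3 with rfl | rfl | rfl
        · rw [show u + 8 - (u + 6) = 2 by omega]
          nlinarith
        · rw [show u + 8 - (u + 7) = 1 by omega]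
          nlinarith
        · rw [Nat.sub_self]
          nlinarith
      · rw [Finset.mem_sdiff, Finset.mem_Icc, Finset.mem_Icc]
        omega
  refine (AD.biUnion (Finset.Icc 2 n) hB).mono ?_
  rintro f ⟨⟨σ, τ, hne⟩, hf⟩
  let p : ℕ → Prop := fun i =>
    ¬ Cut (homs (Finset.Icc 2 i) (chartPull σ τ (f : MvPolynomial (Fin (u + 8)) ℂ))) (n + 1 - i)
  have hpn : p n := by
    change ¬ Cut _ (n + 1 - n)
    rwa [Nat.add_sub_cancel_left]
  classical
  let i := Nat.find (⟨n, hpn⟩ : ∃ i, p i)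
  have hpi : p i := Nat.find_spec (⟨n, hpn⟩ : ∃ i, p i)
  have hin : i ≤ n := Nat.find_min' _ hpn
  have hi2 : 2 ≤ i := by
    by_contra! hi
    exact hpi ((cut_self _).mono_dim (homSet_homs (fun j hj => (Finset.mem_Icc.mp hj).1) _) (by omega))
  have hprev : ¬ p (i - 1) := Nat.find_min (⟨n, hpn⟩ : ∃ i, p i) (show i - 1 < i by omega)
  refine Set.mem_biUnion (Finset.mem_coe.mpr (Finset.mem_Icc.mpr ⟨hi2, hin⟩)) ⟨⟨σ, τ, hpi, ?_⟩, hf⟩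
  have := not_not.mp hprev
  rwa [show n + 1 - (i - 1) = n + 1 - i + 1 by omega] at this

theorem zdim_le_of_cut {n : ℕ} {σ : Fin n ↪ Fin M} {τ : Chart σ} {f : MvPolynomial (Fin M) ℂ}
    (h : Cut (homs (Finset.Icc 2 n) (chartPull σ τ f)) 1) {Pl : Submodule ℂ (Fin M → ℂ)}
    (hPl : ∀ z, z ∈ Pl ↔ ∃ x, z = fun j => chartRow σ τ j ⬝ᵥ x) :
    zdim {z : Fin M → ℂ | z ∈ Pl ∧ ∀ i ∈ Finset.Icc 2 n, eval z (homogeneousComponent i f) = 0} ≤ 1 := by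
  have h1 := ad_of_cut (homSet_homs (fun j hj => (Finset.mem_Icc.mp hj).1) _) h
  have h2 := (h1.image (Φ := chartMap σ τ) fun φ => IsPolyFun.linear (φ ∘ₗ chartMap σ τ)).mono
    (A := {z : Fin M → ℂ | z ∈ Pl ∧ ∀ i ∈ Finset.Icc 2 n, eval z (homogeneousComponent i f) = 0}) ?_
  · exact_mod_cast h2.zdim_le
  · rintro z ⟨hz, hzf⟩
    obtain ⟨x, rfl⟩ := (hPl z).mp hz
    refine ⟨x, ?_, rfl⟩
    rintro _ ⟨i, hi, rfl⟩
    dsimp only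
    rw [← chartPull_homogeneousComponent, eval_chartPull]
    exact hzf i hi

theorem ad_not_condR21 (hM : 8 ≤ M) {d : ℕ}
    (hd : Module.finrank ℂ (Pol M M) ≤ d + (M - 7) * (M - 6) / 2) :
    AD {f : Pol M M | ¬ CondR21 (f : MvPolynomial (Fin M) ℂ)} d := by
  classical
  refine (((AD.biUnion (Finset.Icc 2 ((M - 3) / 2)) fun t ht =>
    ad_excessOn (t := t) (Finset.mem_Icc.mp ht).1
      (by have := (Finset.mem_Icc.mp ht).2; omega) hM hd)).union
    (AD.biUnion (Finset.Icc (M - 2) M) fun n hn =>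
      ad_not_cut hM (Finset.mem_Icc.mp hn).1 (Finset.mem_Icc.mp hn).2 hd)).mono ?_
  intro f hf
  by_cases hex : ∃ s, s ≤ (M - 3) / 2 ∧ ExcessOn s (f : MvPolynomial (Fin M) ℂ)
  · left
    have hspec := Nat.find_spec hex
    refine Set.mem_biUnion (Finset.mem_coe.mpr (Finset.mem_Icc.mpr ⟨?_, hspec.1⟩))
      ⟨hspec.2, fun s hs hs' => Nat.find_min hex hs ⟨hs.le.trans hspec.1, hs'⟩⟩
    by_contra! h
    exact not_excessOn_of_le_one (by omega) _ hspec.2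
  · right
    push Not at hex
    rw [Set.mem_ofPred_eq, CondR21] at hf
    push Not at hf
    obtain ⟨c, hc, Pl, hPl, hdim⟩ := hf
    have hc2 : c ≤ 2 := by
      rcases hc with rfl | rfl | rfl <;> omega
    obtain ⟨σ, τ, hστ⟩ := exists_chart hPl
    refine Set.mem_biUnion (Finset.mem_coe.mpr (Finset.mem_Icc.mpr
      ⟨show M - 2 ≤ M - c by omega, show M - c ≤ M by omega⟩)) ⟨⟨σ, τ, fun hcut => ?_⟩, hex⟩
    exact not_le.mpr hdim (zdim_le_of_cut hcut hστ)

end Strata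

section Gram

variable {n : ℕ}

theorem MvPolynomial.IsHomogeneous.exists_eq_linP {f : MvPolynomial (Fin n) ℂ} (hf : f.IsHomogeneous 1) :
    ∃ c, f = linP c := by
  rw [← mem_homogeneousSubmodule, homogeneousSubmodule_one_eq_span_X] at hf
  have : Submodule.span ℂ (Set.range X) ≤ LinearMap.range (linP (t := n)) := by
    rw [Submodule.span_le]
    rintro _ ⟨i, rfl⟩
    exact ⟨_, linP_single i⟩
  obtain ⟨c, hc⟩ := this hf
  exact ⟨c, hc.symm⟩

theorem exists_eval_eq_sum {q : MvPolynomial (Fin n) ℂ} (hq : q.IsHomogeneous 2) :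
    ∃ A : Matrix (Fin n) (Fin n) ℂ, ∀ z, eval z q = ∑ i, ∑ j, A i j * (z i * z j) := by
  choose c hc using fun i => (hq.pderiv (i := i)).exists_eq_linP
  refine ⟨fun i j => c i j / 2, fun z => ?_⟩
  have := congrArg (eval z) hq.sum_X_mul_pderiv
  simp only [hc, map_sum, map_mul, eval_X, eval_linP, nsmul_eq_mul, Nat.cast_ofNat, map_ofNat] at this
  rw [show eval z q = (2 * eval z q) / 2 by ring, ← this, Finset.sum_div]
  refine Finset.sum_congr rfl fun i _ => ?_
  rw [dotProduct, Finset.mul_sum, Finset.sum_div]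
  exact Finset.sum_congr rfl fun j _ => by ring

/-- The Gram matrix of the quadratic part of a polynomial. -/
def gram (f : MvPolynomial (Fin n) ℂ) : Matrix (Fin n) (Fin n) ℂ := fun i j =>
  (eval (Pi.single i 1 + Pi.single j 1) (homogeneousComponent 2 f) -
    eval (Pi.single i 1) (homogeneousComponent 2 f) -
    eval (Pi.single j 1) (homogeneousComponent 2 f)) / 2

theorem gram_comm (f : MvPolynomial (Fin n) ℂ) (i j : Fin n) : gram f i j = gram f j i := by
  rw [gram, gram, add_comm]
  ring

theorem isPolyFun_gram (i j : Fin n) : IsPolyFun fun f : MvPolynomial (Fin n) ℂ => gram f i j := by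
  let ev (z : Fin n → ℂ) : MvPolynomial (Fin n) ℂ →ₗ[ℂ] ℂ :=
    (MvPolynomial.aeval z).toLinearMap ∘ₗ homogeneousComponent 2
  have := IsPolyFun.linear ((2⁻¹ : ℂ) •
    (ev (Pi.single i 1 + Pi.single j 1) - ev (Pi.single i 1) - ev (Pi.single j 1)))
  convert this using 2 with f
  simp [ev, gram, div_eq_inv_mul]

theorem eval_homogeneousComponent_two (f : MvPolynomial (Fin n) ℂ) (z : Fin n → ℂ) :
    eval z (homogeneousComponent 2 f) = ∑ i, ∑ j, gram f i j * (z i * z j) := by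
  obtain ⟨A, hA⟩ := exists_eval_eq_sum (homogeneousComponent_isHomogeneous 2 f)
  have hs : ∀ i, eval (Pi.single i 1) (homogeneousComponent 2 f) = A i i := fun i => by
    simp [hA, Pi.single_apply]
  have hg : ∀ i j, gram f i j = (A i j + A j i) / 2 := fun i j => by
    rw [gram, hs, hs, hA]
    simp only [Pi.add_apply, Pi.single_apply, mul_add, Finset.sum_add_distrib,
      mul_ite, mul_one, mul_zero, Finset.sum_ite_eq', Finset.mem_univ, if_true]
    ring
  rw [hA]
  simp_rw [hg, add_div, add_mul, Finset.sum_add_distrib]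
  rw [Finset.sum_comm (f := fun i j => A j i / 2 * (z i * z j)), ← Finset.sum_add_distrib]
  refine Finset.sum_congr rfl fun i _ => ?_
  rw [← Finset.sum_add_distrib]
  exact Finset.sum_congr rfl fun j _ => by ring

theorem exists_sum_sq {q : MvPolynomial (Fin n) ℂ} (hq : q.IsHomogeneous 2) :
    ∃ l : Fin n → ((Fin n → ℂ) →ₗ[ℂ] ℂ), ∀ z, eval z q = ∑ i, l i z ^ 2 := by
  obtain ⟨A, hA⟩ := exists_eval_eq_sum hq
  obtain ⟨w, ⟨e⟩⟩ := QuadraticForm.equivalent_weightedSumSquares A.toQuadraticForm'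
  have hn : Module.finrank ℂ (Fin n → ℂ) = n := Module.finrank_fin_fun ℂ
  choose s hs using fun i => IsAlgClosed.exists_pow_nat_eq (w i) two_pos
  refine ⟨fun i => s (Fin.cast hn.symm i) •
    (LinearMap.proj (Fin.cast hn.symm i) ∘ₗ e.toLinearEquiv.toLinearMap), fun z => ?_⟩
  have h1 : A.toQuadraticForm' z = eval z q := by
    rw [hA]
    simp [Matrix.toQuadraticForm', Matrix.toLinearMap₂'_apply, mul_comm, mul_left_comm]
  rw [← h1, ← e.map_app, QuadraticMap.weightedSumSquares_apply,
    ← (finCongr hn.symm).sum_comp]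
  refine Finset.sum_congr rfl fun i _ => ?_
  simp only [finCongr_apply, LinearMap.smul_apply, LinearMap.comp_apply, LinearMap.proj_apply,
    smul_eq_mul, mul_pow, hs, ← pow_two]
  rfl

end Gram

section Families

variable {M n : ℕ} {E : Type*} [AddCommGroup E] [Module ℂ E]

theorem monomial_mem_pol {m : Fin M →₀ ℕ} (h2 : 2 ≤ m.degree) (hn : m.degree ≤ n) (c : ℂ) :
    monomial m c ∈ Pol M n := by
  rw [mem_pol_iff]
  intro m' hm'
  rw [Finset.mem_singleton.mp (support_monomial_subset hm')]
  exact ⟨h2, hn⟩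

theorem PolyFam.ad_range [FiniteDimensional ℂ E] {q : E → MvPolynomial (Fin M) ℂ} (hq : PolyFam q)
    {d : ℕ} (hd : Module.finrank ℂ E ≤ d) : AD {f : Pol M n | ∃ v, q v = f} d := by
  classical
  have := finite_pol M n
  let S : Finset (Fin M →₀ ℕ) := (Finset.Icc 2 n).biUnion fun i => Finset.univ.finsuppAntidiag i
  have hS : ∀ m, m ∈ S ↔ 2 ≤ m.degree ∧ m.degree ≤ n := fun m => by
    simp [S, Finset.mem_finsuppAntidiag, Finsupp.degree_eq_sum, and_assoc]
  let Φ : E → Pol M n := fun v => ∑ m : S, coeff m.1 (q v) •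
    ⟨monomial m.1 1, monomial_mem_pol ((hS _).mp m.2).1 ((hS _).mp m.2).2 1⟩
  refine ((AD.of_finrank_le Set.univ hd).image (Φ := Φ) fun φ => ?_).mono ?_
  · simp only [Φ, map_sum, map_smul, smul_eq_mul]
    exact IsPolyFun.sum _ fun m _ => (hq m.1).mul (IsPolyFun.const _)
  · rintro f ⟨v, hv⟩
    refine ⟨v, Set.mem_univ _, Subtype.ext ?_⟩
    ext m
    simp only [Φ, hv, AddSubmonoidClass.coe_finsetSum, Submodule.coe_smul, coeff_sum, coeff_smul,
      coeff_monomial, smul_eq_mul, mul_ite, mul_one, mul_zero]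
    rw [Finset.sum_coe_sort S fun i => if i = m then coeff i (f : MvPolynomial (Fin M) ℂ) else 0,
      Finset.sum_ite_eq']
    refine ite_eq_left_iff.mpr fun h => ?_
    by_contra hne
    exact h ((hS m).mpr (mem_pol_iff.mp f.2 m (mem_support_iff.mpr (Ne.symm hne))))

theorem PolyFam.linP {c : E → Fin M → ℂ} (hc : ∀ j, IsPolyFun fun v => c v j) :
    PolyFam fun v => linP (c v) :=
  PolyFam.sum _ fun j _ => (PolyFam.C (hc j)).mul (PolyFam.const (X j))

/-- The polynomials with vanishing component of degree `i`. -/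
def polKer (M n i : ℕ) : Submodule ℂ (MvPolynomial (Fin M) ℂ) :=
  Pol M n ⊓ LinearMap.ker (homogeneousComponent i)

theorem finite_polKer (M n i : ℕ) : Module.Finite ℂ (polKer M n i) :=
  have := finite_pol M n
  Submodule.finiteDimensional_inf_left _ _

theorem finrank_polKer_add {i : ℕ} (h2 : 2 ≤ i) (hn : i ≤ n) :
    Module.finrank ℂ (polKer M n i) + (M + i - 1).choose i = Module.finrank ℂ (Pol M n) := by
  have := finite_pol M n
  have hrange : LinearMap.range (homogeneousComponent i ∘ₗ (Pol M n).subtype) =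
      homogeneousSubmodule (Fin M) ℂ i := by
    ext q
    constructor
    · rintro ⟨f, rfl⟩
      exact homogeneousComponent_isHomogeneous i f.1
    · intro hq
      refine ⟨⟨homogeneousComponent i q, homogeneousComponent_mem_pol h2 hn q⟩, ?_⟩
      rw [LinearMap.comp_apply, Submodule.subtype_apply]
      dsimp only
      rw [homogeneousComponent_eq_self hq, homogeneousComponent_eq_self hq]
  have := LinearMap.finrank_range_add_finrank_ker (homogeneousComponent i ∘ₗ (Pol M n).subtype)
  rwa [hrange, finrank_homogeneousSubmodule, add_comm, LinearMap.ker_comp,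
    ← Submodule.finrank_map_subtype_eq, Submodule.map_comap_subtype] at this

theorem finite_homogeneousSubmodule (t i : ℕ) : Module.Finite ℂ (homogeneousSubmodule (Fin t) ℂ i) :=
  Submodule.finiteDimensional_of_le (S₂ := restrictTotalDegree (Fin t) ℂ i) fun f hf => by
    rw [mem_restrictTotalDegree]
    exact IsHomogeneous.totalDegree_le hf

theorem exists_polKer_add_eq {i : ℕ} (h2 : 2 ≤ i) (hn : i ≤ n) {f : MvPolynomial (Fin M) ℂ}
    (hf : f ∈ Pol M n) : ∃ g : polKer M n i, homogeneousComponent i f + g.1 = f := by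
  refine ⟨⟨f - homogeneousComponent i f,
    Submodule.sub_mem _ hf (homogeneousComponent_mem_pol h2 hn f), ?_⟩, add_sub_cancel _ _⟩
  rw [SetLike.mem_coe, LinearMap.mem_ker, map_sub,
    homogeneousComponent_eq_self (homogeneousComponent_isHomogeneous i _), sub_self]

theorem rank_le_of_not_condR22 {f : MvPolynomial (Fin M) ℂ} (h : ¬ CondR22 f) :
    ∃ r ≤ 7, ∃ l : Fin r → ((Fin M → ℂ) →ₗ[ℂ] ℂ),
      ∀ z, eval z (homogeneousComponent 2 f) = ∑ i, l i z ^ 2 := by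
  have hne : {r : ℕ | ∃ l : Fin r → ((Fin M → ℂ) →ₗ[ℂ] ℂ),
      ∀ z ∈ Set.univ, eval z (homogeneousComponent 2 f) = ∑ i, l i z ^ 2}.Nonempty := by
    obtain ⟨l, hl⟩ := exists_sum_sq (homogeneousComponent_isHomogeneous 2 f)
    exact ⟨M, l, fun z _ => hl z⟩
  obtain ⟨l, hl⟩ := Nat.sInf_mem hne
  rw [CondR22, not_le, rankOn] at h
  exact ⟨_, Nat.le_of_lt_succ h, l, fun z => hl z (Set.mem_univ z)⟩

theorem not_condR22_of_sum {f : MvPolynomial (Fin M) ℂ} {r : ℕ} (hr : r ≤ 7)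
    (l : Fin r → ((Fin M → ℂ) →ₗ[ℂ] ℂ))
    (hl : ∀ z, eval z (homogeneousComponent 2 f) = ∑ i, l i z ^ 2) : ¬ CondR22 f := by
  rw [CondR22, not_le]
  have : r ∈ {r : ℕ | ∃ l : Fin r → ((Fin M → ℂ) →ₗ[ℂ] ℂ),
      ∀ z ∈ Set.univ, eval z (homogeneousComponent 2 f) = ∑ i, l i z ^ 2} := ⟨l, fun z _ => hl z⟩
  exact Nat.lt_succ_of_le ((Nat.sInf_le this).trans hr)

theorem exists_chart_of_rank_le {f : MvPolynomial (Fin M) ℂ} {r : ℕ}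
    (l : Fin r → ((Fin M → ℂ) →ₗ[ℂ] ℂ))
    (hl : ∀ z, eval z (homogeneousComponent 2 f) = ∑ i, l i z ^ 2) :
    ∃ t ≤ r, ∃ (σ : Fin t ↪ Fin M) (τ : Chart σ) (Q : homogeneousSubmodule (Fin t) ℂ 2),
      homogeneousComponent 2 f = aeval (fun k => linP fun j => chartRow σ τ j k) Q.1 := by
  choose c hc using fun i => exists_linP_eq (l i)
  have hT : Module.finrank ℂ (Submodule.span ℂ (Set.range c)) ≤ r := by
    simpa [Set.finrank] using finrank_range_le_card (R := ℂ) c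
  obtain ⟨σ, τ, h⟩ := exists_chart (T := Submodule.span ℂ (Set.range c)) rfl
  choose x hx using fun i => (h (c i)).mp (Submodule.subset_span ⟨i, rfl⟩)
  refine ⟨_, hT, σ, τ, ⟨∑ i, linP (x i) ^ 2, ?_⟩, ?_⟩
  · refine Submodule.sum_mem _ fun i _ => ?_
    exact (linP_isHomogeneous (x i)).pow 2
  · refine MvPolynomial.funext fun z => ?_
    rw [hl, eval_aeval]
    simp only [map_sum, map_pow, eval_linP]
    refine Finset.sum_congr rfl fun i _ => ?_
    congr 1
    rw [← hc, hx]
    simp only [dotProduct, Finset.mul_sum, Finset.sum_mul]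
    rw [Finset.sum_comm]
    exact Finset.sum_congr rfl fun k _ => Finset.sum_congr rfl fun j _ => by ring

theorem choose_two_eq (hM : 7 ≤ M) : (M + 1).choose 2 + 21 = (M - 7) * (M - 6) / 2 + 7 * M := by
  obtain ⟨m, rfl⟩ := Nat.exists_eq_add_of_le hM
  rw [Nat.choose_two_right, show 7 + m - 7 = m by omega, show 7 + m - 6 = m + 1 by omega,
    show (7 + m + 1) * (7 + m + 1 - 1) = m * (m + 1) + 2 * (7 * m + 28) by
      rw [Nat.add_sub_cancel]; ring, Nat.add_mul_div_left _ _ two_pos]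
  ring

theorem polyFam_chart {t : ℕ} {H K : Type*} [AddCommGroup H] [Module ℂ H] [AddCommGroup K] [Module ℂ K]
    (σ : Fin t ↪ Fin M) (ι : H →ₗ[ℂ] MvPolynomial (Fin t) ℂ) (S : Finset (Fin t →₀ ℕ))
    (hS : ∀ Q, (ι Q).support ⊆ S) (κ : K →ₗ[ℂ] MvPolynomial (Fin M) ℂ) :
    PolyFam fun v : Chart σ × H × K =>
      aeval (fun k => linP fun j => chartRow σ v.1 j k) (ι v.2.1) + κ v.2.2 := by
  have h1 : PolyFam fun v : Chart σ × H × K => ι v.2.1 := fun m => IsPolyFun.linear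
    (lcoeff ℂ m ∘ₗ ι ∘ₗ LinearMap.fst ℂ H K ∘ₗ LinearMap.snd ℂ (Chart σ) (H × K))
  have h2 : PolyFam fun v : Chart σ × H × K => κ v.2.2 := fun m => IsPolyFun.linear
    (lcoeff ℂ m ∘ₗ κ ∘ₗ LinearMap.snd ℂ H K ∘ₗ LinearMap.snd ℂ (Chart σ) (H × K))
  have h3 : ∀ k, PolyFam fun v : Chart σ × H × K =>
      (linP fun j => chartRow σ v.1 j k : MvPolynomial (Fin M) ℂ) := by
    refine fun k => PolyFam.linP fun j => ?_
    by_cases h : j ∈ Set.range σ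
    · simp only [chartRow, dif_pos h]
      exact IsPolyFun.const _
    · simp only [chartRow, dif_neg h]
      let φ : Chart σ →ₗ[ℂ] Fin t → ℂ := LinearMap.proj
        (φ := fun _ : {j // j ∉ Set.range σ} => Fin t → ℂ) ⟨j, h⟩
      let ψ : (Fin t → ℂ) →ₗ[ℂ] ℂ := LinearMap.proj (φ := fun _ => ℂ) k
      exact (IsPolyFun.linear (ψ ∘ₗ φ)).comp_linear (LinearMap.fst ℂ (Chart σ) (H × K))
  exact (h1.aeval S (fun v => hS _) h3).add h2

theorem ad_not_condR22 (hM : 8 ≤ M) {d : ℕ}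
    (hd : Module.finrank ℂ (Pol M M) ≤ d + (M - 7) * (M - 6) / 2) :
    AD {f : Pol M M | ¬ CondR22 (f : MvPolynomial (Fin M) ℂ)} d := by
  have := finite_pol M M
  have hker := finrank_polKer_add (M := M) le_rfl (show 2 ≤ M by omega)
  have hch := choose_two_eq (M := M) (by omega)
  have key : ∀ t ∈ Finset.range 8, ∀ σ : Fin t ↪ Fin M,
      AD {f : Pol M M | ∃ v : Chart σ × homogeneousSubmodule (Fin t) ℂ 2 × polKer M M 2,
        aeval (fun k => linP fun j => chartRow σ v.1 j k) v.2.1.1 + v.2.2.1 = f.1} d := by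
    intro t ht σ
    have := finite_homogeneousSubmodule t 2
    have := finite_polKer M M 2
    refine PolyFam.ad_range (polyFam_chart (K := polKer M M 2) σ (homogeneousSubmodule (Fin t) ℂ 2).subtype
      (Finset.univ.finsuppAntidiag 2) (fun Q m hm => ?_)
      (polKer M M 2).subtype) ?_
    · rw [Finset.mem_finsuppAntidiag]
      refine ⟨?_, Finset.subset_univ _⟩
      have := Q.2 (mem_support_iff.mp hm)
      simpa [Finsupp.weight_apply, Finsupp.sum_fintype] using this
    · rw [Module.finrank_prod, Module.finrank_prod, Module.finrank_pi_fintype,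
        finrank_homogeneousSubmodule]
      simp only [Module.finrank_fintype_fun_eq_card, Fintype.card_fin, Finset.sum_const,
        Finset.card_univ, smul_eq_mul]
      rw [Fintype.card_subtype_compl, Fintype.card_fin, Fintype.card_range, Fintype.card_fin]
      rw [show M + 2 - 1 = M + 1 by omega] at hker
      rw [Finset.mem_range] at ht
      clear σ
      generalize (M + 1).choose 2 = C₁ at *
      generalize (M - 7) * (M - 6) / 2 = C₂ at *
      generalize Module.finrank ℂ (polKer M M 2) = k at *
      interval_cases t <;> simp [Nat.choose] <;> omega
  refine (AD.biUnion _ fun t ht => AD.iUnion fun σ => key t ht σ).mono ?_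
  intro f hf
  obtain ⟨r, hr, l, hl⟩ := rank_le_of_not_condR22 hf
  obtain ⟨t, ht, σ, τ, Q, hQ⟩ := exists_chart_of_rank_le l hl
  obtain ⟨g, hg⟩ := exists_polKer_add_eq le_rfl (show 2 ≤ M by omega) f.2
  rw [hQ] at hg
  exact Set.mem_biUnion (Finset.mem_coe.mpr (Finset.mem_range.mpr (show t < 8 by omega)))
    (Set.mem_iUnion.mpr ⟨σ, ⟨τ, Q, g⟩, hg⟩)

end Families

section Pencils

variable {M : ℕ}

theorem polyFam_pencil {K : Type*} [AddCommGroup K] [Module ℂ K] (κ : K →ₗ[ℂ] MvPolynomial (Fin M) ℂ) :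
    PolyFam fun v : (Fin 3 → Fin M → ℂ) × (Fin 3 → Fin 2 → ℂ) × K =>
      (∏ i, (C (v.2.1 i 0) * linP (v.1 0) + C (v.2.1 i 1) * linP (v.1 1))) +
        linP (v.1 2) * homogeneousComponent 2 (κ v.2.2) + κ v.2.2 := by
  have h1 : PolyFam fun v : (Fin 3 → Fin M → ℂ) × (Fin 3 → Fin 2 → ℂ) × K => κ v.2.2 :=
    fun m => IsPolyFun.linear (lcoeff ℂ m ∘ₗ κ ∘ₗ LinearMap.snd ℂ (Fin 3 → Fin 2 → ℂ) K ∘ₗ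
      LinearMap.snd ℂ (Fin 3 → Fin M → ℂ) ((Fin 3 → Fin 2 → ℂ) × K))
  have h2 : ∀ a, PolyFam fun v : (Fin 3 → Fin M → ℂ) × (Fin 3 → Fin 2 → ℂ) × K =>
      (linP (v.1 a) : MvPolynomial (Fin M) ℂ) := by
    refine fun a => PolyFam.linP fun j => ?_
    exact IsPolyFun.linear ((LinearMap.proj j : (Fin M → ℂ) →ₗ[ℂ] ℂ) ∘ₗ
      (LinearMap.proj a : (Fin 3 → Fin M → ℂ) →ₗ[ℂ] _) ∘ₗ
      LinearMap.fst ℂ (Fin 3 → Fin M → ℂ) ((Fin 3 → Fin 2 → ℂ) × K))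
  have h3 : ∀ i k, PolyFam fun v : (Fin 3 → Fin M → ℂ) × (Fin 3 → Fin 2 → ℂ) × K =>
      (C (v.2.1 i k) : MvPolynomial (Fin M) ℂ) := by
    refine fun i k => PolyFam.C ?_
    exact IsPolyFun.linear ((LinearMap.proj k : (Fin 2 → ℂ) →ₗ[ℂ] ℂ) ∘ₗ
      (LinearMap.proj i : (Fin 3 → Fin 2 → ℂ) →ₗ[ℂ] _) ∘ₗ LinearMap.fst ℂ (Fin 3 → Fin 2 → ℂ) K ∘ₗ
      LinearMap.snd ℂ (Fin 3 → Fin M → ℂ) ((Fin 3 → Fin 2 → ℂ) × K))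
  exact ((PolyFam.prod Finset.univ fun i _ => ((h3 i 0).mul (h2 0)).add ((h3 i 1).mul (h2 1))).add
    ((h2 2).mul (h1.homogeneousComponent 2))).add h1

theorem ad_not_condR23 (hM : 8 ≤ M) {d : ℕ}
    (hd : Module.finrank ℂ (Pol M M) ≤ d + (M - 7) * (M - 6) / 2) :
    AD {f : Pol M M | ¬ CondR23 (f : MvPolynomial (Fin M) ℂ)} d := by
  have := finite_pol M M
  have := finite_polKer M M 3
  have hker := finrank_polKer_add (M := M) (i := 3) (by norm_num) (show 3 ≤ M by omega)
  have hch := choose_two_eq (M := M) (by omega)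
  rw [show M + 3 - 1 = M + 1 + 1 by omega, Nat.choose_succ_succ'] at hker
  refine (PolyFam.ad_range (d := d) (polyFam_pencil (polKer M M 3).subtype) ?_).mono ?_
  · rw [Module.finrank_prod, Module.finrank_prod]
    simp only [Module.finrank_pi_fintype, Module.finrank_self, Fintype.card_fin, Finset.sum_const,
      Finset.card_univ, smul_eq_mul]
    norm_num at hker ⊢
    omega
  · intro f hf
    obtain ⟨a, b, l, l₁, l₂, l₃, ha, hb, hl, h1, h2, h3, h⟩ := not_not.mp hf
    obtain ⟨g, hg⟩ := exists_polKer_add_eq (i := 3) (by norm_num) (show 3 ≤ M by omega) f.2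
    obtain ⟨α, rfl⟩ := ha.exists_eq_linP
    obtain ⟨β, rfl⟩ := hb.exists_eq_linP
    obtain ⟨γ, rfl⟩ := hl.exists_eq_linP
    obtain ⟨s₁, t₁, rfl⟩ := Submodule.mem_span_pair.mp h1
    obtain ⟨s₂, t₂, rfl⟩ := Submodule.mem_span_pair.mp h2
    obtain ⟨s₃, t₃, rfl⟩ := Submodule.mem_span_pair.mp h3
    have hfg : homogeneousComponent 2 g.1 = homogeneousComponent 2 f.1 := by
      conv_rhs => rw [← hg]
      rw [map_add, homogeneousComponent_of_mem (homogeneousComponent_isHomogeneous 3 f.1),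
        if_neg (by norm_num), zero_add]
    refine ⟨⟨![α, β, γ], ![![s₁, t₁], ![s₂, t₂], ![s₃, t₃]], g⟩, ?_⟩
    conv_rhs => rw [← hg, h]
    simp [Fin.prod_univ_three, hfg, smul_eq_C_mul]

end Pencils

section Lower

theorem IsPolyFun.eq_zero_of_mul_eq_zero {E : Type*} [AddCommGroup E] [Module ℂ E] [FiniteDimensional ℂ E]
    {g h : E → ℂ} (hg : IsPolyFun g) (hh : IsPolyFun h) (hgh : ∀ v, g v * h v = 0) {v₀ : E}
    (h0 : h v₀ ≠ 0) (v : E) : g v = 0 := by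
  obtain ⟨p, hp⟩ := isPolyFun_iff.mp hg
  obtain ⟨q, hq⟩ := isPolyFun_iff.mp hh
  have hpq : p * q = 0 := by
    refine MvPolynomial.funext fun x => ?_
    have := hgh ((coordE E).symm x)
    rwa [hp, hq, LinearEquiv.apply_symm_apply, ← map_mul, ← map_zero (MvPolynomial.eval x)] at this
  rcases mul_eq_zero.mp hpq with rfl | rfl
  · rw [hp, map_zero]
  · exact (h0 (by rw [hq, map_zero])).elim

variable {m n : ℕ}

/-- The quadratic forms in all but the first seven variables. -/
def tailForms (m n : ℕ) : Submodule ℂ (Pol (7 + m) n) :=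
  ((homogeneousSubmodule (Fin m) ℂ 2).map (rename (Fin.natAdd 7)).toLinearMap).comap (Pol (7 + m) n).subtype

theorem finrank_tailForms_le : Module.finrank ℂ (tailForms m n) ≤ (m + 1).choose 2 := by
  have := finite_homogeneousSubmodule m 2
  rw [← Submodule.finrank_map_subtype_eq, tailForms, Submodule.map_comap_subtype]
  refine (Submodule.finrank_mono inf_le_right).trans ?_
  refine (Submodule.finrank_map_le _ _).trans ?_
  rw [finrank_homogeneousSubmodule, show m + 2 - 1 = m + 1 by omega]

theorem sum_quadratic_isHomogeneous {t : ℕ} (A : Matrix (Fin t) (Fin t) ℂ) :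
    (∑ i, ∑ j, C (A i j) * (X i * X j)).IsHomogeneous 2 := by
  refine IsHomogeneous.sum _ _ _ fun i _ => IsHomogeneous.sum _ _ _ fun j _ => ?_
  simpa using (isHomogeneous_C _ (A i j)).mul ((isHomogeneous_X ℂ i).mul (isHomogeneous_X ℂ j))

theorem eval_sum_quadratic {t : ℕ} (A : Matrix (Fin t) (Fin t) ℂ) (x : Fin t → ℂ) :
    eval x (∑ i, ∑ j, C (A i j) * (X i * X j)) = x ⬝ᵥ A.mulVec x := by
  simp only [map_sum, map_mul, eval_C, eval_X, dotProduct, Matrix.mulVec, Finset.mul_sum]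
  exact Finset.sum_congr rfl fun i _ => Finset.sum_congr rfl fun j _ => by ring

/-- The determinant of the Gram matrix in the first seven variables. -/
def headDet (f : MvPolynomial (Fin (7 + m)) ℂ) : ℂ :=
  ((gram f).submatrix (Fin.castAdd m) (Fin.castAdd m)).det

theorem exists_tailForm_not_condR22 (hn : 2 ≤ n) (f : Pol (7 + m) n) (hf : headDet f.1 ≠ 0) :
    ∃ l ∈ tailForms m n, ¬ CondR22 (f + l).1 := by
  let S := (gram f.1).submatrix (Fin.castAdd m) (Fin.castAdd m)
  let B := (gram f.1).submatrix (Fin.castAdd m) (Fin.natAdd 7 : Fin m → _)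
  let D := (gram f.1).submatrix (Fin.natAdd 7) (Fin.natAdd 7 : Fin m → _)
  let T := S⁻¹ * B
  have hST : S * T = B := by
    rw [← Matrix.mul_assoc, Matrix.mul_nonsing_inv _ (isUnit_iff_ne_zero.mpr hf), Matrix.one_mul]
  have hS : S.transpose = S := by
    ext i j
    exact gram_comm _ _ _
  let Λ : MvPolynomial (Fin m) ℂ := ∑ i, ∑ j, C ((T.transpose * B - D) i j) * (X i * X j)
  have hΛ : Λ.IsHomogeneous 2 := sum_quadratic_isHomogeneous _
  have hΛ' : (rename (Fin.natAdd 7) Λ).IsHomogeneous 2 := hΛ.rename_isHomogeneous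
  have hmem : rename (Fin.natAdd 7) Λ ∈ Pol (7 + m) n := by
    rw [← homogeneousComponent_eq_self hΛ']
    exact homogeneousComponent_mem_pol le_rfl hn _
  refine ⟨⟨_, hmem⟩, ⟨Λ, hΛ, rfl⟩, ?_⟩
  obtain ⟨l, hl⟩ := exists_sum_sq (sum_quadratic_isHomogeneous S)
  let W : (Fin (7 + m) → ℂ) →ₗ[ℂ] Fin 7 → ℂ :=
    LinearMap.funLeft ℂ ℂ (Fin.castAdd m) + T.mulVecLin ∘ₗ LinearMap.funLeft ℂ ℂ (Fin.natAdd 7)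
  refine not_condR22_of_sum le_rfl (fun i => l i ∘ₗ W) fun z => ?_
  simp only [LinearMap.comp_apply]
  rw [← hl, eval_sum_quadratic, Submodule.coe_add, map_add, homogeneousComponent_eq_self hΛ', map_add,
    eval_rename, eval_sum_quadratic]
  obtain ⟨x, hx⟩ : ∃ x, x = z ∘ Fin.castAdd m := ⟨_, rfl⟩
  obtain ⟨y, hy⟩ : ∃ y, y = z ∘ Fin.natAdd 7 := ⟨_, rfl⟩
  have hW : W z = x + T.mulVec y := by rw [hx, hy]; rfl
  have hfz : eval z (homogeneousComponent 2 f.1) =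
      x ⬝ᵥ S.mulVec x + 2 * (x ⬝ᵥ B.mulVec y) + y ⬝ᵥ D.mulVec y := by
    have h1 : ∑ i, ∑ j, gram f.1 (Fin.natAdd 7 i) (Fin.castAdd m j) * (y i * x j) =
        ∑ i, ∑ j, gram f.1 (Fin.castAdd m i) (Fin.natAdd 7 j) * (x i * y j) := by
      rw [Finset.sum_comm]
      exact Finset.sum_congr rfl fun i _ => Finset.sum_congr rfl fun j _ => by
        rw [gram_comm, mul_comm (x i)]
    have h2 : ∀ {s t : ℕ} (A : Matrix (Fin s) (Fin t) ℂ) (u : Fin s → ℂ) (v : Fin t → ℂ),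
        u ⬝ᵥ A.mulVec v = ∑ i, ∑ j, A i j * (u i * v j) := fun A u v => by
      simp only [dotProduct, Matrix.mulVec, Finset.mul_sum]
      exact Finset.sum_congr rfl fun i _ => Finset.sum_congr rfl fun j _ => by ring
    have hxz : ∀ i, z (Fin.castAdd m i) = x i := fun i => by rw [hx]; rfl
    have hyz : ∀ i, z (Fin.natAdd 7 i) = y i := fun i => by rw [hy]; rfl
    rw [eval_homogeneousComponent_two, Fin.sum_univ_add]
    simp only [Fin.sum_univ_add, Finset.sum_add_distrib, hxz, hyz, h1, h2]
    simp only [S, B, D, Matrix.submatrix_apply]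
    ring
  rw [hW, hfz, ← hy]
  have h1 : T.mulVec y ⬝ᵥ S.mulVec x = x ⬝ᵥ B.mulVec y := by
    rw [Matrix.dotProduct_mulVec, ← Matrix.mulVec_transpose, hS, Matrix.mulVec_mulVec, hST, dotProduct_comm]
  have h2 : y ⬝ᵥ (T.transpose * B).mulVec y = T.mulVec y ⬝ᵥ B.mulVec y := by
    rw [← Matrix.mulVec_mulVec, Matrix.dotProduct_mulVec, Matrix.vecMul_transpose]
  rw [Matrix.mulVec_add, add_dotProduct, dotProduct_add, dotProduct_add, Matrix.mulVec_mulVec, hST, h1,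
    Matrix.sub_mulVec, dotProduct_sub, h2]
  ring

theorem exists_headDet_ne_zero (hn : 2 ≤ n) : ∃ f : Pol (7 + m) n, headDet f.1 ≠ 0 := by
  let q : MvPolynomial (Fin (7 + m)) ℂ := ∑ i, X (Fin.castAdd m i) ^ 2
  have hq : q.IsHomogeneous 2 := IsHomogeneous.sum _ _ _ fun i _ => by
    simpa using (isHomogeneous_X ℂ (Fin.castAdd m i)).pow 2
  refine ⟨⟨q, by
    rw [← homogeneousComponent_eq_self hq]
    exact homogeneousComponent_mem_pol le_rfl hn _⟩, ?_⟩
  have h1 : (gram q).submatrix (Fin.castAdd m) (Fin.castAdd m) = 1 := by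
    ext i j
    rw [Matrix.submatrix_apply, gram, homogeneousComponent_eq_self hq]
    simp only [q, map_sum, map_pow, eval_X, Pi.add_apply, Pi.single_apply, Fin.castAdd_inj,
      Matrix.one_apply]
    simp only [add_sq, ite_pow, one_pow, mul_ite, mul_one, Finset.sum_add_distrib]
    by_cases hij : i = j
    · simp [hij]
    · simp [hij, Ne.symm hij]
  rw [headDet, h1, Matrix.det_one]
  exact one_ne_zero

theorem le_zdim_zclosure_not_condR22 (hn : 2 ≤ n) {A : Set (Pol (7 + m) n)}
    (hA : ∀ f : Pol (7 + m) n, ¬ CondR22 f.1 → f ∈ A) {d : ℕ}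
    (hd : d + (m + 1).choose 2 ≤ Module.finrank ℂ (Pol (7 + m) n)) : d ≤ zdim (zclosure A) := by
  have := finite_pol (7 + m) n
  let φ : Pol (7 + m) n →ₗ[ℂ] Fin (Module.finrank ℂ (Pol (7 + m) n ⧸ tailForms m n)) → ℂ :=
    (Module.finBasis ℂ (Pol (7 + m) n ⧸ tailForms m n)).equivFun.toLinearMap ∘ₗ (tailForms m n).mkQ
  have hφ : Function.Surjective φ := by
    rw [LinearMap.coe_comp]
    exact (LinearEquiv.surjective _).comp (Submodule.mkQ_surjective _)
  have hd' : d ≤ Module.finrank ℂ (Pol (7 + m) n ⧸ tailForms m n) := by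
    have := Submodule.finrank_quotient_add_finrank (tailForms m n)
    have := finrank_tailForms_le (m := m) (n := n)
    omega
  refine le_trans ?_ (le_zdim_zclosure (f := fun i v => φ v i)
    (fun i => IsPolyFun.linear (LinearMap.proj i ∘ₗ φ)) fun F hF => ?_)
  · exact_mod_cast hd'
  · obtain ⟨f₀, hf₀⟩ := exists_headDet_ne_zero (m := m) hn
    have hdet : IsPolyFun fun v : Pol (7 + m) n => headDet v.1 := by
      refine IsPolyFun.det fun i j => ?_
      exact (isPolyFun_gram _ _).comp_linear (Pol (7 + m) n).subtype
    have hFφ : IsPolyFun fun v : Pol (7 + m) n => eval (φ v) F := ⟨_, φ, F, fun _ => rfl⟩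
    have h0 := hFφ.eq_zero_of_mul_eq_zero hdet (fun v => ?_) hf₀
    · refine MvPolynomial.funext fun x => ?_
      obtain ⟨v, rfl⟩ := hφ x
      rw [h0, map_zero]
    · by_cases hv : headDet v.1 = 0
      · rw [hv, mul_zero]
      · obtain ⟨l, hl, hvl⟩ := exists_tailForm_not_condR22 hn v hv
        have h1 : φ (v + l) = φ v := by
          rw [map_add, add_eq_left]
          simp [φ, (Submodule.Quotient.mk_eq_zero _).mpr hl]
        have h2 := hF _ (hA _ hvl)
        change eval (φ (v + l)) F = 0 at h2
        rw [← h1, h2, zero_mul]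

end Lower

section Main

variable {M : ℕ}

theorem zdim_zclosure_of_le_seven (hM : M ≤ 7) {A : Set (Pol M M)}
    (hA : ∀ f : Pol M M, ¬ CondR22 f.1 → f ∈ A) :
    zdim (zclosure A) = Module.finrank ℂ (Pol M M) := by
  have := finite_pol M M
  refine le_antisymm (AD.of_finrank _).zdim_le (le_zdim_zclosure (f := fun i v => coordE (Pol M M) v i)
    (fun i => IsPolyFun.linear (LinearMap.proj i ∘ₗ (coordE (Pol M M)).toLinearMap)) fun F hF => ?_)
  refine MvPolynomial.funext fun x => ?_
  obtain ⟨v, rfl⟩ := (coordE (Pol M M)).surjective x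
  obtain ⟨l, hl⟩ := exists_sum_sq (homogeneousComponent_isHomogeneous 2 v.1)
  rw [map_zero]
  exact hF v (hA v (not_condR22_of_sum hM l hl))

theorem ad_compl_psingReg (hM : 8 ≤ M) {d : ℕ}
    (hd : Module.finrank ℂ (Pol M M) ≤ d + (M - 7) * (M - 6) / 2) : AD (PsingReg M)ᶜ d := by
  refine (((ad_not_condR21 hM hd).union (ad_not_condR22 hM hd)).union (ad_not_condR23 hM hd)).mono ?_
  intro f hf
  simp only [Set.mem_union, Set.mem_ofPred_eq]
  by_contra! h
  exact hf ⟨h.1.1, h.1.2, h.2⟩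

end Main

/-- Proposition 2.5: the Zariski closure of the complement
`𝒫^sing \ 𝒫^sing_reg` has codimension exactly `(M−7)(M−6)/2` in `𝒫^sing`. -/
theorem codim_Psing_reg (M : ℕ) :
    zdim (zclosure ((PsingReg M)ᶜ)) + (((M - 7) * (M - 6) / 2 : ℕ) : ℕ∞)
      = ((Module.finrank ℂ ↥(Psing M) : ℕ∞) : WithBot ℕ∞) := by
  have hA : ∀ f : Pol M M, ¬ CondR22 f.1 → f ∈ (PsingReg M)ᶜ := fun f hf h => hf h.2.1
  rcases Nat.lt_or_ge M 8 with hM | hM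
  · have hM' : M ≤ 7 := by omega
    have h : zdim (zclosure ((PsingReg M)ᶜ)) = Module.finrank ℂ (Psing M) :=
      zdim_zclosure_of_le_seven hM' hA
    rw [h, Nat.sub_eq_zero_of_le hM', zero_mul, Nat.zero_div]
    simp
  · have hr : (M - 7) * (M - 6) / 2 ≤ Module.finrank ℂ (Pol M M) := by
      have := choose_two_eq (M := M) (by omega)
      have := finrank_polKer_add (M := M) (n := M) le_rfl (by omega : 2 ≤ M)
      rw [show M + 2 - 1 = M + 1 by omega] at this
      omega
    obtain ⟨d, hd⟩ := Nat.exists_eq_add_of_le' hr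
    have hlow : (d : WithBot ℕ∞) ≤ zdim (zclosure ((PsingReg M)ᶜ)) := by
      obtain ⟨m, rfl⟩ := Nat.exists_eq_add_of_le (by omega : 7 ≤ M)
      refine le_zdim_zclosure_not_condR22 (by omega) hA ?_
      rw [hd, Nat.choose_two_right, Nat.add_sub_cancel, show 7 + m - 7 = m by omega,
        show 7 + m - 6 = m + 1 by omega, mul_comm m]
    have : FiniteDimensional ℂ (Psing M) := finite_pol M M
    rw [le_antisymm (ad_compl_psingReg hM hd.le).zclosure.zdim_le hlow]
    change _ = ((Module.finrank ℂ (Pol M M) : ℕ∞) : WithBot ℕ∞)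
    rw [hd]
    norm_cast
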